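/- Assume (H1): for each θ∈Θ, A_θ = σ_θσ_θ^T where σ_θ: 𝕋^N → M_N(ℝ) is Lipschitz with |σ_θ| ≤ C and Lipschitz constant ≤ C uniformly in θ; (H2): each H_θ: 𝕋^N×ℝ^N → ℝ satisfies |H_θ(x,0)| ≤ C and is Lipschitz on 𝕋^N×B(0,R) with constant C_R independent of θ for every R>0; and the superlinearity condition (BS): there exists L₁ ≥ 1 such that for almost every (x,p) ∈ 𝕋^N×ℝ^N with |p| ≥ L₁ and every θ∈Θ, L₁[⟨D_pH_θ(x,p),p⟩ − H_θ(x,p) − |2σ_θ(x)(D_xσ_θ^T)(x)||p| − sup_y|H_θ(y,0)|] − |D_xH_θ(x,p)| − N(sup_y|D_xσ_θ(y)|)²|p| ≥ 0. Then: (a) for every Lipschitz initial datum u₀ the Cauchy problem (CP) has a continuous viscosity solution u Lipschitz in x with a constant independent of t, and for every λ>0 the approximate stationary equation λv_λ + sup_θ{−trace(A_θD²v_λ)+H_θ(x,Dv_λ)} = 0 has a continuous viscosity solution v_λ Lipschitz with a constant independent of λ; (b) the comparison principle holds for (CP) and for the stationary equations; (c) the ergodic problem sup_θ{−trace(A_θ(x)D²v)+H_θ(x,Dv)}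 = c has a solution (c,v) ∈ ℝ×W^{1,∞}(𝕋^N). -/

import Mathlib

open Filter
open scoped RealInnerProductSpace Matrix

noncomputable section

namespace LargeTimeBehavior

/-- Euclidean space ℝ^N; ℤ^N-periodic functions on it represent functions on the torus 𝕋^N. -/
abbrev E (N : ℕ) := EuclideanSpace ℝ (Fin N)

variable {N : ℕ} {Θ : Type*}

/-- `f` is ℤ^N-periodic. -/
def ZPeriodic {α : Type*} (f : E N → α) : Prop :=
  ∀ (x : E N) (k : Fin N → ℤ), f (x + (WithLp.equiv 2 (Fin N → ℝ)).symm fun i => (k i : ℝ)) = f x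

/-- Hessian matrix of a real function on ℝ^N. -/
def hessMatrix (φ : E N → ℝ) (x : E N) : Matrix (Fin N) (Fin N) ℝ :=
  Matrix.of fun i j =>
    fderiv ℝ (fun y => fderiv ℝ φ y (EuclideanSpace.single j 1)) x (EuclideanSpace.single i 1)

/-- The totally degenerate set Σ = {x : A_θ(x) = 0 for all θ}. -/
def degenSet (A : Θ → E N → Matrix (Fin N) (Fin N) ℝ) : Set (E N) :=
  {x | ∀ θ, A θ x = 0}

/-- Value of the operator −trace(A_θ(x)D²φ) + H_θ(x,Dφ) on a C² test function φ at x. -/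
def opVal (A : Θ → E N → Matrix (Fin N) (Fin N) ℝ) (H : Θ → E N → E N → ℝ)
    (θ : Θ) (x : E N) (φ : E N → ℝ) : ℝ :=
  -Matrix.trace (A θ x * hessMatrix φ x) + H θ x (gradient φ x)

/-- Viscosity subsolution of ∂u/∂t + sup_θ{−tr(A_θD²u)+H_θ(x,Du)} = 0 on ℝ^N×(0,∞). -/
def IsSubSolCP (A : Θ → E N → Matrix (Fin N) (Fin N) ℝ) (H : Θ → E N → E N → ℝ)
    (u : E N → ℝ → ℝ) : Prop :=
  ∀ φ : E N → ℝ → ℝ, ContDiff ℝ 2 (fun q : E N × ℝ => φ q.1 q.2) →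
    ∀ (x₀ : E N) (t₀ : ℝ), 0 < t₀ →
      IsLocalMax (fun q : E N × ℝ => u q.1 q.2 - φ q.1 q.2) (x₀, t₀) →
      deriv (φ x₀) t₀ + (⨆ θ, opVal A H θ x₀ fun y => φ y t₀) ≤ 0

/-- Viscosity supersolution of the Cauchy problem. -/
def IsSuperSolCP (A : Θ → E N → Matrix (Fin N) (Fin N) ℝ) (H : Θ → E N → E N → ℝ)
    (u : E N → ℝ → ℝ) : Prop :=
  ∀ φ : E N → ℝ → ℝ, ContDiff ℝ 2 (fun q : E N × ℝ => φ q.1 q.2) →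
    ∀ (x₀ : E N) (t₀ : ℝ), 0 < t₀ →
      IsLocalMin (fun q : E N × ℝ => u q.1 q.2 - φ q.1 q.2) (x₀, t₀) →
      0 ≤ deriv (φ x₀) t₀ + (⨆ θ, opVal A H θ x₀ fun y => φ y t₀)

/-- Viscosity solution of the Cauchy problem. -/
def IsSolCP (A : Θ → E N → Matrix (Fin N) (Fin N) ℝ) (H : Θ → E N → E N → ℝ)
    (u : E N → ℝ → ℝ) : Prop :=
  IsSubSolCP A H u ∧ IsSuperSolCP A H u

/-- Viscosity subsolution of the ergodic problem sup_θ{−tr(A_θD²v)+H_θ(x,Dv)} = c. -/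
def IsSubSolErg (A : Θ → E N → Matrix (Fin N) (Fin N) ℝ) (H : Θ → E N → E N → ℝ)
    (c : ℝ) (v : E N → ℝ) : Prop :=
  ∀ φ : E N → ℝ, ContDiff ℝ 2 φ → ∀ x₀ : E N,
    IsLocalMax (fun x => v x - φ x) x₀ → (⨆ θ, opVal A H θ x₀ φ) ≤ c

/-- Viscosity supersolution of the ergodic problem. -/
def IsSuperSolErg (A : Θ → E N → Matrix (Fin N) (Fin N) ℝ) (H : Θ → E N → E N → ℝ)
    (c : ℝ) (v : E N → ℝ) : Prop :=
  ∀ φ : E N → ℝ, ContDiff ℝ 2 φ → ∀ x₀ : E N,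
    IsLocalMin (fun x => v x - φ x) x₀ → c ≤ (⨆ θ, opVal A H θ x₀ φ)

/-- Viscosity solution of the ergodic problem. -/
def IsSolErg (A : Θ → E N → Matrix (Fin N) (Fin N) ℝ) (H : Θ → E N → E N → ℝ)
    (c : ℝ) (v : E N → ℝ) : Prop :=
  IsSubSolErg A H c v ∧ IsSuperSolErg A H c v

/-- Viscosity subsolution of the discounted equation λw + sup_θ{−tr(A_θD²w)+H_θ(x,Dw)} = 0. -/
def IsSubSolDisc (A : Θ → E N → Matrix (Fin N) (Fin N) ℝ) (H : Θ → E N → E N → ℝ)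
    (lam : ℝ) (w : E N → ℝ) : Prop :=
  ∀ φ : E N → ℝ, ContDiff ℝ 2 φ → ∀ x₀ : E N,
    IsLocalMax (fun x => w x - φ x) x₀ → lam * w x₀ + (⨆ θ, opVal A H θ x₀ φ) ≤ 0

/-- Viscosity supersolution of the discounted equation. -/
def IsSuperSolDisc (A : Θ → E N → Matrix (Fin N) (Fin N) ℝ) (H : Θ → E N → E N → ℝ)
    (lam : ℝ) (w : E N → ℝ) : Prop :=
  ∀ φ : E N → ℝ, ContDiff ℝ 2 φ → ∀ x₀ : E N,
    IsLocalMin (fun x => w x - φ x) x₀ → 0 ≤ lam * w x₀ + (⨆ θ, opVal A H θ x₀ φ)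

/-- Viscosity solution of the discounted equation. -/
def IsSolDisc (A : Θ → E N → Matrix (Fin N) (Fin N) ℝ) (H : Θ → E N → E N → ℝ)
    (lam : ℝ) (w : E N → ℝ) : Prop :=
  IsSubSolDisc A H lam w ∧ IsSuperSolDisc A H lam w

/-- P_{ημ}[u](x,t) = sup_{s ≥ t} { u(x,t) − v(x) − μ(u(x,s) − v(x)) − μη(s−t) }. -/
def Pfun (u : E N → ℝ → ℝ) (v : E N → ℝ) (η μ : ℝ) (x : E N) (t : ℝ) : ℝ :=
  sSup ((fun s => u x t - v x - μ * (u x s - v x) - μ * η * (s - t)) '' Set.Ici t)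

/-- M_{ημ}[u](t) = sup_x P_{ημ}[u](x,t). -/
def Mfun (u : E N → ℝ → ℝ) (v : E N → ℝ) (η μ : ℝ) (t : ℝ) : ℝ :=
  sSup (Set.range fun x : E N => Pfun u v η μ x t)

/-- Viscosity subsolution of
  min{ U , ∂U/∂t + inf_θ{−tr(A_θ(x)D²U)} − C₀|DU| } ≤ 0 on ℝ^N×(0,∞). -/
def IsSubSolMinIneq (A : Θ → E N → Matrix (Fin N) (Fin N) ℝ) (C₀ : ℝ)
    (U : E N → ℝ → ℝ) : Prop :=
  ∀ φ : E N → ℝ → ℝ, ContDiff ℝ 2 (fun q : E N × ℝ => φ q.1 q.2) →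
    ∀ (x₀ : E N) (t₀ : ℝ), 0 < t₀ →
      IsLocalMax (fun q : E N × ℝ => U q.1 q.2 - φ q.1 q.2) (x₀, t₀) →
      U x₀ t₀ ≤ 0 ∨
        deriv (φ x₀) t₀ + (⨅ θ, -Matrix.trace (A θ x₀ * hessMatrix (fun y => φ y t₀) x₀))
          - C₀ * ‖gradient (fun y => φ y t₀) x₀‖ ≤ 0

/-- The unit cube [0,1]^N. -/
def cube (N : ℕ) : Set (E N) := {x | ∀ i, x i ∈ Set.Icc (0:ℝ) 1}

/-- Assumption (sur-sol-stricte) with constant C. -/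
def SurSolStricte (A : Θ → E N → Matrix (Fin N) (Fin N) ℝ) (C : ℝ) : Prop :=
  ∀ δ > (0:ℝ), ∃ ψ : E N → ℝ, ContDiff ℝ 2 ψ ∧
    ∃ Ω : Set (E N), IsOpen Ω ∧ Bornology.IsBounded Ω ∧ cube N ⊆ Ω ∧
      (∀ x ∈ Ω, ψ x ≤ 0) ∧ (∀ x ∉ Ω, 0 ≤ ψ x) ∧
      ∀ x ∈ Ω, (∀ y ∈ degenSet A, δ < dist x y) →
        0 < (⨅ θ, -Matrix.trace (A θ x * hessMatrix ψ x)) - C * ‖gradient ψ x‖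

/-- Assumption (inver_dege): uniform ellipticity at distance > δ from Σ. -/
def InverDege (A : Θ → E N → Matrix (Fin N) (Fin N) ℝ) : Prop :=
  ∀ δ > (0:ℝ), ∃ ν > (0:ℝ), ∀ (θ : Θ) (x : E N),
    (∀ y ∈ degenSet A, δ < dist x y) →
    (A θ x - ν • (1 : Matrix (Fin N) (Fin N) ℝ)).PosSemidef

/-- Frobenius norm of a matrix. -/
def mnorm (M : Matrix (Fin N) (Fin N) ℝ) : ℝ := Real.sqrt (∑ i, ∑ j, (M i j)^2)


open scoped Topology

section JA
variable {W : Type*} [NormedAddCommGroup W] [InnerProductSpace ℝ W]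

/-- `s` is a subgradient of `f` at `y`. -/
def SubG (f : W → ℝ) (y s : W) : Prop := ∀ y', f y + ⟪s, y' - y⟫ ≤ f y'

lemma SubG.mono {f : W → ℝ} {y s y' s' : W} (h : SubG f y s) (h' : SubG f y' s') :
    0 ≤ ⟪s - s', y - y'⟫ := by
  have h1 := h y'
  have h2 := h' y
  have : y' - y = -(y - y') := by abel
  rw [this, inner_neg_right] at h1
  rw [inner_sub_left]; linarith

lemma SubG.dist {f : W → ℝ} {y s y' s' : W} (h : SubG f y s) (h' : SubG f y' s') :
    ‖y - y'‖ ≤ ‖(y + s) - (y' + s')‖ := by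
  have h1 := h.mono h'
  have e : (y + s) - (y' + s') = (y - y') + (s - s') := by abel
  rw [e]
  have h2 : ‖y - y'‖ * ‖y - y'‖ ≤ ‖(y - y') + (s - s')‖ * ‖y - y'‖ := by
    calc ‖y - y'‖ * ‖y - y'‖ = ⟪y - y', y - y'⟫ := (real_inner_self_eq_norm_mul_norm _).symm
      _ ≤ ⟪(y - y') + (s - s'), y - y'⟫ := by rw [inner_add_left]; linarith
      _ ≤ _ := real_inner_le_norm _ _
  by_cases h0 : ‖y - y'‖ = 0
  · rw [h0]; positivity
  · exact le_of_mul_le_mul_right h2 (lt_of_le_of_ne (norm_nonneg _) (Ne.symm h0))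

/-- the subgradient at a nearby point is close to `g`, if `f` is touched from above -/
lemma SubG.close {f : W → ℝ} {x g : W} (hg : SubG f x g) {C ρ : ℝ} (hC : 0 ≤ C) (hρ : 0 < ρ)
    (hup : ∀ h, ‖h‖ ≤ ρ → f (x + h) ≤ f x + ⟪g, h⟫ + C * ‖h‖ ^ 2) {h s : W}
    (hs : SubG f (x + h) s) (hh : 2 * ‖h‖ ≤ ρ) : ‖s - g‖ ≤ 4 * C * ‖h‖ := by
  by_cases hsg : s - g = 0
  · rw [hsg, norm_zero]; positivity
  have hpos : 0 < ‖s - g‖ := norm_pos_iff.mpr hsg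
  have key : ∀ τ : ℝ, 0 < τ → ‖h‖ + τ ≤ ρ → τ * ‖s - g‖ ≤ C * (‖h‖ + τ) ^ 2 := by
    intro τ hτ hτρ
    set e : W := (τ / ‖s - g‖) • (s - g) with he
    have hen : ‖e‖ = τ := by
      rw [he, norm_smul, Real.norm_of_nonneg (by positivity)]; field_simp
    have hhe : ‖h + e‖ ≤ ‖h‖ + τ := (norm_add_le _ _).trans (by rw [hen])
    have a1 := hs (x + h + e)
    have a2 := hup (h + e) (hhe.trans hτρ)
    have a3 := hg (x + h)
    simp only [add_sub_cancel_left] at a1 a3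
    rw [← add_assoc, inner_add_right] at a2
    have a4 : ⟪s, e⟫ - ⟪g, e⟫ = τ * ‖s - g‖ := by
      rw [← inner_sub_left, he, inner_smul_right, real_inner_self_eq_norm_sq]; field_simp
    have a5 : ‖h + e‖ ^ 2 ≤ (‖h‖ + τ) ^ 2 := by gcongr
    have := mul_le_mul_of_nonneg_left a5 hC
    linarith
  by_cases h0 : h = 0
  · subst h0
    simp only [norm_zero, mul_zero, zero_add] at key ⊢
    refine le_of_forall_pos_le_add fun ε hε => ?_
    set τ := min ρ (ε / (C + 1)) with hτ
    have hτ0 : 0 < τ := by positivity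
    have h1 := key τ hτ0 (min_le_left _ _)
    have h2 : ‖s - g‖ ≤ C * τ := by
      have : τ * ‖s - g‖ ≤ τ * (C * τ) := by nlinarith
      exact le_of_mul_le_mul_left this hτ0
    have h3 : τ ≤ ε / (C + 1) := min_le_right _ _
    have h4 : C * τ ≤ ε := by
      rw [le_div_iff₀ (by positivity)] at h3; nlinarith
    linarith
  · have hh0 : 0 < ‖h‖ := norm_pos_iff.mpr h0
    have h1 := key ‖h‖ hh0 (by linarith)
    have : ‖h‖ * ‖s - g‖ ≤ ‖h‖ * (4 * C * ‖h‖) := by nlinarith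
    exact le_of_mul_le_mul_left this hh0

/-- points `y + s` with `s` a subgradient at `y` -/
def ZSet (f : W → ℝ) : Set W := {z | ∃ y, SubG f y (z - y)}

open Classical in
/-- resolvent -/
def Res (f : W → ℝ) (z : W) : W := if h : ∃ y, SubG f y (z - y) then h.choose else 0

lemma Res_eq {f : W → ℝ} {y s : W} (h : SubG f y s) : Res f (y + s) = y := by
  have hex : ∃ y', SubG f y' (y + s - y') := ⟨y, by simpa using h⟩
  have h1 : SubG f (Res f (y + s)) (y + s - Res f (y + s)) := by
    unfold Res; rw [dif_pos hex]; exact hex.choose_spec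
  have := h1.dist h
  simp only [add_sub_cancel, sub_self, norm_zero] at this
  have := norm_le_zero_iff.mp this
  exact sub_eq_zero.mp this

lemma Res_lip (f : W → ℝ) : LipschitzOnWith 1 (Res f) (ZSet f) := by
  refine LipschitzOnWith.of_dist_le_mul ?_
  rintro z ⟨y, hy⟩ z' ⟨y', hy'⟩
  have e := Res_eq hy
  have e' := Res_eq hy'
  rw [add_sub_cancel] at e e'
  rw [e, e', dist_eq_norm, dist_eq_norm]
  have := hy.dist hy'
  simpa using this

variable [FiniteDimensional ℝ W]

/-- first order expansion of subgradients at points of differentiability of the resolvent -/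
lemma subG_expand {f : W → ℝ} (hf : ∀ y, ∃ s, SubG f y s) {x g : W} (hg : SubG f x g)
    {C ρ : ℝ} (hC : 0 ≤ C) (hρ : 0 < ρ)
    (hup : ∀ h, ‖h‖ ≤ ρ → f (x + h) ≤ f x + ⟪g, h⟫ + C * ‖h‖ ^ 2)
    (hd : DifferentiableWithinAt ℝ (Res f) (ZSet f) (x + g)) :
    ∃ M : W →L[ℝ] W, ∀ δ > (0:ℝ), ∀ᶠ h in 𝓝 (0 : W), ∀ s, SubG f (x + h) s →
      ‖s - g - M h‖ ≤ δ * ‖h‖ := by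
  obtain ⟨D, hD⟩ := hd
  -- basic estimate
  have base : ∀ δ > (0:ℝ), ∀ᶠ h in 𝓝 (0 : W), ∀ s, SubG f (x + h) s →
      ‖h - D (h + (s - g))‖ ≤ δ * ‖h‖ := by
    intro δ hδ
    have h1 := hD.isLittleO.def (c := δ / (1 + 4 * C)) (by positivity)
    rw [eventually_nhdsWithin_iff, Metric.eventually_nhds_iff] at h1
    obtain ⟨ε, hε, h1⟩ := h1
    rw [Metric.eventually_nhds_iff]
    refine ⟨min (ρ / 2) (ε / (1 + 4 * C)), by positivity, fun h hh s hs => ?_⟩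
    rw [dist_zero_right, lt_min_iff] at hh
    have hc := hg.close hC hρ hup hs (by linarith)
    have e1 : x + h + s - (x + g) = h + (s - g) := by abel
    have hn : ‖h + (s - g)‖ ≤ (1 + 4 * C) * ‖h‖ := (norm_add_le _ _).trans (by linarith)
    have h2 := @h1 (x + h + s) (by
      rw [dist_eq_norm, e1]
      refine hn.trans_lt ?_
      have := hh.2
      rw [lt_div_iff₀ (by positivity)] at this
      linarith) ⟨x + h, by simpa using hs⟩
    rw [Res_eq hs, Res_eq hg, e1] at h2
    simp only [add_sub_cancel_left] at h2
    refine h2.trans ?_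
    calc δ / (1 + 4 * C) * ‖h + (s - g)‖ ≤ δ / (1 + 4 * C) * ((1 + 4 * C) * ‖h‖) := by gcongr
      _ = δ * ‖h‖ := by field_simp
  -- surjectivity of D
  have hsurj : LinearMap.range (D : W →ₗ[ℝ] W) = ⊤ := by
    by_contra hne
    have : (LinearMap.range (D : W →ₗ[ℝ] W))ᗮ ≠ ⊥ := by
      intro hb; exact hne (Submodule.orthogonal_eq_bot_iff.mp hb)
    obtain ⟨e, he, he0⟩ := Submodule.exists_mem_ne_zero_of_ne_bot this
    have hb := base (1/2) (by norm_num)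
    rw [Metric.eventually_nhds_iff] at hb
    obtain ⟨ε, hε, hb⟩ := hb
    have hepos : 0 < ‖e‖ := norm_pos_iff.mpr he0
    set h : W := (ε / (2 * ‖e‖)) • e with hh
    have hhn : ‖h‖ = ε / 2 := by
      rw [hh, norm_smul, Real.norm_of_nonneg (by positivity)]; field_simp
    obtain ⟨s, hs⟩ := hf (x + h)
    have h1 := hb (y := h) (by rw [dist_zero_right, hhn]; linarith) s hs
    have horth : ⟪h, D (h + (s - g))⟫ = 0 := by
      rw [hh, inner_smul_left]
      have := (Submodule.mem_orthogonal' _ _).mp he (D (h + (s - g))) ⟨_, rfl⟩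
      rw [← hh, this, mul_zero]
    have h2 : ‖h‖ ^ 2 ≤ ‖h‖ * ‖h - D (h + (s - g))‖ := by
      calc ‖h‖ ^ 2 = ⟪h, h - D (h + (s - g))⟫ := by
            rw [inner_sub_right, horth, sub_zero, real_inner_self_eq_norm_sq]
        _ ≤ _ := real_inner_le_norm _ _
    have h3 : 0 < ‖h‖ := by rw [hhn]; linarith
    nlinarith
  have hinj : LinearMap.ker (D : W →ₗ[ℝ] W) = ⊥ :=
    LinearMap.ker_eq_bot_iff_range_eq_top.mpr hsurj
  set De := ContinuousLinearEquiv.ofBijective D hinj hsurj with hDe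
  set Di : W →L[ℝ] W := (De.symm : W →L[ℝ] W) with hDi
  have hinv : ∀ w, Di (D w) = w := fun w => De.symm_apply_apply w
  refine ⟨Di - ContinuousLinearMap.id ℝ W, fun δ hδ => ?_⟩
  filter_upwards [base (δ / (‖Di‖ + 1)) (by positivity)] with h hb s hs
  have h1 := hb s hs
  have e : s - g - (Di - ContinuousLinearMap.id ℝ W) h = - Di (h - D (h + (s - g))) := by
    rw [map_sub, hinv]; simp; abel
  rw [e, norm_neg]
  calc ‖Di (h - D (h + (s - g)))‖ ≤ ‖Di‖ * ‖h - D (h + (s - g))‖ := Di.le_opNorm _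
    _ ≤ (‖Di‖ + 1) * (δ / (‖Di‖ + 1) * ‖h‖) := by gcongr; linarith
    _ = δ * ‖h‖ := by field_simp

lemma SubG.continuous {f : W → ℝ} (hf : ∀ y, ∃ s, SubG f y s) : Continuous f := by
  have hc : ConvexOn ℝ Set.univ f := by
    refine ⟨convex_univ, fun a _ b _ α β hα hβ hαβ => ?_⟩
    obtain ⟨s, hs⟩ := hf (α • a + β • b)
    have h1 := hs a
    have h2 := hs b
    have h3 : α * ⟪s, a - (α • a + β • b)⟫ + β * ⟪s, b - (α • a + β • b)⟫ = 0 := by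
      rw [← inner_smul_right, ← inner_smul_right, ← inner_add_right]
      have : α • (a - (α • a + β • b)) + β • (b - (α • a + β • b)) = 0 := by
        have hβ' : β = 1 - α := by linarith
        subst hβ'
        module
      rw [this, inner_zero_right]
    simp only [smul_eq_mul]
    have h4 := mul_le_mul_of_nonneg_left h1 hα
    have h5 := mul_le_mul_of_nonneg_left h2 hβ
    have h6 : α * f (α • a + β • b) + β * f (α • a + β • b) = f (α • a + β • b) := by
      rw [← add_mul, hαβ, one_mul]
    linarith
  have := hc.continuousOn isOpen_univ
  rwa [← continuousOn_univ]

lemma quad_deriv (c a b d n τ : ℝ) :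
    HasDerivAt (fun τ : ℝ => c + τ * a + τ ^ 2 / 2 * b + d * (τ * n)) (a + τ * b + d * n) τ := by
  have := ((((hasDerivAt_id' τ).mul_const a).const_add c).add
      (((hasDerivAt_pow 2 τ).div_const 2).mul_const b)).add
      (((hasDerivAt_id' τ).mul_const n).const_mul d)
  refine this.congr_deriv ?_
  norm_num

/-- second order expansion of `f` -/
lemma second_expand {f : W → ℝ} (hf : ∀ y, ∃ s, SubG f y s) {x g : W} {M : W →L[ℝ] W}
    (hM : ∀ δ > (0:ℝ), ∀ᶠ h in 𝓝 (0 : W), ∀ s, SubG f (x + h) s → ‖s - g - M h‖ ≤ δ * ‖h‖) :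
    ∀ δ > (0:ℝ), ∀ᶠ h in 𝓝 (0 : W),
      |f (x + h) - f x - ⟪g, h⟫ - 1 / 2 * ⟪M h, h⟫| ≤ δ * ‖h‖ ^ 2 := by
  intro δ hδ
  have hcont := SubG.continuous hf
  have h1 := hM (δ / 2) (by positivity)
  rw [Metric.eventually_nhds_iff] at h1
  obtain ⟨ε, hε, h1⟩ := h1
  rw [Metric.eventually_nhds_iff]
  refine ⟨ε / 2, by positivity, fun h hh => ?_⟩
  rw [dist_zero_right] at hh
  by_cases h0 : h = 0
  · subst h0; simp
  have hpos : 0 < ‖h‖ := norm_pos_iff.mpr h0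
  have hest : ∀ τ : ℝ, 0 ≤ τ → τ ≤ 3/2 → ∀ s, SubG f (x + τ • h) s →
      |⟪s, h⟫ - ⟪g, h⟫ - τ * ⟪M h, h⟫| ≤ δ / 2 * τ * ‖h‖ ^ 2 := by
    intro τ hτ hτ1 s hs
    have hn : ‖τ • h‖ = τ * ‖h‖ := by rw [norm_smul, Real.norm_of_nonneg hτ]
    have h2 := h1 (y := τ • h) (by rw [dist_zero_right, hn]; nlinarith) s hs
    have e : ⟪s, h⟫ - ⟪g, h⟫ - τ * ⟪M h, h⟫ = ⟪s - g - M (τ • h), h⟫ := by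
      rw [map_smul, inner_sub_left, inner_sub_left, inner_smul_left]; simp
    rw [e]
    calc |⟪s - g - M (τ • h), h⟫| ≤ ‖s - g - M (τ • h)‖ * ‖h‖ := abs_real_inner_le_norm _ _
      _ ≤ (δ / 2 * (τ * ‖h‖)) * ‖h‖ := by rw [hn] at h2; gcongr
      _ = _ := by ring
  set φ : ℝ → ℝ := fun τ => f (x + τ • h) with hφ
  have hφc : Continuous φ := by
    apply hcont.comp; fun_prop
  have hslope : ∀ τ τ' : ℝ, ∀ s, SubG f (x + τ • h) s → φ τ + (τ' - τ) * ⟪s, h⟫ ≤ φ τ' := by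
    intro τ τ' s hs
    have := hs (x + τ' • h)
    have e : x + τ' • h - (x + τ • h) = (τ' - τ) • h := by module
    rw [e, inner_smul_right] at this
    exact this
  have hupper : φ 1 ≤ f x + 1 * ⟪g, h⟫ + 1 ^ 2 / 2 * ⟪M h, h⟫ + δ * (1 * ‖h‖ ^ 2) := by
    refine image_le_of_liminf_slope_right_lt_deriv_boundary (a := 0) (b := 1) (f := φ)
      (f' := fun τ => ⟪g, h⟫ + τ * ⟪M h, h⟫ + δ / 2 * τ * ‖h‖ ^ 2)
      (B := fun τ => f x + τ * ⟪g, h⟫ + τ ^ 2 / 2 * ⟪M h, h⟫ + δ * (τ * ‖h‖ ^ 2))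
      hφc.continuousOn ?_ ?_ (fun τ => quad_deriv _ _ _ _ _ τ) ?_ (by simp)
    · intro τ hτ r hr
      have hc : Tendsto (fun τ' : ℝ => ⟪g, h⟫ + τ' * ⟪M h, h⟫ + δ / 2 * τ' * ‖h‖ ^ 2) (𝓝[>] τ)
          (𝓝 (⟪g, h⟫ + τ * ⟪M h, h⟫ + δ / 2 * τ * ‖h‖ ^ 2)) := by
        apply Tendsto.mono_left _ nhdsWithin_le_nhds
        apply Continuous.tendsto; fun_prop
      apply Eventually.frequently
      have h5 : ∀ᶠ z in 𝓝[>] τ, z < 3/2 :=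
        (eventually_lt_nhds (by linarith [hτ.2])).filter_mono nhdsWithin_le_nhds
      filter_upwards [hc.eventually_lt_const hr, self_mem_nhdsWithin, h5] with z hz hz2 hz3
      refine lt_of_le_of_lt ?_ hz
      obtain ⟨s, hs⟩ := hf (x + z • h)
      have hz2' : τ < z := hz2
      have h3 := hslope z τ s hs
      have h4 := (abs_le.mp (hest z (by linarith [hτ.1]) hz3.le s hs)).2
      rw [slope_def_field, div_le_iff₀ (by linarith)]
      nlinarith
    · simp [hφ]
    · intro τ hτ _
      have : 0 < δ * ‖h‖ ^ 2 := by positivity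
      have := hτ.2
      nlinarith
  have hlower : -φ 1 ≤ -(f x) + 1 * (-⟪g, h⟫) + 1 ^ 2 / 2 * (-⟪M h, h⟫) + δ * (1 * ‖h‖ ^ 2) := by
    refine image_le_of_liminf_slope_right_lt_deriv_boundary (a := 0) (b := 1) (f := fun τ => -φ τ)
      (f' := fun τ => -⟪g, h⟫ + τ * (-⟪M h, h⟫) + δ / 2 * τ * ‖h‖ ^ 2)
      (B := fun τ => -(f x) + τ * (-⟪g, h⟫) + τ ^ 2 / 2 * (-⟪M h, h⟫) + δ * (τ * ‖h‖ ^ 2))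
      hφc.neg.continuousOn ?_ ?_ (fun τ => quad_deriv _ _ _ _ _ τ) ?_ (by simp)
    · intro τ hτ r hr
      apply Eventually.frequently
      filter_upwards [self_mem_nhdsWithin] with z hz2
      refine lt_of_le_of_lt ?_ hr
      obtain ⟨s, hs⟩ := hf (x + τ • h)
      have hz2' : τ < z := hz2
      have h3 := hslope τ z s hs
      have h4 := (abs_le.mp (hest τ hτ.1 (by linarith [hτ.2]) s hs)).1
      rw [slope_def_field, div_le_iff₀ (by linarith)]
      nlinarith
    · simp [hφ]
    · intro τ hτ _
      have : 0 < δ * ‖h‖ ^ 2 := by positivity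
      have := hτ.2
      nlinarith
  have e1 : φ 1 = f (x + h) := by simp [hφ]
  rw [e1] at hupper hlower
  rw [abs_le]
  constructor <;> linarith

open MeasureTheory in
/-- Jensen's lemma combined with Alexandrov's theorem -/
lemma JA {f : W → ℝ} (hf : ∀ y, ∃ s, SubG f y s) {x₀ g₀ : W} (B : W →L[ℝ] W)
    (hB : ∀ a b, ⟪B a, b⟫ = ⟪a, B b⟫) {κ ρ r : ℝ} (hκ : 0 < κ) (hρ : 0 < ρ) (hr : 0 < r)
    (hmax : ∀ h, ‖h‖ ≤ ρ → f (x₀ + h) ≤ f x₀ + ⟪g₀, h⟫ + 1 / 2 * ⟪B h, h⟫ - κ * ‖h‖ ^ 2) :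
    ∃ (x g : W) (M : W →L[ℝ] W), ‖x - x₀‖ ≤ r ∧ ‖g - g₀‖ ≤ r ∧
      (∀ δ > (0:ℝ), ∀ᶠ h in 𝓝 (0 : W),
        |f (x + h) - f x - ⟪g, h⟫ - 1 / 2 * ⟪M h, h⟫| ≤ δ * ‖h‖ ^ 2) ∧
      ∀ h, ⟪M h, h⟫ ≤ ⟪B h, h⟫ := by
  let _ : MeasurableSpace W := borel W
  have : BorelSpace W := ⟨rfl⟩
  have hcont := SubG.continuous hf
  set η : ℝ := min (κ * ρ / 2) (min (κ * r) (r / (1 + ‖B‖ / κ))) with hη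
  have hη0 : 0 < η := by positivity
  have hη1 : η ≤ κ * ρ / 2 := min_le_left _ _
  have hη2 : η ≤ κ * r := (min_le_right _ _).trans (min_le_left _ _)
  have hη3 : η * (1 + ‖B‖ / κ) ≤ r := by
    have : η ≤ r / (1 + ‖B‖ / κ) := (min_le_right _ _).trans (min_le_right _ _)
    rwa [le_div_iff₀ (by positivity)] at this
  have hBn : ∀ h, ⟪B h, h⟫ ≤ ‖B‖ * ‖h‖ ^ 2 := fun h => by
    calc ⟪B h, h⟫ ≤ ‖B h‖ * ‖h‖ := real_inner_le_norm _ _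
      _ ≤ ‖B‖ * ‖h‖ * ‖h‖ := by gcongr; exact B.le_opNorm h
      _ = _ := by ring
  have step : ∀ p : W, ‖p‖ < η → ∃ h : W, κ * ‖h‖ ≤ ‖p‖ ∧ SubG f (x₀ + h) (g₀ + p + B h) ∧
      ∀ k, ‖k‖ ≤ ρ / 2 →
        f (x₀ + h + k) ≤ f (x₀ + h) + ⟪g₀ + p + B h, k⟫ + 1 / 2 * ⟪B k, k⟫ := by
    intro p hp
    have hc : ContinuousOn (fun h => f (x₀ + h) - ⟪g₀ + p, h⟫ - 1 / 2 * ⟪B h, h⟫)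
        (Metric.closedBall (0 : W) ρ) := by
      apply Continuous.continuousOn
      have : Continuous fun h => f (x₀ + h) := hcont.comp (by fun_prop)
      fun_prop
    obtain ⟨h, hh, hm⟩ := (isCompact_closedBall (0 : W) ρ).exists_isMaxOn
      ⟨0, by simp [hρ.le]⟩ hc
    have hh' : ‖h‖ ≤ ρ := by simpa using hh
    have h1 := hm (show (0 : W) ∈ Metric.closedBall 0 ρ by simp [hρ.le])
    have h2 := hmax h hh'
    simp only [Set.mem_ofPred_eq, add_zero, inner_zero_right, map_zero, mul_zero, sub_zero,
      inner_add_left] at h1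
    have h3 : -⟪p, h⟫ ≤ ‖p‖ * ‖h‖ := by
      have := (abs_le.mp (abs_real_inner_le_norm p h)).1; linarith
    have hle : κ * ‖h‖ ≤ ‖p‖ := by
      by_cases h0 : ‖h‖ = 0
      · rw [h0]; simp
      · have hpos : 0 < ‖h‖ := lt_of_le_of_ne (norm_nonneg _) (Ne.symm h0)
        refine le_of_mul_le_mul_right ?_ hpos
        nlinarith
    have hh2 : ‖h‖ ≤ ρ / 2 := by
      refine le_of_mul_le_mul_left ?_ hκ
      linarith
    have hup : ∀ k, ‖k‖ ≤ ρ / 2 →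
        f (x₀ + h + k) ≤ f (x₀ + h) + ⟪g₀ + p + B h, k⟫ + 1 / 2 * ⟪B k, k⟫ := by
      intro k hk
      have h4 := hm (show h + k ∈ Metric.closedBall (0 : W) ρ by
        rw [mem_closedBall_zero_iff]; exact (norm_add_le _ _).trans (by linarith))
      have h5 : ⟪B k, h⟫ = ⟪B h, k⟫ := by rw [hB, real_inner_comm]
      simp only [Set.mem_ofPred_eq, map_add, inner_add_left, inner_add_right, ← add_assoc] at h4
      simp only [inner_add_left]
      linarith
    refine ⟨h, hle, ?_, hup⟩
    obtain ⟨s, hs⟩ := hf (x₀ + h)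
    have : s = g₀ + p + B h := by
      by_contra hne
      set d := s - (g₀ + p + B h) with hd
      have hd0 : 0 < ‖d‖ := norm_pos_iff.mpr (sub_ne_zero.mpr hne)
      set τ : ℝ := min (ρ / 2 / ‖d‖) (1 / (1 + ‖B‖)) with hτ
      have hτ0 : 0 < τ := by positivity
      have hτ1 : τ * ‖d‖ ≤ ρ / 2 := by
        have : τ ≤ ρ / 2 / ‖d‖ := min_le_left _ _
        rwa [le_div_iff₀ hd0] at this
      have hτ2 : τ * (1 + ‖B‖) ≤ 1 := by
        have : τ ≤ 1 / (1 + ‖B‖) := min_le_right _ _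
        rwa [le_div_iff₀ (by positivity)] at this
      have a1 := hup (τ • d) (by rw [norm_smul, Real.norm_of_nonneg hτ0.le]; exact hτ1)
      have a2 := hs (x₀ + h + τ • d)
      rw [add_sub_cancel_left] at a2
      have a3 : ⟪s, τ • d⟫ - ⟪g₀ + p + B h, τ • d⟫ = τ * ‖d‖ ^ 2 := by
        rw [← inner_sub_left, ← hd, inner_smul_right, real_inner_self_eq_norm_sq]
      have a4 := hBn (τ • d)
      rw [norm_smul, Real.norm_of_nonneg hτ0.le] at a4
      have a5 : τ * ‖d‖ ^ 2 ≤ 1 / 2 * (‖B‖ * (τ * ‖d‖) ^ 2) := by linarith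
      have a6 : 0 < τ * ‖d‖ ^ 2 := by positivity
      have a7 : ‖B‖ * (τ * ‖d‖) ^ 2 ≤ τ * ‖d‖ ^ 2 := by
        calc ‖B‖ * (τ * ‖d‖) ^ 2 = (τ * ‖B‖) * (τ * ‖d‖ ^ 2) := by ring
          _ ≤ 1 * (τ * ‖d‖ ^ 2) := by gcongr; linarith
          _ = _ := one_mul _
      linarith
    rwa [← this]
  -- a good `p`
  obtain ⟨p, hp, h, hle, hsub, hup, hdiff⟩ : ∃ p : W, ‖p‖ < η ∧ ∃ h : W, κ * ‖h‖ ≤ ‖p‖ ∧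
      SubG f (x₀ + h) (g₀ + p + B h) ∧
      (∀ k, ‖k‖ ≤ ρ / 2 →
        f (x₀ + h + k) ≤ f (x₀ + h) + ⟪g₀ + p + B h, k⟫ + 1 / 2 * ⟪B k, k⟫) ∧
      DifferentiableWithinAt ℝ (Res f) (ZSet f) (x₀ + h + (g₀ + p + B h)) := by
    by_contra! hbad
    set μ : Measure W := Measure.hausdorffMeasure (Module.finrank ℝ W : ℝ) with hμ
    set Nn : Set W := {z | z ∈ ZSet f ∧ ¬ DifferentiableWithinAt ℝ (Res f) (ZSet f) z} with hNn
    have hN0 : μ Nn = 0 := by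
      have h1 : ∀ᵐ z ∂μ, z ∈ ZSet f → DifferentiableWithinAt ℝ (Res f) (ZSet f) z :=
        (Res_lip f).ae_differentiableWithinAt_of_mem
      rw [ae_iff] at h1
      convert h1 using 2
      ext z; simp [hNn]
    set P : W → W := fun z => z - Res f z - g₀ - B (Res f z - x₀) with hP
    have hPl : LipschitzOnWith (2 + ‖B‖₊) P Nn := by
      refine LipschitzOnWith.of_dist_le_mul fun z hz z' hz' => ?_
      have h1 := (Res_lip f).dist_le_mul z hz.1 z' hz'.1
      rw [dist_eq_norm, dist_eq_norm] at h1 ⊢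
      simp only [NNReal.coe_one, one_mul] at h1
      have e : P z - P z' = (z - z') - (Res f z - Res f z') - B (Res f z - Res f z') := by
        simp only [hP, map_sub]; abel
      rw [e]
      have h2 := B.le_opNorm (Res f z - Res f z')
      have h3 : ‖B‖ * ‖Res f z - Res f z'‖ ≤ ‖B‖ * ‖z - z'‖ := by gcongr
      have h4 := norm_sub_le ((z - z') - (Res f z - Res f z')) (B (Res f z - Res f z'))
      have h5 := norm_sub_le (z - z') (Res f z - Res f z')
      push_cast
      linarith
    have hsubset : Metric.ball (0 : W) η ⊆ P '' Nn := by
      intro p hp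
      rw [mem_ball_zero_iff] at hp
      obtain ⟨h, h1, h2, h3⟩ := step p hp
      refine ⟨x₀ + h + (g₀ + p + B h), ⟨⟨x₀ + h, by simpa using h2⟩, hbad p hp h h1 h2 h3⟩, ?_⟩
      simp only [hP]
      rw [Res_eq h2]
      simp only [add_sub_cancel_left]
      abel
    have h1 : μ (P '' Nn) = 0 := by
      have := hPl.hausdorffMeasure_image_le (d := (Module.finrank ℝ W : ℝ)) (by positivity)
      rw [← hμ, hN0, mul_zero] at this
      exact le_antisymm this bot_le
    have h2 : μ (Metric.ball (0 : W) η) = 0 := measure_mono_null hsubset h1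
    have h3 : 0 < μ (Metric.ball (0 : W) η) := Metric.measure_ball_pos μ 0 hη0
    exact h3.ne' h2
  have hup2 : ∀ k, ‖k‖ ≤ ρ / 2 → f (x₀ + h + k) ≤ f (x₀ + h) + ⟪g₀ + p + B h, k⟫
      + (1 / 2 * ‖B‖) * ‖k‖ ^ 2 := fun k hk => by
    have := hup k hk
    have := hBn k
    linarith
  obtain ⟨M, hM⟩ := subG_expand hf hsub (by positivity) (by positivity) hup2 hdiff
  have hM2 := second_expand hf hM
  refine ⟨x₀ + h, g₀ + p + B h, M, ?_, ?_, hM2, ?_⟩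
  · rw [add_sub_cancel_left]
    refine le_of_mul_le_mul_left ?_ hκ
    linarith
  · have e : g₀ + p + B h - g₀ = p + B h := by abel
    rw [e]
    have h1 : ‖h‖ ≤ η / κ := by rw [le_div_iff₀ hκ]; linarith
    have h2 : ‖B h‖ ≤ ‖B‖ * (η / κ) := (B.le_opNorm h).trans (by gcongr)
    have h3 : η * (1 + ‖B‖ / κ) = η + ‖B‖ * (η / κ) := by ring
    exact (norm_add_le _ _).trans (by linarith)
  · intro k
    refine le_of_forall_pos_le_add fun ε hε => ?_
    have h1 := hM2 (ε / (2 * (‖k‖ ^ 2 + 1))) (by positivity)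
    have h2 : ∀ᶠ k in 𝓝 (0 : W), ‖k‖ ≤ ρ / 2 := by
      have := Metric.closedBall_mem_nhds (0 : W) (show 0 < ρ / 2 by positivity)
      filter_upwards [this] with k hk using by simpa using hk
    have h3 : Tendsto (fun τ : ℝ => τ • k) (𝓝[>] 0) (𝓝 (0 : W)) := by
      apply Tendsto.mono_left _ nhdsWithin_le_nhds
      have : Continuous fun τ : ℝ => τ • k := by fun_prop
      simpa using this.tendsto 0
    obtain ⟨τ, ⟨h4, h5⟩, h6⟩ := ((h3.eventually (h1.and h2)).and self_mem_nhdsWithin).exists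
    have hτ : 0 < τ := h6
    have h7 := (abs_le.mp h4).1
    have h8 := hup _ h5
    simp only [map_smul, inner_smul_left, inner_smul_right, norm_smul, Real.norm_of_nonneg hτ.le,
      conj_trivial] at h7 h8
    have h9 : ε / (2 * (‖k‖ ^ 2 + 1)) * (τ * ‖k‖) ^ 2 ≤ τ ^ 2 * (ε / 2) := by
      rw [div_mul_eq_mul_div, div_le_iff₀ (by positivity)]
      nlinarith [mul_pos (pow_pos hτ 2) hε]
    have h10 : τ ^ 2 * ⟪M k, k⟫ ≤ τ ^ 2 * (⟪B k, k⟫ + ε) := by nlinarith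
    exact le_of_mul_le_mul_left h10 (by positivity)

end JA

section TS
variable {V : Type*} [NormedAddCommGroup V] [InnerProductSpace ℝ V]

lemma form_le (B : V →L[ℝ] V) (h : V) : ⟪B h, h⟫ ≤ ‖B‖ * ‖h‖ ^ 2 := by
  calc ⟪B h, h⟫ ≤ ‖B h‖ * ‖h‖ := real_inner_le_norm _ _
    _ ≤ ‖B‖ * ‖h‖ * ‖h‖ := by gcongr; exact B.le_opNorm h
    _ = _ := by ring

/-- first component injection -/
def il : V →L[ℝ] WithLp 2 (V × V) :=
  (WithLp.prodContinuousLinearEquiv 2 ℝ V V).symm.toContinuousLinearMap.comp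
    (ContinuousLinearMap.inl ℝ V V)
/-- second component injection -/
def ir : V →L[ℝ] WithLp 2 (V × V) :=
  (WithLp.prodContinuousLinearEquiv 2 ℝ V V).symm.toContinuousLinearMap.comp
    (ContinuousLinearMap.inr ℝ V V)

lemma il_fst (a : V) : (il a).fst = a := rfl
lemma il_snd (a : V) : (il a).snd = 0 := rfl
lemma ir_fst (a : V) : (ir a).fst = 0 := rfl
lemma ir_snd (a : V) : (ir a).snd = a := rfl
lemma inner_il (z : WithLp 2 (V × V)) (a : V) : ⟪z, il a⟫ = ⟪z.fst, a⟫ := by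
  rw [WithLp.prod_inner_apply]
  change ⟪z.fst, a⟫ + ⟪z.snd, (0 : V)⟫ = _
  simp
lemma inner_ir (z : WithLp 2 (V × V)) (a : V) : ⟪z, ir a⟫ = ⟪z.snd, a⟫ := by
  rw [WithLp.prod_inner_apply]
  change ⟪z.fst, (0 : V)⟫ + ⟪z.snd, a⟫ = _
  simp
lemma norm_il (a : V) : ‖il a‖ = ‖a‖ := by
  have : ‖il a‖ ^ 2 = ‖a‖ ^ 2 := by
    rw [WithLp.prod_norm_sq_eq_of_L2, il_fst, il_snd]; simp
  exact (sq_eq_sq₀ (norm_nonneg _) (norm_nonneg _)).mp this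
lemma norm_ir (a : V) : ‖ir a‖ = ‖a‖ := by
  have : ‖ir a‖ ^ 2 = ‖a‖ ^ 2 := by
    rw [WithLp.prod_norm_sq_eq_of_L2, ir_fst, ir_snd]; simp
  exact (sq_eq_sq₀ (norm_nonneg _) (norm_nonneg _)).mp this
lemma il_add_ir (z : WithLp 2 (V × V)) : il z.fst + ir z.snd = z := by
  apply WithLp.ofLp_injective 2
  refine Prod.ext ?_ ?_
  · change z.fst + 0 = _; simp
  · change 0 + z.snd = _; simp

lemma sq_le_two {a b c : ℝ} (h : a ≤ b + c) (ha : 0 ≤ a) : a ^ 2 ≤ 2 * b ^ 2 + 2 * c ^ 2 := by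
  nlinarith [sq_nonneg (b - c)]

lemma fst_le (z : WithLp 2 (V × V)) : ‖z.fst‖ ≤ ‖z‖ := by
  have := WithLp.prod_norm_sq_eq_of_L2 z
  apply le_of_sq_le_sq _ (norm_nonneg z); nlinarith [sq_nonneg ‖z.snd‖]

lemma snd_le (z : WithLp 2 (V × V)) : ‖z.snd‖ ≤ ‖z‖ := by
  have := WithLp.prod_norm_sq_eq_of_L2 z
  apply le_of_sq_le_sq _ (norm_nonneg z); nlinarith [sq_nonneg ‖z.fst‖]

lemma grad_unique {f : V → ℝ} {a g g' : V} {M : V →L[ℝ] V} (hs : SubG f a g')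
    (he : ∀ᶠ h in 𝓝 (0 : V), f (a + h) ≤ f a + ⟪g, h⟫ + 1 / 2 * ⟪M h, h⟫ + ‖h‖ ^ 2) :
    g' = g := by
  by_contra hne
  set d := g' - g with hd
  have hd0 : 0 < ‖d‖ := norm_pos_iff.mpr (sub_ne_zero.mpr hne)
  have h3 : Tendsto (fun τ : ℝ => τ • d) (𝓝[>] 0) (𝓝 (0 : V)) := by
    apply Tendsto.mono_left _ nhdsWithin_le_nhds
    have : Continuous fun τ : ℝ => τ • d := by fun_prop
    simpa using this.tendsto 0
  have h4 : ∀ᶠ τ : ℝ in 𝓝[>] 0, τ < 1 / (‖M‖ + 2) :=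
    (eventually_lt_nhds (by positivity)).filter_mono nhdsWithin_le_nhds
  obtain ⟨τ, ⟨h5, h6⟩, h7⟩ := (((h3.eventually he).and h4).and self_mem_nhdsWithin).exists
  have hτ : 0 < τ := h7
  have h8 := hs (a + τ • d)
  rw [add_sub_cancel_left] at h8
  have a3 : ⟪g', τ • d⟫ - ⟪g, τ • d⟫ = τ * ‖d‖ ^ 2 := by
    rw [← inner_sub_left, ← hd, inner_smul_right, real_inner_self_eq_norm_sq]
  have a4 := form_le M (τ • d)
  rw [norm_smul, Real.norm_of_nonneg hτ.le] at h5 a4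
  rw [lt_div_iff₀ (by positivity)] at h6
  have a5 : 0 < τ * ‖d‖ ^ 2 := by positivity
  have a6 : (τ * (‖M‖ + 2)) * (τ * ‖d‖ ^ 2) < 1 * (τ * ‖d‖ ^ 2) := by gcongr
  nlinarith [norm_nonneg M, mul_nonneg (norm_nonneg M) (sq_nonneg (τ * ‖d‖))]

lemma transfer {u f : V → ℝ} {x h g : V} {s ρ : ℝ} {M : V →L[ℝ] V}
    (hle : ∀ a y, ‖y‖ ≤ ρ → u y + s * ⟪a, y⟫ - s / 2 * ‖y‖ ^ 2 ≤ f a)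
    (hh : ‖h‖ < ρ) (heq : f x = u h + s * ⟪x, h⟫ - s / 2 * ‖h‖ ^ 2) {δ : ℝ}
    (he : ∀ᶠ k in 𝓝 (0 : V), f (x + k) ≤ f x + ⟪g, k⟫ + 1 / 2 * ⟪M k, k⟫ + δ * ‖k‖ ^ 2) :
    ∀ᶠ k in 𝓝 (0 : V), u (h + k) ≤ u h + ⟪g - s • x, k⟫ +
      1 / 2 * ⟪(M + (2 * δ - s) • ContinuousLinearMap.id ℝ V) k, k⟫ := by
  have h2 : ∀ᶠ k in 𝓝 (0 : V), ‖k‖ ≤ ρ - ‖h‖ := by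
    have := Metric.closedBall_mem_nhds (0 : V) (show 0 < ρ - ‖h‖ by linarith)
    filter_upwards [this] with k hk using by simpa using hk
  filter_upwards [he, h2] with k h3 h4
  have h5 := hle (x + k) (h + k) ((norm_add_le _ _).trans (by linarith))
  have e1 : ‖h + k‖ ^ 2 = ‖h‖ ^ 2 + 2 * ⟪h, k⟫ + ‖k‖ ^ 2 := norm_add_sq_real h k
  have e2 : ⟪x + k, h + k⟫ = ⟪x, h⟫ + ⟪x, k⟫ + ⟪h, k⟫ + ‖k‖ ^ 2 := by
    rw [inner_add_left, inner_add_right, inner_add_right, real_inner_self_eq_norm_sq,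
      real_inner_comm h k]; ring
  rw [e1, e2] at h5
  simp only [_root_.add_apply, _root_.smul_apply,
    ContinuousLinearMap.id_apply, inner_add_left, inner_sub_left, inner_smul_left, conj_trivial,
    real_inner_self_eq_norm_sq]
  nlinarith

variable [FiniteDimensional ℝ V]

lemma supconv {u : V → ℝ} {ρ : ℝ} (hρ : 0 < ρ)
    (hu : UpperSemicontinuousOn u (Metric.closedBall 0 ρ)) (s : ℝ) :
    ∃ (f : V → ℝ) (m : V → V), (∀ a, ‖m a‖ ≤ ρ ∧
      f a = u (m a) + s * ⟪a, m a⟫ - s / 2 * ‖m a‖ ^ 2) ∧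
      ∀ a y, ‖y‖ ≤ ρ → u y + s * ⟪a, y⟫ - s / 2 * ‖y‖ ^ 2 ≤ f a := by
  have key : ∀ a : V, ∃ m : V, ‖m‖ ≤ ρ ∧ ∀ y, ‖y‖ ≤ ρ →
      u y + s * ⟪a, y⟫ - s / 2 * ‖y‖ ^ 2 ≤ u m + s * ⟪a, m⟫ - s / 2 * ‖m‖ ^ 2 := by
    intro a
    have h1 : UpperSemicontinuousOn (fun y => u y + (s * ⟪a, y⟫ - s / 2 * ‖y‖ ^ 2))
        (Metric.closedBall 0 ρ) := by
      apply UpperSemicontinuousOn.add hu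
      apply ContinuousOn.upperSemicontinuousOn
      fun_prop
    obtain ⟨m, hm, hmax⟩ := h1.exists_isMaxOn ⟨0, by simp [hρ.le]⟩ (isCompact_closedBall _ _)
    refine ⟨m, by simpa using hm, fun y hy => ?_⟩
    have := hmax (show y ∈ Metric.closedBall (0 : V) ρ by simpa using hy)
    simp only [Set.mem_ofPred_eq] at this
    linarith
  choose m hm hmax using key
  exact ⟨fun a => u (m a) + s * ⟪a, m a⟫ - s / 2 * ‖m a‖ ^ 2, m, fun a => ⟨hm a, rfl⟩,
    fun a y hy => hmax a y hy⟩

set_option maxHeartbeats 1000000 in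
/-- Theorem on sums, normalized strict version -/
lemma TS_core {u w : V → ℝ} {ρ : ℝ} (hρ : 0 < ρ)
    (hu : UpperSemicontinuousOn u (Metric.closedBall 0 ρ))
    (hw : UpperSemicontinuousOn w (Metric.closedBall 0 ρ))
    (hu0 : u 0 = 0) (hw0 : w 0 = 0) (B : WithLp 2 (V × V) →L[ℝ] WithLp 2 (V × V))
    (hB : ∀ a b, ⟪B a, b⟫ = ⟪a, B b⟫) {κ₀ : ℝ} (hκ₀ : 0 < κ₀)
    (hmax : ∀ z : WithLp 2 (V × V), ‖z.fst‖ ≤ ρ → ‖z.snd‖ ≤ ρ →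
      u z.fst + w z.snd ≤ 1 / 2 * ⟪B z, z⟫ - κ₀ * ‖z‖ ^ 2) {κ : ℝ} (hκ : 0 < κ) :
    ∃ (x y p q : V) (X Y : V →L[ℝ] V), ‖x‖ ≤ κ ∧ ‖y‖ ≤ κ ∧ |u x| ≤ κ ∧ |w y| ≤ κ ∧
      ‖p‖ ≤ κ ∧ ‖q‖ ≤ κ ∧
      (∀ᶠ k in 𝓝 (0 : V), u (x + k) ≤ u x + ⟪p, k⟫ + 1 / 2 * ⟪X k, k⟫) ∧
      (∀ᶠ k in 𝓝 (0 : V), w (y + k) ≤ w y + ⟪q, k⟫ + 1 / 2 * ⟪Y k, k⟫) ∧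
      ∀ z : WithLp 2 (V × V), ⟪X z.fst, z.fst⟫ + ⟪Y z.snd, z.snd⟫ ≤ ⟪B z, z⟫ + κ * ‖z‖ ^ 2 := by
  set s : ℝ := 1 + 2 * (κ₀ + ‖B‖ ^ 2 / κ₀ + ‖B‖) with hs
  have hs1 : 1 ≤ s := by
    have : 0 ≤ 2 * (κ₀ + ‖B‖ ^ 2 / κ₀ + ‖B‖) := by positivity
    linarith
  obtain ⟨f₁, m₁, hm₁, hle₁⟩ := supconv hρ hu s
  obtain ⟨f₂, m₂, hm₂, hle₂⟩ := supconv hρ hw s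
  have hsub₁ : ∀ a, SubG f₁ a (s • m₁ a) := fun a a' => by
    have h1 := hle₁ a' (m₁ a) (hm₁ a).1
    rw [(hm₁ a).2, inner_smul_left, inner_sub_right, real_inner_comm a' (m₁ a),
      real_inner_comm a (m₁ a)]
    simp only [conj_trivial]; linarith
  have hsub₂ : ∀ a, SubG f₂ a (s • m₂ a) := fun a a' => by
    have h1 := hle₂ a' (m₂ a) (hm₂ a).1
    rw [(hm₂ a).2, inner_smul_left, inner_sub_right, real_inner_comm a' (m₂ a),
      real_inner_comm a (m₂ a)]
    simp only [conj_trivial]; linarith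
  set f : WithLp 2 (V × V) → ℝ := fun z => f₁ z.fst + f₂ z.snd with hf
  have hsubf : ∀ z, ∃ g, SubG f z g := fun z => by
    refine ⟨il (s • m₁ z.fst) + ir (s • m₂ z.snd), fun z' => ?_⟩
    have h1 := hsub₁ z.fst z'.fst
    have h2 := hsub₂ z.snd z'.snd
    rw [inner_add_left, real_inner_comm, inner_il, real_inner_comm (z' - z) (ir _), inner_ir,
      real_inner_comm, real_inner_comm (s • m₂ z.snd)]
    simp only [hf]
    simp only [WithLp.sub_fst, WithLp.sub_snd]
    linarith
  have hub : ∀ ζ, f ζ ≤ 1 / 2 * ⟪(B + s • ContinuousLinearMap.id ℝ (WithLp 2 (V × V))) ζ, ζ⟫ - κ₀ / 4 * ‖ζ‖ ^ 2 := by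
    intro ζ
    set z : WithLp 2 (V × V) := il (m₁ ζ.fst) + ir (m₂ ζ.snd) with hz
    have hz1 : z.fst = m₁ ζ.fst := by rw [hz, WithLp.add_fst, il_fst, ir_fst, add_zero]
    have hz2 : z.snd = m₂ ζ.snd := by rw [hz, WithLp.add_snd, il_snd, ir_snd, zero_add]
    have h1 := hmax z (by rw [hz1]; exact (hm₁ _).1) (by rw [hz2]; exact (hm₂ _).1)
    have e0 : f ζ = u z.fst + w z.snd + s * ⟪ζ, z⟫ - s / 2 * ‖z‖ ^ 2 := by
      simp only [hf]
      rw [(hm₁ ζ.fst).2, (hm₂ ζ.snd).2, WithLp.prod_norm_sq_eq_of_L2, WithLp.prod_inner_apply,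
        ← hz1, ← hz2]
      change _ = u z.fst + w z.snd + s * (⟪ζ.fst, z.fst⟫ + ⟪ζ.snd, z.snd⟫) - _
      ring
    obtain ⟨d, hd⟩ : ∃ d, z = ζ + d := ⟨z - ζ, by abel⟩
    have h2 : ‖z‖ ^ 2 = ‖ζ‖ ^ 2 + 2 * ⟪ζ, d⟫ + ‖d‖ ^ 2 := by rw [hd]; exact norm_add_sq_real ζ d
    have h3 : ⟪ζ, z⟫ = ‖ζ‖ ^ 2 + ⟪ζ, d⟫ := by
      rw [hd, inner_add_right, real_inner_self_eq_norm_sq]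
    have h4 : ⟪B z, z⟫ = ⟪B ζ, ζ⟫ + 2 * ⟪B ζ, d⟫ + ⟪B d, d⟫ := by
      rw [hd, map_add, inner_add_left, inner_add_right, inner_add_right, hB d ζ,
        real_inner_comm (B ζ) d]; ring
    have h5 := form_le B d
    have h6 : ⟪B ζ, d⟫ ≤ κ₀ / 4 * ‖ζ‖ ^ 2 + ‖B‖ ^ 2 / κ₀ * ‖d‖ ^ 2 := by
      have a1 : ⟪B ζ, d⟫ ≤ ‖B‖ * ‖ζ‖ * ‖d‖ :=
        (real_inner_le_norm _ _).trans (by gcongr; exact B.le_opNorm ζ)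
      have a2 : κ₀ / 4 * ‖ζ‖ ^ 2 + ‖B‖ ^ 2 / κ₀ * ‖d‖ ^ 2 - ‖B‖ * ‖ζ‖ * ‖d‖
          = (κ₀ * ‖ζ‖ - 2 * ‖B‖ * ‖d‖) ^ 2 / (4 * κ₀) := by field_simp; ring
      have a3 : 0 ≤ (κ₀ * ‖ζ‖ - 2 * ‖B‖ * ‖d‖) ^ 2 / (4 * κ₀) := by positivity
      linarith
    have h7 : ‖ζ‖ ^ 2 ≤ 2 * ‖z‖ ^ 2 + 2 * ‖d‖ ^ 2 := by
      have : ‖ζ‖ ≤ ‖z‖ + ‖d‖ := by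
        have : ζ = z - d := by rw [hd]; abel
        rw [this]; exact norm_sub_le _ _
      exact sq_le_two this (norm_nonneg _)
    simp only [_root_.add_apply, _root_.smul_apply,
      ContinuousLinearMap.id_apply, inner_add_left, inner_smul_left, conj_trivial,
      real_inner_self_eq_norm_sq]
    rw [e0]
    have h8 : s * ‖d‖ ^ 2 = ‖d‖ ^ 2 + 2 * (κ₀ * ‖d‖ ^ 2 + ‖B‖ ^ 2 / κ₀ * ‖d‖ ^ 2
      + ‖B‖ * ‖d‖ ^ 2) := by rw [hs]; ring
    have h9 : 0 ≤ ‖d‖ ^ 2 := by positivity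
    have h10 : 0 ≤ ‖B‖ * ‖d‖ ^ 2 := by positivity
    have h11 : κ₀ * ‖ζ‖ ^ 2 ≤ κ₀ * (2 * ‖z‖ ^ 2 + 2 * ‖d‖ ^ 2) := by gcongr
    rw [h3]
    have h12 : s / 2 * ‖z‖ ^ 2 = s / 2 * (‖ζ‖ ^ 2 + 2 * ⟪ζ, d⟫ + ‖d‖ ^ 2) := by rw [h2]
    linarith
  have hf0 : f 0 = 0 := by
    have h1 := hub 0
    have h2 := hle₁ 0 0 (by simp [hρ.le])
    have h3 := hle₂ 0 0 (by simp [hρ.le])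
    simp only [map_zero, inner_zero_left, norm_zero, mul_zero, hu0, hw0] at h1 h2 h3
    norm_num at h1 h2 h3
    simp only [hf] at h1 ⊢
    simp only [WithLp.zero_fst, WithLp.zero_snd] at h1 ⊢
    linarith
  set r : ℝ := min 1 (min (ρ / 2) (min (κ / (1 + s)) (κ / (1 + ‖B‖)))) with hr
  have hr0 : 0 < r := by positivity
  have hr1 : r ≤ 1 := min_le_left _ _
  have hr2 : r ≤ ρ / 2 := (min_le_right _ _).trans (min_le_left _ _)
  have hr3 : r * (1 + s) ≤ κ := by
    have : r ≤ κ / (1 + s) :=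
      ((min_le_right _ _).trans (min_le_right _ _)).trans (min_le_left _ _)
    rwa [le_div_iff₀ (by positivity)] at this
  have hr4 : r * (1 + ‖B‖) ≤ κ := by
    have : r ≤ κ / (1 + ‖B‖) :=
      ((min_le_right _ _).trans (min_le_right _ _)).trans (min_le_right _ _)
    rwa [le_div_iff₀ (by positivity)] at this
  have hrs : r ≤ r * s := le_mul_of_one_le_right hr0.le hs1
  clear_value r
  obtain ⟨x, g, M, hx, hg, hexp, hM⟩ := JA hsubf (x₀ := 0) (g₀ := 0)
    (B + s • ContinuousLinearMap.id ℝ (WithLp 2 (V × V))) (by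
      intro a b
      simp [inner_add_left, inner_add_right, inner_smul_left, inner_smul_right, hB])
    (κ := κ₀ / 4) (ρ := 1) (r := r) (by positivity) one_pos hr0 (by
      intro h _
      rw [zero_add, hf0, inner_zero_left]
      have := hub h
      linarith)
  rw [sub_zero] at hx hg
  set M₁ : V →L[ℝ] V := (WithLp.fstL 2 ℝ V V).comp (M.comp il) with hM₁
  set M₂ : V →L[ℝ] V := (WithLp.sndL 2 ℝ V V).comp (M.comp ir) with hM₂
  have hM₁a : ∀ h, ⟪M (il h), il h⟫ = ⟪M₁ h, h⟫ := fun h => inner_il _ _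
  have hM₂a : ∀ h, ⟪M (ir h), ir h⟫ = ⟪M₂ h, h⟫ := fun h => inner_ir _ _
  have tl : Tendsto (il : V → WithLp 2 (V × V)) (𝓝 0) (𝓝 0) := by
    have := (il (V := V)).continuous.tendsto 0
    rwa [map_zero] at this
  have tr : Tendsto (ir : V → WithLp 2 (V × V)) (𝓝 0) (𝓝 0) := by
    have := (ir (V := V)).continuous.tendsto 0
    rwa [map_zero] at this
  have exp₁ : ∀ δ > (0:ℝ), ∀ᶠ h in 𝓝 (0 : V),
      |f₁ (x.fst + h) - f₁ x.fst - ⟪g.fst, h⟫ - 1 / 2 * ⟪M₁ h, h⟫| ≤ δ * ‖h‖ ^ 2 := by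
    intro δ hδ
    filter_upwards [tl.eventually (hexp δ hδ)] with h hh
    rw [hM₁a, inner_il, norm_il] at hh
    simp only [hf, WithLp.add_fst, WithLp.add_snd, il_fst, il_snd, add_zero] at hh
    convert hh using 2; ring
  have exp₂ : ∀ δ > (0:ℝ), ∀ᶠ h in 𝓝 (0 : V),
      |f₂ (x.snd + h) - f₂ x.snd - ⟪g.snd, h⟫ - 1 / 2 * ⟪M₂ h, h⟫| ≤ δ * ‖h‖ ^ 2 := by
    intro δ hδ
    filter_upwards [tr.eventually (hexp δ hδ)] with h hh
    rw [hM₂a, inner_ir, norm_ir] at hh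
    simp only [hf, WithLp.add_fst, WithLp.add_snd, ir_fst, ir_snd, add_zero] at hh
    convert hh using 2; ring
  have hx1 : ‖x.fst‖ ≤ r := (fst_le x).trans hx
  have hx2 : ‖x.snd‖ ≤ r := (snd_le x).trans hx
  have hg1 : ‖g.fst‖ ≤ r := (fst_le g).trans hg
  have hg2 : ‖g.snd‖ ≤ r := (snd_le g).trans hg
  have half : ∀ (f' : V → ℝ) (x' g' : V) (M' : V →L[ℝ] V) (δ : ℝ), (∀ᶠ h in 𝓝 (0 : V),
      |f' (x' + h) - f' x' - ⟪g', h⟫ - 1 / 2 * ⟪M' h, h⟫| ≤ δ * ‖h‖ ^ 2) → ∀ᶠ h in 𝓝 (0 : V),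
      f' (x' + h) ≤ f' x' + ⟪g', h⟫ + 1 / 2 * ⟪M' h, h⟫ + δ * ‖h‖ ^ 2 := by
    intro f' x' g' M' δ h
    filter_upwards [h] with k hk
    have := (abs_le.mp hk).2
    linarith
  have hgm₁ : s • m₁ x.fst = g.fst := grad_unique (M := M₁) (hsub₁ x.fst) (by
    simpa using half _ _ _ _ _ (exp₁ 1 one_pos))
  have hgm₂ : s • m₂ x.snd = g.snd := grad_unique (M := M₂) (hsub₂ x.snd) (by
    simpa using half _ _ _ _ _ (exp₂ 1 one_pos))
  have hnm₁ : s * ‖m₁ x.fst‖ ≤ r := by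
    have : ‖s • m₁ x.fst‖ ≤ r := by rw [hgm₁]; exact hg1
    rwa [norm_smul, Real.norm_of_nonneg (by linarith)] at this
  have hnm₂ : s * ‖m₂ x.snd‖ ≤ r := by
    have : ‖s • m₂ x.snd‖ ≤ r := by rw [hgm₂]; exact hg2
    rwa [norm_smul, Real.norm_of_nonneg (by linarith)] at this
  have hm1r : ‖m₁ x.fst‖ ≤ r := (le_mul_of_one_le_left (norm_nonneg _) hs1).trans hnm₁
  have hm2r : ‖m₂ x.snd‖ ≤ r := (le_mul_of_one_le_left (norm_nonneg _) hs1).trans hnm₂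
  have hrr : r * r ≤ r := mul_le_of_le_one_left hr0.le hr1
  have hrκ : r ≤ κ := by have := mul_nonneg hr0.le (norm_nonneg B); linarith
  have val : ∀ (u' : ℝ) (x' m' : V) (F : ℝ), F = u' + s * ⟪x', m'⟫ - s / 2 * ‖m'‖ ^ 2 →
      0 ≤ F → ‖x'‖ ≤ r → s * ‖m'‖ ≤ r → -κ ≤ u' := by
    intro u' x' m' F h1 h2 h3 h4
    have h5 : s * ⟪x', m'⟫ ≤ r * r := by
      calc s * ⟪x', m'⟫ ≤ s * (‖x'‖ * ‖m'‖) := by gcongr; exact real_inner_le_norm _ _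
        _ = ‖x'‖ * (s * ‖m'‖) := by ring
        _ ≤ r * r := by gcongr
    have h6 : 0 ≤ s / 2 * ‖m'‖ ^ 2 := by positivity
    linarith
  have Bbd : ∀ z, ‖z‖ ≤ r → 1 / 2 * ⟪B z, z⟫ - κ₀ * ‖z‖ ^ 2 ≤ κ := by
    intro z hz
    have h1 := form_le B z
    have h2 : ‖B‖ * ‖z‖ ^ 2 ≤ ‖B‖ * (r * r) := by
      rw [sq]; gcongr
    have h3 : ‖B‖ * (r * r) ≤ ‖B‖ * r := by gcongr
    have h4 : 0 ≤ κ₀ * ‖z‖ ^ 2 := by positivity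
    linarith
  refine ⟨m₁ x.fst, m₂ x.snd, g.fst - s • x.fst, g.snd - s • x.snd,
    M₁ + (2 * (κ / 2) - s) • ContinuousLinearMap.id ℝ V,
    M₂ + (2 * (κ / 2) - s) • ContinuousLinearMap.id ℝ V,
    by linarith, by linarith, ?_, ?_, ?_, ?_, ?_, ?_, ?_⟩
  · rw [abs_le]
    refine ⟨val _ _ _ _ (hm₁ x.fst).2 ?_ hx1 hnm₁, ?_⟩
    · have := hle₁ x.fst 0 (by simp [hρ.le])
      simpa [hu0] using this
    · have h1 := hmax (il (m₁ x.fst)) (by rw [il_fst]; linarith) (by rw [il_snd]; simp [hρ.le])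
      have h2 := Bbd (il (m₁ x.fst)) (by rw [norm_il]; exact hm1r)
      rw [il_fst, il_snd, hw0] at h1
      linarith
  · rw [abs_le]
    refine ⟨val _ _ _ _ (hm₂ x.snd).2 ?_ hx2 hnm₂, ?_⟩
    · have := hle₂ x.snd 0 (by simp [hρ.le])
      simpa [hw0] using this
    · have h1 := hmax (ir (m₂ x.snd)) (by rw [ir_fst]; simp [hρ.le]) (by rw [ir_snd]; linarith)
      have h2 := Bbd (ir (m₂ x.snd)) (by rw [norm_ir]; exact hm2r)
      rw [ir_fst, ir_snd, hu0] at h1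
      linarith
  · refine (norm_sub_le _ _).trans ?_
    rw [norm_smul, Real.norm_of_nonneg (by linarith)]
    have := mul_le_mul_of_nonneg_left hx1 (show 0 ≤ s by linarith)
    linarith
  · refine (norm_sub_le _ _).trans ?_
    rw [norm_smul, Real.norm_of_nonneg (by linarith)]
    have := mul_le_mul_of_nonneg_left hx2 (show 0 ≤ s by linarith)
    linarith
  · exact transfer hle₁ (by linarith) (hm₁ x.fst).2 (half _ _ _ _ _ (exp₁ (κ / 2) (by positivity)))
  · exact transfer hle₂ (by linarith) (hm₂ x.snd).2 (half _ _ _ _ _ (exp₂ (κ / 2) (by positivity)))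
  · intro z
    have key : ⟪M₁ z.fst, z.fst⟫ + ⟪M₂ z.snd, z.snd⟫ ≤ ⟪M z, z⟫ := by
      refine le_of_forall_pos_le_add fun ε hε => ?_
      set δ := ε / (4 * (‖z‖ ^ 2 + 1)) with hδ
      have hδ0 : 0 < δ := by positivity
      have t0 : ∀ k : V, Tendsto (fun τ : ℝ => τ • k) (𝓝[>] 0) (𝓝 0) := fun k => by
        apply Tendsto.mono_left _ nhdsWithin_le_nhds
        have : Continuous fun τ : ℝ => τ • k := by fun_prop
        simpa using this.tendsto 0
      have t1 : Tendsto (fun τ : ℝ => τ • z) (𝓝[>] 0) (𝓝 0) := by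
        apply Tendsto.mono_left _ nhdsWithin_le_nhds
        have : Continuous fun τ : ℝ => τ • z := by fun_prop
        simpa using this.tendsto 0
      obtain ⟨τ, ⟨⟨a1, a2⟩, a3⟩, a4⟩ := ((((t1.eventually (hexp δ hδ0)).and
        ((t0 z.fst).eventually (exp₁ δ hδ0))).and
        ((t0 z.snd).eventually (exp₂ δ hδ0))).and self_mem_nhdsWithin).exists
      have hτ : 0 < τ := a4
      have b1 := (abs_le.mp a1).2
      have b2 := (abs_le.mp a2).1
      have b3 := (abs_le.mp a3).1
      simp only [map_smul, inner_smul_left, inner_smul_right, norm_smul,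
        Real.norm_of_nonneg hτ.le, conj_trivial, hf, WithLp.add_fst, WithLp.add_snd,
        WithLp.smul_fst, WithLp.smul_snd] at b1 b2 b3
      have e1 : ⟪g, z⟫ = ⟪g.fst, z.fst⟫ + ⟪g.snd, z.snd⟫ := WithLp.prod_inner_apply _ _
      have e2 : ‖z‖ ^ 2 = ‖z.fst‖ ^ 2 + ‖z.snd‖ ^ 2 := WithLp.prod_norm_sq_eq_of_L2 z
      have e3 : δ * (4 * (‖z‖ ^ 2 + 1)) = ε := by rw [hδ]; field_simp
      rw [e1] at b1
      simp only [mul_pow] at b1 b2 b3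
      have h10 : τ ^ 2 * (⟪M₁ z.fst, z.fst⟫ + ⟪M₂ z.snd, z.snd⟫) ≤ τ ^ 2 * (⟪M z, z⟫ + ε) := by
        have e4 : δ * (τ ^ 2 * ‖z‖ ^ 2) = δ * (τ ^ 2 * ‖z.fst‖ ^ 2) + δ * (τ ^ 2 * ‖z.snd‖ ^ 2) := by
          rw [e2]; ring
        have e5 : τ ^ 2 * ε = 4 * (δ * (τ ^ 2 * ‖z‖ ^ 2)) + 4 * δ * τ ^ 2 := by rw [← e3]; ring
        have e6 : 0 ≤ 4 * δ * τ ^ 2 := by positivity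
        linarith
      exact le_of_mul_le_mul_left h10 (by positivity)
    have h2 := hM z
    have e2 : ‖z‖ ^ 2 = ‖z.fst‖ ^ 2 + ‖z.snd‖ ^ 2 := WithLp.prod_norm_sq_eq_of_L2 z
    simp only [_root_.add_apply, _root_.smul_apply,
      ContinuousLinearMap.id_apply, inner_add_left, inner_smul_left, conj_trivial,
      real_inner_self_eq_norm_sq] at h2 ⊢
    rw [e2] at h2 ⊢
    linarith
end TS

section TS
variable {V : Type*} [NormedAddCommGroup V] [InnerProductSpace ℝ V]

lemma TS_back {u : V → ℝ} {x₀ p x p₁ : V} {κ₀ κ' κ : ℝ} {X : V →L[ℝ] V} (hκ₀ : 0 ≤ κ₀)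
    (hκ' : 0 ≤ κ') (hκ1 : κ' ≤ 1)
    (h1 : κ' * (1 + ‖p‖ + 2 * κ₀) ≤ κ) (hx : ‖x‖ ≤ κ') (hp : ‖p₁‖ ≤ κ')
    (hv : |u (x₀ + x) - u x₀ - ⟪p, x⟫ - κ₀ * ‖x‖ ^ 2| ≤ κ')
    (hj : ∀ᶠ k in 𝓝 (0 : V), u (x₀ + (x + k)) - u x₀ - ⟪p, x + k⟫ - κ₀ * ‖x + k‖ ^ 2 ≤
      u (x₀ + x) - u x₀ - ⟪p, x⟫ - κ₀ * ‖x‖ ^ 2 + ⟪p₁, k⟫ + 1 / 2 * ⟪X k, k⟫) :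
    ‖x₀ + x - x₀‖ ≤ κ ∧ |u (x₀ + x) - u x₀| ≤ κ ∧ ‖p + p₁ + (2 * κ₀) • x - p‖ ≤ κ ∧
    ∀ᶠ k in 𝓝 (0 : V), u (x₀ + x + k) ≤ u (x₀ + x) + ⟪p + p₁ + (2 * κ₀) • x, k⟫ +
      1 / 2 * ⟪(X + (2 * κ₀) • ContinuousLinearMap.id ℝ V) k, k⟫ := by
  have hn := norm_nonneg p
  have hκp : 0 ≤ κ' * ‖p‖ := by positivity
  have hκk : 0 ≤ κ' * κ₀ := by positivity
  refine ⟨?_, ?_, ?_, ?_⟩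
  · rw [add_sub_cancel_left]; linarith
  · have a1 : |⟪p, x⟫| ≤ ‖p‖ * κ' := (abs_real_inner_le_norm _ _).trans (by gcongr)
    have a2 : κ₀ * ‖x‖ ^ 2 ≤ κ₀ * κ' := by
      have : ‖x‖ ^ 2 ≤ κ' ^ 2 := by gcongr
      have : κ' ^ 2 ≤ κ' := by nlinarith
      gcongr; linarith
    have a3 : 0 ≤ κ₀ * ‖x‖ ^ 2 := by positivity
    rw [abs_le] at a1 hv ⊢
    constructor <;> linarith [hv.1, hv.2, a1.1, a1.2]
  · have e : p + p₁ + (2 * κ₀) • x - p = p₁ + (2 * κ₀) • x := by abel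
    rw [e]
    refine (norm_add_le _ _).trans ?_
    rw [norm_smul, Real.norm_of_nonneg (by positivity)]
    have : 2 * κ₀ * ‖x‖ ≤ 2 * κ₀ * κ' := by gcongr
    linarith
  · filter_upwards [hj] with k hk
    have e1 : ‖x + k‖ ^ 2 = ‖x‖ ^ 2 + 2 * ⟪x, k⟫ + ‖k‖ ^ 2 := norm_add_sq_real x k
    rw [e1, inner_add_right, ← add_assoc] at hk
    simp only [_root_.add_apply, _root_.smul_apply,
      ContinuousLinearMap.id_apply, inner_add_left, inner_smul_left, conj_trivial,
      real_inner_self_eq_norm_sq]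
    linarith

variable [FiniteDimensional ℝ V]

lemma TS_usc {u : V → ℝ} {x₀ p : V} {ρ κ₀ : ℝ}
    (hu : UpperSemicontinuousOn u (Metric.closedBall x₀ ρ)) :
    UpperSemicontinuousOn (fun h => u (x₀ + h) - u x₀ - ⟪p, h⟫ - κ₀ * ‖h‖ ^ 2)
      (Metric.closedBall 0 ρ) := by
  have h1 : UpperSemicontinuousOn (fun h => u (x₀ + h)) (Metric.closedBall 0 ρ) := by
    intro h hh y hy
    have t : Tendsto (fun h => x₀ + h) (𝓝[Metric.closedBall 0 ρ] h)
        (𝓝[Metric.closedBall x₀ ρ] (x₀ + h)) := by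
      refine ContinuousWithinAt.tendsto_nhdsWithin (by fun_prop) fun k hk => ?_
      simpa using hk
    exact t.eventually (hu (x₀ + h) (by simpa using hh) y hy)
  have h2 : UpperSemicontinuousOn (fun h => u (x₀ + h) + (- u x₀ - ⟪p, h⟫ - κ₀ * ‖h‖ ^ 2))
      (Metric.closedBall 0 ρ) := by
    apply UpperSemicontinuousOn.add h1
    apply ContinuousOn.upperSemicontinuousOn
    fun_prop
  convert h2 using 2
  ring

/-- Theorem on sums -/
lemma TS {u w : V → ℝ} {x₀ y₀ p q : V} {ρ : ℝ} (hρ : 0 < ρ)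
    (hu : UpperSemicontinuousOn u (Metric.closedBall x₀ ρ))
    (hw : UpperSemicontinuousOn w (Metric.closedBall y₀ ρ))
    (B : WithLp 2 (V × V) →L[ℝ] WithLp 2 (V × V))
    (hB : ∀ a b, ⟪B a, b⟫ = ⟪a, B b⟫)
    (hmax : ∀ z : WithLp 2 (V × V), ‖z.fst‖ ≤ ρ → ‖z.snd‖ ≤ ρ →
      u (x₀ + z.fst) + w (y₀ + z.snd) ≤ u x₀ + w y₀ + ⟪p, z.fst⟫ + ⟪q, z.snd⟫ + 1 / 2 * ⟪B z, z⟫)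
    {κ : ℝ} (hκ : 0 < κ) :
    ∃ (x y p' q' : V) (X Y : V →L[ℝ] V), (‖x - x₀‖ ≤ κ ∧ |u x - u x₀| ≤ κ ∧ ‖p' - p‖ ≤ κ ∧
      (∀ᶠ k in 𝓝 (0 : V), u (x + k) ≤ u x + ⟪p', k⟫ + 1 / 2 * ⟪X k, k⟫)) ∧
      (‖y - y₀‖ ≤ κ ∧ |w y - w y₀| ≤ κ ∧ ‖q' - q‖ ≤ κ ∧
      (∀ᶠ k in 𝓝 (0 : V), w (y + k) ≤ w y + ⟪q', k⟫ + 1 / 2 * ⟪Y k, k⟫)) ∧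
      ∀ z : WithLp 2 (V × V), ⟪X z.fst, z.fst⟫ + ⟪Y z.snd, z.snd⟫ ≤ ⟪B z, z⟫ + κ * ‖z‖ ^ 2 := by
  set κ₀ := κ / 4 with hκ₀
  set D := 2 + ‖p‖ + ‖q‖ + κ with hD
  have hD0 : 0 < D := by positivity
  set κ' := min 1 (κ / D) with hκ'
  have hκ'0 : 0 < κ' := by positivity
  have hκ'1 : κ' ≤ 1 := min_le_left _ _
  have hκ'2 : κ' * D ≤ κ := by
    have : κ' ≤ κ / D := min_le_right _ _
    rwa [le_div_iff₀ hD0] at this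
  have i1 : 0 ≤ κ' * ‖p‖ := by positivity
  have i2 : 0 ≤ κ' * ‖q‖ := by positivity
  have i3 : 0 ≤ κ' * κ := by positivity
  have hex : κ' * D = 2 * κ' + κ' * ‖p‖ + κ' * ‖q‖ + κ' * κ := by rw [hD]; ring
  obtain ⟨x, y, p₁, q₁, X, Y, hx, hy, hux, hwy, hp, hq, hjx, hjy, hXY⟩ := TS_core hρ
    (TS_usc (p := p) (κ₀ := κ₀) hu) (TS_usc (p := q) (κ₀ := κ₀) hw) (by simp) (by simp) B hB
    (κ₀ := κ₀) (by positivity) (by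
      intro z h1 h2
      have := hmax z h1 h2
      rw [WithLp.prod_norm_sq_eq_of_L2]
      linarith) hκ'0
  have r1 := TS_back (κ := κ) (by positivity) hκ'0.le hκ'1 (by rw [hκ₀]; linarith) hx hp hux hjx
  have r2 := TS_back (κ := κ) (by positivity) hκ'0.le hκ'1 (by rw [hκ₀]; linarith) hy hq hwy hjy
  refine ⟨_, _, _, _, _, _, r1, r2, fun z => ?_⟩
  have h1 := hXY z
  have e2 : ‖z‖ ^ 2 = ‖z.fst‖ ^ 2 + ‖z.snd‖ ^ 2 := WithLp.prod_norm_sq_eq_of_L2 z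
  have h2 : κ' * ‖z‖ ^ 2 ≤ (κ - 2 * κ₀) * ‖z‖ ^ 2 := by gcongr; linarith
  simp only [_root_.add_apply, _root_.smul_apply,
      ContinuousLinearMap.id_apply, inner_add_left, inner_smul_left, conj_trivial,
      real_inner_self_eq_norm_sq]
  have e3 : (κ - 2 * κ₀) * ‖z‖ ^ 2 = κ * ‖z‖ ^ 2 - (2 * κ₀ * ‖z.fst‖ ^ 2 + 2 * κ₀ * ‖z.snd‖ ^ 2) := by
    rw [e2]; ring
  linarith
end TS

/-- quadratic form of a matrix -/
def qf (X : Matrix (Fin N) (Fin N) ℝ) (h : E N) : ℝ := ∑ i, ∑ j, X i j * h i * h j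

/-- parabolic upper jets -/
def UJ (u : E N → ℝ → ℝ) (x : E N) (t a : ℝ) (p : E N) (X : Matrix (Fin N) (Fin N) ℝ) (c : ℝ) :
    Prop :=
  ∀ᶠ q : E N × ℝ in 𝓝 (x, t), u q.1 q.2 ≤ u x t + a * (q.2 - t) + ⟪p, q.1 - x⟫
    + 1 / 2 * qf X (q.1 - x) + c * (q.2 - t) ^ 2

/-- subsolutions of Bellman equations through jets -/
def SubF (σ : Θ → E N → Matrix (Fin N) (Fin N) ℝ) (F : Θ → E N → ℝ → E N → ℝ)
    (u : E N → ℝ → ℝ) : Prop :=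
  ∀ θ x t a p X c, 0 < t → X.IsSymm → UJ u x t a p X c →
    a - Matrix.trace (σ θ x * (σ θ x)ᵀ * X) + F θ x (u x t) p ≤ 0

/-- supersolutions of Bellman equations through jets -/
def SupF (σ : Θ → E N → Matrix (Fin N) (Fin N) ℝ) (F : Θ → E N → ℝ → E N → ℝ)
    (u : E N → ℝ → ℝ) : Prop :=
  ∀ x t a p X c, 0 < t → X.IsSymm → UJ (fun x t => -u x t) x t (-a) (-p) (-X) (-c) →
    ∀ κ > (0:ℝ), ∃ θ, -κ ≤ a - Matrix.trace (σ θ x * (σ θ x)ᵀ * X) + F θ x (u x t) p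

/-- equicontinuity in the parameter -/
def EquiC (F : Θ → E N → ℝ → E N → ℝ) : Prop :=
  ∀ x r p, ∀ ε > (0:ℝ), ∃ δ > (0:ℝ), ∀ θ x' r' p', ‖x' - x‖ ≤ δ → |r' - r| ≤ δ → ‖p' - p‖ ≤ δ →
    |F θ x' r' p' - F θ x r p| ≤ ε

lemma qf_neg (X : Matrix (Fin N) (Fin N) ℝ) (h : E N) : qf (-X) h = - qf X h := by
  simp [qf]

lemma qf_add (X Y : Matrix (Fin N) (Fin N) ℝ) (h : E N) : qf (X + Y) h = qf X h + qf Y h := by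
  simp [qf, add_mul, Finset.sum_add_distrib]

lemma qf_smul_one (δ : ℝ) (h : E N) :
    qf (δ • (1 : Matrix (Fin N) (Fin N) ℝ)) h = δ * ‖h‖ ^ 2 := by
  simp only [qf, Matrix.smul_apply, Matrix.one_apply, EuclideanSpace.real_norm_sq_eq,
    Finset.mul_sum]
  refine Finset.sum_congr rfl fun i _ => ?_
  simp; ring

lemma qf_clm (T : E N →L[ℝ] E N) (h : E N) :
    qf (Matrix.of fun i j => 1 / 2 * (T (EuclideanSpace.single j 1) i
      + T (EuclideanSpace.single i 1) j)) h = ⟪T h, h⟫ := by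
  have e : h = ∑ j, h j • EuclideanSpace.single j (1 : ℝ) := by
    have := (EuclideanSpace.basisFun (Fin N) ℝ).sum_repr h
    simpa using this.symm
  have e2 : ∀ i, T h i = ∑ j, h j * T (EuclideanSpace.single j 1) i := by
    intro i
    conv_lhs => rw [e]
    simp
  have e3 : ⟪T h, h⟫ = ∑ i, ∑ j, T (EuclideanSpace.single j 1) i * h i * h j := by
    rw [PiLp.inner_apply]
    refine Finset.sum_congr rfl fun i _ => ?_
    simp only [e2, RCLike.inner_apply, conj_trivial, Finset.mul_sum]
    refine Finset.sum_congr rfl fun j _ => by ring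
  have e4 : ⟪T h, h⟫ = ∑ i, ∑ j, T (EuclideanSpace.single i 1) j * h i * h j := by
    rw [e3, Finset.sum_comm]
    refine Finset.sum_congr rfl fun i _ => Finset.sum_congr rfl fun j _ => by ring
  have e5 : ⟪T h, h⟫ = 1 / 2 * (⟪T h, h⟫ + ⟪T h, h⟫) := by ring
  rw [e5]
  nth_rw 1 [e3]
  rw [e4, ← Finset.sum_add_distrib, Finset.mul_sum]
  simp only [qf]
  refine Finset.sum_congr rfl fun i _ => ?_
  rw [← Finset.sum_add_distrib, Finset.mul_sum]
  refine Finset.sum_congr rfl fun j _ => ?_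
  simp only [Matrix.of_apply]; ring

/-- columns -/
def colv (S : Matrix (Fin N) (Fin N) ℝ) (k : Fin N) : E N := WithLp.toLp 2 fun i => S i k

lemma trace_qf (S X : Matrix (Fin N) (Fin N) ℝ) :
    Matrix.trace (S * Sᵀ * X) = ∑ k, qf X (colv S k) := by
  simp only [Matrix.trace, Matrix.diag, Matrix.mul_apply, Matrix.transpose_apply, qf, colv,
    Finset.sum_mul]
  rw [Finset.sum_comm]
  have : ∀ j, ∑ i, ∑ k, S i k * S j k * X j i = ∑ k, ∑ i, S i k * S j k * X j i := fun j =>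
    Finset.sum_comm
  simp only [this]
  rw [Finset.sum_comm]
  refine Finset.sum_congr rfl fun k _ => Finset.sum_congr rfl fun i _ =>
    Finset.sum_congr rfl fun j _ => by ring

lemma mnorm_sq (S : Matrix (Fin N) (Fin N) ℝ) : mnorm S ^ 2 = ∑ i, ∑ j, (S i j) ^ 2 := by
  unfold mnorm
  rw [Real.sq_sqrt]; positivity

lemma col_sq (S S' : Matrix (Fin N) (Fin N) ℝ) :
    ∑ k, ‖colv S k - colv S' k‖ ^ 2 = mnorm (S - S') ^ 2 := by
  rw [mnorm_sq, Finset.sum_comm]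
  refine Finset.sum_congr rfl fun k _ => ?_
  rw [EuclideanSpace.real_norm_sq_eq]
  rfl

lemma sum2_le {f : Fin N → Fin N → ℝ} {c : ℝ} (h : ∀ i j, f i j ≤ c) :
    ∑ i, ∑ j, f i j ≤ N ^ 2 * c := by
  calc ∑ i, ∑ j, f i j ≤ ∑ _i : Fin N, ∑ _j : Fin N, c :=
        Finset.sum_le_sum fun i _ => Finset.sum_le_sum fun j _ => h i j
    _ = _ := by simp; ring

lemma col_bd {S : Matrix (Fin N) (Fin N) ℝ} {C : ℝ} (h : ∀ i j, |S i j| ≤ C) :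
    ∑ k, ‖colv S k‖ ^ 2 ≤ N ^ 2 * C ^ 2 := by
  have := col_sq S 0
  have e : ∀ k, colv (0 : Matrix (Fin N) (Fin N) ℝ) k = 0 := fun k => rfl
  simp only [e, sub_zero] at this
  rw [this, mnorm_sq]
  refine sum2_le fun i j => ?_
  rw [← sq_abs]; gcongr; exact h i j

/-- splitting space and time in a quadratic form -/
lemma cross (T : WithLp 2 (E N × ℝ) →L[ℝ] WithLp 2 (E N × ℝ)) {δ : ℝ} (hδ : 0 < δ) :
    ∃ (X : Matrix (Fin N) (Fin N) ℝ) (c : ℝ), X.IsSymm ∧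
      (∀ z : WithLp 2 (E N × ℝ), 1 / 2 * ⟪T z, z⟫ ≤ 1 / 2 * qf X z.fst + c * z.snd ^ 2) ∧
      ∀ h : E N, qf X h = ⟪T (WithLp.toLp 2 (h, 0)), WithLp.toLp 2 (h, (0:ℝ))⟫ + δ * ‖h‖ ^ 2 := by
  set j : E N →L[ℝ] WithLp 2 (E N × ℝ) :=
    (WithLp.prodContinuousLinearEquiv 2 ℝ (E N) ℝ).symm.toContinuousLinearMap.comp
      (ContinuousLinearMap.inl ℝ (E N) ℝ) with hj
  have hja : ∀ h, j h = WithLp.toLp 2 (h, 0) := fun h => rfl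
  set T₁ : E N →L[ℝ] E N := (WithLp.fstL 2 ℝ (E N) ℝ).comp (T.comp j) with hT₁
  have hT₁a : ∀ h, ⟪T (j h), j h⟫ = ⟪T₁ h, h⟫ := fun h => by
    rw [WithLp.prod_inner_apply]
    change ⟪T₁ h, h⟫ + ⟪(T (j h)).snd, (0 : ℝ)⟫ = _
    simp
  have hq : ∀ h : E N, qf ((Matrix.of fun i k => 1 / 2 * (T₁ (EuclideanSpace.single k 1) i
      + T₁ (EuclideanSpace.single i 1) k)) + δ • (1 : Matrix (Fin N) (Fin N) ℝ)) h
      = ⟪T (j h), j h⟫ + δ * ‖h‖ ^ 2 := fun h => by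
    rw [qf_add, qf_clm, qf_smul_one, hT₁a]
  refine ⟨_, 1 / 2 * (‖T‖ + ‖T‖ ^ 2 / δ), ?_, fun z => ?_, hq⟩
  · rw [Matrix.IsSymm.ext_iff]
    intro i k
    simp only [Matrix.add_apply, Matrix.of_apply, Matrix.smul_apply, Matrix.one_apply]
    rw [add_comm (T₁ (EuclideanSpace.single i 1) k)]
    simp [eq_comm]
  · rw [hq]
    set e : WithLp 2 (E N × ℝ) := WithLp.toLp 2 (0, z.snd) with he
    have hz : z = j z.fst + e := by
      apply WithLp.ofLp_injective 2
      refine Prod.ext ?_ ?_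
      · change _ = z.fst + 0; simp
      · change _ = 0 + z.snd; simp
    have hen : ‖e‖ ^ 2 = z.snd ^ 2 := by
      rw [WithLp.prod_norm_sq_eq_of_L2]
      change ‖(0 : E N)‖ ^ 2 + ‖z.snd‖ ^ 2 = _
      simp
    have hjn : ‖j z.fst‖ ^ 2 = ‖z.fst‖ ^ 2 := by
      rw [WithLp.prod_norm_sq_eq_of_L2]
      change ‖z.fst‖ ^ 2 + ‖(0 : ℝ)‖ ^ 2 = _
      simp
    have b1 : ⟪T z, z⟫ = ⟪T (j z.fst), j z.fst⟫ + ⟪T (j z.fst), e⟫ + ⟪T e, j z.fst⟫ + ⟪T e, e⟫ := by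
      conv_lhs => rw [hz]
      rw [map_add, inner_add_left, inner_add_right, inner_add_right]; ring
    have b2 : ⟪T (j z.fst), e⟫ ≤ ‖T‖ * ‖j z.fst‖ * ‖e‖ :=
      (real_inner_le_norm _ _).trans (by gcongr; exact T.le_opNorm _)
    have b3 : ⟪T e, j z.fst⟫ ≤ ‖T‖ * ‖e‖ * ‖j z.fst‖ :=
      (real_inner_le_norm _ _).trans (by gcongr; exact T.le_opNorm _)
    have b4 := form_le T e
    have b5 : 2 * (‖T‖ * ‖j z.fst‖ * ‖e‖) ≤ δ * ‖j z.fst‖ ^ 2 + ‖T‖ ^ 2 / δ * ‖e‖ ^ 2 := by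
      have a2 : δ * ‖j z.fst‖ ^ 2 + ‖T‖ ^ 2 / δ * ‖e‖ ^ 2 - 2 * (‖T‖ * ‖j z.fst‖ * ‖e‖)
          = (δ * ‖j z.fst‖ - ‖T‖ * ‖e‖) ^ 2 / δ := by field_simp; ring
      have a3 : 0 ≤ (δ * ‖j z.fst‖ - ‖T‖ * ‖e‖) ^ 2 / δ := by positivity
      linarith
    rw [hen] at b4 b5
    rw [hjn] at b5
    linarith

lemma UJ_of_quad {U : E N → ℝ → ℝ} {v P : WithLp 2 (E N × ℝ)}
    {T : WithLp 2 (E N × ℝ) →L[ℝ] WithLp 2 (E N × ℝ)}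
    (h : ∀ᶠ k in 𝓝 (0 : WithLp 2 (E N × ℝ)), U (v + k).fst (v + k).snd ≤
      U v.fst v.snd + ⟪P, k⟫ + 1 / 2 * ⟪T k, k⟫) {δ : ℝ} (hδ : 0 < δ) :
    ∃ (X : Matrix (Fin N) (Fin N) ℝ) (c : ℝ), X.IsSymm ∧ UJ U v.fst v.snd P.snd P.fst X c ∧
      ∀ h : E N, qf X h = ⟪T (WithLp.toLp 2 (h, 0)), WithLp.toLp 2 (h, (0:ℝ))⟫ + δ * ‖h‖ ^ 2 := by
  obtain ⟨X, c, h1, h2, h3⟩ := cross T hδ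
  refine ⟨X, c, h1, ?_, h3⟩
  have ht : Tendsto (fun q : E N × ℝ => (WithLp.toLp 2 (q.1 - v.fst, q.2 - v.snd) :
      WithLp 2 (E N × ℝ))) (𝓝 (v.fst, v.snd)) (𝓝 0) := by
    have : Continuous (fun q : E N × ℝ => (WithLp.toLp 2 (q.1 - v.fst, q.2 - v.snd) :
      WithLp 2 (E N × ℝ))) := by fun_prop
    have h0 := this.tendsto (v.fst, v.snd)
    simp only [sub_self] at h0
    exact h0
  filter_upwards [ht.eventually h] with q hq
  have e1 : (v + WithLp.toLp 2 (q.1 - v.fst, q.2 - v.snd)).fst = q.1 := by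
    change v.fst + (q.1 - v.fst) = _; abel
  have e2 : (v + WithLp.toLp 2 (q.1 - v.fst, q.2 - v.snd)).snd = q.2 := by
    change v.snd + (q.2 - v.snd) = _; ring
  rw [e1, e2, WithLp.prod_inner_apply] at hq
  have h4 := h2 (WithLp.toLp 2 (q.1 - v.fst, q.2 - v.snd))
  change _ ≤ 1 / 2 * qf X (q.1 - v.fst) + c * (q.2 - v.snd) ^ 2 at h4
  change U q.1 q.2 ≤ U v.fst v.snd + (⟪P.fst, q.1 - v.fst⟫ + ⟪P.snd, q.2 - v.snd⟫) + _ at hq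
  have e3 : ⟪P.snd, q.2 - v.snd⟫ = P.snd * (q.2 - v.snd) := by
    simp [mul_comm]
  rw [e3] at hq
  linarith

lemma nfst (z : WithLp 2 (E N × ℝ)) : ‖z.fst‖ ≤ ‖z‖ := by
  have := WithLp.prod_norm_sq_eq_of_L2 z
  apply le_of_sq_le_sq _ (norm_nonneg z); nlinarith [sq_nonneg ‖z.snd‖]

lemma nsnd (z : WithLp 2 (E N × ℝ)) : |z.snd| ≤ ‖z‖ := by
  have := WithLp.prod_norm_sq_eq_of_L2 z
  rw [← Real.norm_eq_abs]
  apply le_of_sq_le_sq _ (norm_nonneg z); nlinarith [sq_nonneg ‖z.fst‖]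

/-- the quadratic form used for doubling -/
lemma doubling_form (b c : ℝ) : ∃ B : WithLp 2 (WithLp 2 (E N × ℝ) × WithLp 2 (E N × ℝ)) →L[ℝ]
      WithLp 2 (WithLp 2 (E N × ℝ) × WithLp 2 (E N × ℝ)), (∀ a b, ⟪B a, b⟫ = ⟪a, B b⟫) ∧
    ∀ z, ⟪B z, z⟫ = b * ‖z.fst.fst - z.snd.fst‖ ^ 2 + 2 * c * (z.fst.snd ^ 2 + z.snd.snd ^ 2) := by
  set f1 := WithLp.fstL 2 ℝ (WithLp 2 (E N × ℝ)) (WithLp 2 (E N × ℝ))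
  set f2 := WithLp.sndL 2 ℝ (WithLp 2 (E N × ℝ)) (WithLp 2 (E N × ℝ))
  set g1 := WithLp.fstL 2 ℝ (E N) ℝ
  set g2 := WithLp.sndL 2 ℝ (E N) ℝ
  set D := g1.comp f1 - g1.comp f2
  set S1 := g2.comp f1
  set S2 := g2.comp f2
  have e1 : ∀ z, D z = z.fst.fst - z.snd.fst := fun z => rfl
  have e2 : ∀ z, S1 z = z.fst.snd := fun z => rfl
  have e3 : ∀ z, S2 z = z.snd.snd := fun z => rfl
  refine ⟨b • (ContinuousLinearMap.adjoint D).comp D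
    + (2 * c) • ((ContinuousLinearMap.adjoint S1).comp S1
      + (ContinuousLinearMap.adjoint S2).comp S2), fun x y => ?_, fun z => ?_⟩
  · simp only [_root_.add_apply, _root_.smul_apply, ContinuousLinearMap.comp_apply,
      inner_add_left, inner_add_right, inner_smul_left, inner_smul_right,
      ContinuousLinearMap.adjoint_inner_left, ContinuousLinearMap.adjoint_inner_right,
      conj_trivial]
  · simp only [_root_.add_apply, _root_.smul_apply, ContinuousLinearMap.comp_apply,
      inner_add_left, inner_smul_left,
      ContinuousLinearMap.adjoint_inner_left, conj_trivial, real_inner_self_eq_norm_sq,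
      e1, e2, e3, Real.norm_eq_abs, sq_abs]

lemma mnorm_close {S T S' T' : Matrix (Fin N) (Fin N) ℝ} {C κ : ℝ} (hC : 0 ≤ C) (hκ : 0 ≤ κ)
    (h1 : ∀ i j, |S i j| ≤ C)
    (h2 : ∀ i j, |T i j| ≤ C) (h3 : ∀ i j, |S' i j| ≤ C) (h4 : ∀ i j, |T' i j| ≤ C)
    (h5 : ∀ i j, |S i j - S' i j| ≤ C * κ) (h6 : ∀ i j, |T i j - T' i j| ≤ C * κ) :
    mnorm (S - T) ^ 2 ≤ mnorm (S' - T') ^ 2 + N ^ 2 * (8 * C ^ 2 * κ) := by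
  rw [mnorm_sq, mnorm_sq, ← sub_le_iff_le_add', ← Finset.sum_sub_distrib]
  simp only [← Finset.sum_sub_distrib]
  refine sum2_le fun i j => ?_
  simp only [Matrix.sub_apply]
  have a1 := abs_le.1 (h1 i j); have a2 := abs_le.1 (h2 i j); have a3 := abs_le.1 (h3 i j)
  have a4 := abs_le.1 (h4 i j); have a5 := abs_le.1 (h5 i j); have a6 := abs_le.1 (h6 i j)
  have e : (S i j - T i j) ^ 2 - (S' i j - T' i j) ^ 2 =
    ((S i j - T i j) - (S' i j - T' i j)) * ((S i j - T i j) + (S' i j - T' i j)) := by ring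
  rw [e]
  refine (le_abs_self _).trans ?_
  rw [abs_mul]
  have b1 : |(S i j - T i j) - (S' i j - T' i j)| ≤ 2 * (C * κ) := abs_le.2 ⟨by linarith, by linarith⟩
  have b2 : |(S i j - T i j) + (S' i j - T' i j)| ≤ 4 * C := abs_le.2 ⟨by linarith, by linarith⟩
  calc _ ≤ 2 * (C * κ) * (4 * C) := by gcongr
    _ = _ := by ring

/-- the two point inequality -/
lemma TP {σ : Θ → E N → Matrix (Fin N) (Fin N) ℝ} {F : Θ → E N → ℝ → E N → ℝ} {C : ℝ} (hC : 0 ≤ C)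
    (hσb : ∀ θ x i j, |σ θ x i j| ≤ C)
    (hσl : ∀ θ x y i j, |σ θ x i j - σ θ y i j| ≤ C * ‖x - y‖)
    (hF : EquiC F) {U₁ U₂ : E N → ℝ → ℝ}
    (hu : UpperSemicontinuous fun q : E N × ℝ => U₁ q.1 q.2)
    (hl : LowerSemicontinuous fun q : E N × ℝ => U₂ q.1 q.2)
    (h1 : SubF σ F U₁) (h2 : SupF σ F U₂) {x₀ y₀ p : E N} {t₀ s₀ a a' b c : ℝ}
    (ht : 0 < t₀) (hs : 0 < s₀) (hb : 0 ≤ b)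
    (hmax : ∀ᶠ q : (E N × ℝ) × (E N × ℝ) in 𝓝 ((x₀, t₀), (y₀, s₀)),
      U₁ q.1.1 q.1.2 - U₂ q.2.1 q.2.2 ≤ U₁ x₀ t₀ - U₂ y₀ s₀
        + ⟪p, (q.1.1 - x₀) - (q.2.1 - y₀)⟫ + b / 2 * ‖(q.1.1 - x₀) - (q.2.1 - y₀)‖ ^ 2
        + a * (q.1.2 - t₀) + a' * (q.2.2 - s₀) + c * ((q.1.2 - t₀) ^ 2 + (q.2.2 - s₀) ^ 2))
    {κ : ℝ} (hκ : 0 < κ) :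
    ∃ θ, a + a' + F θ x₀ (U₁ x₀ t₀) p - F θ y₀ (U₂ y₀ s₀) p
      ≤ b * mnorm (σ θ x₀ - σ θ y₀) ^ 2 + κ := by
  obtain ⟨B, hB1, hB2⟩ := doubling_form (N := N) b c
  obtain ⟨ρ₀, hρ₀, hball⟩ := Metric.eventually_nhds_iff.1 hmax
  set ρ := ρ₀ / 2 with hρdef
  have hρ : 0 < ρ := by positivity
  set X₀ : WithLp 2 (E N × ℝ) := WithLp.toLp 2 (x₀, t₀) with hX₀
  set Y₀ : WithLp 2 (E N × ℝ) := WithLp.toLp 2 (y₀, s₀) with hY₀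
  set P : WithLp 2 (E N × ℝ) := WithLp.toLp 2 (p, a) with hP
  set Q : WithLp 2 (E N × ℝ) := WithLp.toLp 2 (-p, a') with hQ
  obtain ⟨δ₁, hδ₁, hF1⟩ := hF x₀ (U₁ x₀ t₀) p (κ / 8) (by positivity)
  obtain ⟨δ₂, hδ₂, hF2⟩ := hF y₀ (U₂ y₀ s₀) p (κ / 8) (by positivity)
  set M : ℝ := 2 + 4 * (N ^ 2 * C ^ 2) + b * (N ^ 2 * (8 * C ^ 2)) with hM
  have hM0 : 0 < M := by positivity
  set κ' := min (min δ₁ δ₂) (min (min (t₀ / 2) (s₀ / 2)) (κ / (4 * M))) with hκ'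
  have hκ'0 : 0 < κ' := by positivity
  have k1 : κ' ≤ δ₁ := (min_le_left _ _).trans (min_le_left _ _)
  have k2 : κ' ≤ δ₂ := (min_le_left _ _).trans (min_le_right _ _)
  have k3 : κ' ≤ t₀ / 2 := (min_le_right _ _).trans ((min_le_left _ _).trans (min_le_left _ _))
  have k4 : κ' ≤ s₀ / 2 := (min_le_right _ _).trans ((min_le_left _ _).trans (min_le_right _ _))
  have k5 : κ' * M ≤ κ / 4 := by
    have : κ' ≤ κ / (4 * M) := (min_le_right _ _).trans (min_le_right _ _)
    calc κ' * M ≤ κ / (4 * M) * M := by gcongr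
      _ = κ / 4 := by field_simp
  have hu' : UpperSemicontinuous fun v : WithLp 2 (E N × ℝ) => U₁ v.fst v.snd :=
    hu.comp (g := fun v : WithLp 2 (E N × ℝ) => (v.fst, v.snd)) (by fun_prop)
  have hl' : UpperSemicontinuous fun v : WithLp 2 (E N × ℝ) => -U₂ v.fst v.snd := by
    have := hl.comp (g := fun v : WithLp 2 (E N × ℝ) => (v.fst, v.snd)) (by fun_prop)
    intro x y hy
    have h3 := this x (-y) (by change -y < U₂ x.fst x.snd; change -U₂ x.fst x.snd < y at hy; linarith)
    filter_upwards [h3] with z hz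
    change -y < U₂ z.fst z.snd at hz; change -U₂ z.fst z.snd < y; linarith
  obtain ⟨x, y, p', q', X, Y, ⟨hx1, hx2, hx3, hx4⟩, ⟨hy1, hy2, hy3, hy4⟩, hXY⟩ :=
    TS (u := fun v => U₁ v.fst v.snd) (w := fun v => -U₂ v.fst v.snd) (x₀ := X₀) (y₀ := Y₀)
      (p := P) (q := Q) hρ (hu'.upperSemicontinuousOn _)
      (hl'.upperSemicontinuousOn _) B hB1 (by
        intro z hz1 hz2
        have hz3 := (nfst z.fst).trans hz1
        have hz4 := (nsnd z.fst).trans hz1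
        have hz5 := (nfst z.snd).trans hz2
        have hz6 := (nsnd z.snd).trans hz2
        have := @hball ((x₀ + z.fst.fst, t₀ + z.fst.snd), (y₀ + z.snd.fst, s₀ + z.snd.snd)) (by
          rw [Prod.dist_eq, Prod.dist_eq, Prod.dist_eq]
          simp only [dist_self_add_left, Real.norm_eq_abs]
          have : ρ < ρ₀ := by rw [hρdef]; linarith
          refine max_lt (max_lt ?_ ?_) (max_lt ?_ ?_) <;> linarith)
        simp only [add_sub_cancel_left] at this
        rw [hB2, WithLp.prod_inner_apply, WithLp.prod_inner_apply]
        change U₁ (x₀ + z.fst.fst) (t₀ + z.fst.snd) + -U₂ (y₀ + z.snd.fst) (s₀ + z.snd.snd) ≤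
          U₁ x₀ t₀ + -U₂ y₀ s₀ + (⟪p, z.fst.fst⟫ + ⟪a, z.fst.snd⟫)
            + (⟪-p, z.snd.fst⟫ + ⟪a', z.snd.snd⟫) + _
        rw [inner_neg_left]
        rw [inner_sub_right] at this
        simp only [RCLike.inner_apply, conj_trivial]
        linarith) hκ'0
  obtain ⟨X₁, c₁, hX1, hX2, hX3⟩ := UJ_of_quad hx4 hκ'0
  obtain ⟨Y₁, c₂, hY1, hY2, hY3⟩ :=
    UJ_of_quad (U := fun x t => -U₂ x t) hy4 hκ'0
  have g1 : ‖x.fst - x₀‖ ≤ κ' := (nfst (x - X₀)).trans hx1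
  have g2 := abs_le.1 ((nsnd (x - X₀)).trans hx1)
  have g3 : ‖p'.fst - p‖ ≤ κ' := (nfst (p' - P)).trans hx3
  have g4 := abs_le.1 ((nsnd (p' - P)).trans hx3)
  have g5 : ‖y.fst - y₀‖ ≤ κ' := (nfst (y - Y₀)).trans hy1
  have g6 := abs_le.1 ((nsnd (y - Y₀)).trans hy1)
  have g7 : ‖q'.fst - -p‖ ≤ κ' := (nfst (q' - Q)).trans hy3
  have g8 := abs_le.1 ((nsnd (q' - Q)).trans hy3)
  change -κ' ≤ x.snd - t₀ ∧ x.snd - t₀ ≤ κ' at g2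
  change -κ' ≤ y.snd - s₀ ∧ y.snd - s₀ ≤ κ' at g6
  change -κ' ≤ p'.snd - a ∧ p'.snd - a ≤ κ' at g4
  change -κ' ≤ q'.snd - a' ∧ q'.snd - a' ≤ κ' at g8
  change |U₁ x.fst x.snd - U₁ x₀ t₀| ≤ κ' at hx2
  change |-U₂ y.fst y.snd - -U₂ y₀ s₀| ≤ κ' at hy2
  obtain ⟨θ, hθ⟩ := h2 y.fst y.snd (-q'.snd) (-q'.fst) (-Y₁) (-c₂) (by linarith) hY1.neg
    (by simpa using hY2) (κ / 8) (by positivity)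
  refine ⟨θ, ?_⟩
  have m1 := h1 θ x.fst x.snd _ _ _ _ (by linarith) hX1 hX2
  have m2 := abs_le.1 (hF1 θ x.fst (U₁ x.fst x.snd) p'.fst (g1.trans k1) (hx2.trans k1) (g3.trans k1))
  have m3 := abs_le.1 (hF2 θ y.fst (U₂ y.fst y.snd) (-q'.fst) (g5.trans k2)
    (by rw [← abs_neg, show -(U₂ y.fst y.snd - U₂ y₀ s₀) = -U₂ y.fst y.snd - -U₂ y₀ s₀ by ring]; exact hy2.trans k2)
    (by rw [← norm_neg, show -(-q'.fst - p) = q'.fst - -p by abel]; exact g7.trans k2))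
  rw [Matrix.mul_neg, Matrix.trace_neg, trace_qf] at hθ
  rw [trace_qf] at m1
  have key : ∑ k, qf X₁ (colv (σ θ x.fst) k) + ∑ k, qf Y₁ (colv (σ θ y.fst) k)
      ≤ b * mnorm (σ θ x.fst - σ θ y.fst) ^ 2 + κ' * (4 * (N ^ 2 * C ^ 2)) := by
    rw [← Finset.sum_add_distrib, ← col_sq]
    have n1 := col_bd (hσb θ x.fst)
    have n2 := col_bd (hσb θ y.fst)
    calc _ ≤ ∑ k, (b * ‖colv (σ θ x.fst) k - colv (σ θ y.fst) k‖ ^ 2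
          + 2 * κ' * (‖colv (σ θ x.fst) k‖ ^ 2 + ‖colv (σ θ y.fst) k‖ ^ 2)) := by
          refine Finset.sum_le_sum fun k _ => ?_
          set h := colv (σ θ x.fst) k
          set g := colv (σ θ y.fst) k
          have := hXY (WithLp.toLp 2 (WithLp.toLp 2 (h, 0), WithLp.toLp 2 (g, 0)))
          rw [hB2, WithLp.prod_norm_sq_eq_of_L2] at this
          rw [WithLp.prod_norm_sq_eq_of_L2, WithLp.prod_norm_sq_eq_of_L2] at this
          change ⟪X (WithLp.toLp 2 (h, 0)), WithLp.toLp 2 (h, (0:ℝ))⟫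
            + ⟪Y (WithLp.toLp 2 (g, 0)), WithLp.toLp 2 (g, (0:ℝ))⟫ ≤
            b * ‖h - g‖ ^ 2 + 2 * c * ((0:ℝ) ^ 2 + (0:ℝ) ^ 2)
            + κ' * (‖h‖ ^ 2 + ‖(0:ℝ)‖ ^ 2 + (‖g‖ ^ 2 + ‖(0:ℝ)‖ ^ 2)) at this
          rw [norm_zero] at this
          rw [hX3, hY3]
          linarith
      _ = b * ∑ k, ‖colv (σ θ x.fst) k - colv (σ θ y.fst) k‖ ^ 2
          + 2 * κ' * (∑ k, ‖colv (σ θ x.fst) k‖ ^ 2 + ∑ k, ‖colv (σ θ y.fst) k‖ ^ 2) := by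
          rw [Finset.mul_sum, ← Finset.sum_add_distrib, Finset.mul_sum, ← Finset.sum_add_distrib]
      _ ≤ b * ∑ k, ‖colv (σ θ x.fst) k - colv (σ θ y.fst) k‖ ^ 2
          + 2 * κ' * (N ^ 2 * C ^ 2 + N ^ 2 * C ^ 2) := by gcongr
      _ = _ := by ring
  have m4 : mnorm (σ θ x.fst - σ θ y.fst) ^ 2 ≤ mnorm (σ θ x₀ - σ θ y₀) ^ 2
      + N ^ 2 * (8 * C ^ 2 * κ') :=
    mnorm_close hC hκ'0.le (hσb θ _) (hσb θ _) (hσb θ _) (hσb θ _)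
      (fun i j => (hσl θ _ _ i j).trans (by gcongr)) (fun i j => (hσl θ _ _ i j).trans (by gcongr))
  have m5 := mul_le_mul_of_nonneg_left m4 hb
  have m6 : κ' * M = 2 * κ' + κ' * (4 * (N ^ 2 * C ^ 2)) + b * (N ^ 2 * (8 * C ^ 2 * κ')) := by
    rw [hM]; ring
  linarith [m2.1, m2.2, m3.1, m3.2]

/-- integer vectors -/
def iv (k : Fin N → ℤ) : E N := (WithLp.equiv 2 (Fin N → ℝ)).symm fun i => (k i : ℝ)

lemma per_red (x : E N) : ∃ k : Fin N → ℤ, ‖x + iv k‖ ≤ Real.sqrt N := by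
  refine ⟨fun i => -⌊x i⌋, ?_⟩
  rw [EuclideanSpace.norm_eq]
  apply Real.sqrt_le_sqrt
  calc ∑ i, ‖(x + iv fun i => -⌊x i⌋) i‖ ^ 2 ≤ ∑ _i : Fin N, (1:ℝ) := by
        refine Finset.sum_le_sum fun i _ => ?_
        have : (x + iv fun i => -⌊x i⌋) i = x i - ⌊x i⌋ := by
          simp only [iv, PiLp.add_apply, WithLp.equiv_symm_apply]; push_cast; ring
        rw [this, Real.norm_eq_abs, sq_abs]
        have h1 := Int.floor_le (x i)
        have h2 := Int.lt_floor_add_one (x i)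
        nlinarith
    _ = N := by simp

lemma usc_bdd {U : E N → ℝ → ℝ} (hu : UpperSemicontinuous fun q : E N × ℝ => U q.1 q.2)
    (hp : ∀ t : ℝ, ZPeriodic fun x => U x t) (T : ℝ) :
    ∃ M, ∀ x t, 0 ≤ t → t ≤ T → U x t ≤ M := by
  have hc : IsCompact (Metric.closedBall (0 : E N) (Real.sqrt N) ×ˢ Set.Icc (0:ℝ) T) :=
    (isCompact_closedBall _ _).prod isCompact_Icc
  obtain ⟨M, hM⟩ := (hu.upperSemicontinuousOn _).bddAbove_of_isCompact hc
  refine ⟨M, fun x t h0 h1 => ?_⟩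
  obtain ⟨k, hk⟩ := per_red x
  have : U (x + iv k) t = U x t := hp t x k
  rw [← this]
  exact hM ⟨(x + iv k, t), ⟨by simpa using hk, h0, h1⟩, rfl⟩

/-- the doubled function -/
def Psi (U₁ U₂ : E N → ℝ → ℝ) (β : E N → ℝ) (g : ℝ) (χ : ℝ → ℝ) (x y : E N) (t s : ℝ) : ℝ :=
  U₁ x t - U₂ y s - β (x - y) - g / 2 * (t - s) ^ 2 - χ t

lemma usc_neg {α : Type*} [TopologicalSpace α] {f : α → ℝ} (h : LowerSemicontinuous f) :
    UpperSemicontinuous fun x => -f x := by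
  intro x y hy
  have h3 := h x (-y) (by change -f x < y at hy; linarith)
  filter_upwards [h3] with z hz
  change -y < f z at hz; change -f z < y; linarith

lemma lsc_neg {α : Type*} [TopologicalSpace α] {f : α → ℝ} (h : UpperSemicontinuous f) :
    LowerSemicontinuous fun x => -f x := by
  intro x y hy
  have h3 := h x (-y) (by change y < -f x at hy; linarith)
  filter_upwards [h3] with z hz
  change f z < -y at hz; change y < -f z; linarith

lemma Psi_max {U₁ U₂ : E N → ℝ → ℝ} (hu : UpperSemicontinuous fun q : E N × ℝ => U₁ q.1 q.2)
    (hl : LowerSemicontinuous fun q : E N × ℝ => U₂ q.1 q.2)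
    (hp₁ : ∀ t : ℝ, ZPeriodic fun x => U₁ x t) (hp₂ : ∀ t : ℝ, ZPeriodic fun x => U₂ x t)
    {χ : ℝ → ℝ} {T η : ℝ} (hη : 0 < η) (hχ : ContinuousOn χ (Set.Iio T))
    (hχ' : ∀ t, 0 ≤ t → t < T → η / (T - t) ≤ χ t) :
    ∃ (D T' : ℝ), T' < T ∧ 0 ≤ D ∧ ∀ (β : E N → ℝ) (g : ℝ), Continuous β →
      (∀ z, ‖z‖ ≤ β z + 1) → (∀ z, 0 ≤ β z) → 0 ≤ g →
      ∀ (a b : E N) (r : ℝ), 0 ≤ r → r < T → 0 < U₁ a r - U₂ b r - β (a - b) - χ r →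
    ∃ x y t s, ‖x‖ ≤ Real.sqrt N ∧ ‖x - y‖ ≤ D ∧ 0 ≤ t ∧ t ≤ T' ∧ 0 ≤ s ∧ s ≤ T + 1 ∧
      0 < Psi U₁ U₂ β g χ x y t s ∧ g / 2 * (t - s) ^ 2 ≤ D ∧
      ∀ x' y' t' s', 0 ≤ t' → t' < T → 0 ≤ s' → s' ≤ T + 1 →
        Psi U₁ U₂ β g χ x' y' t' s' ≤ Psi U₁ U₂ β g χ x y t s := by
  obtain ⟨M₁, hM₁⟩ := usc_bdd hu hp₁ T
  obtain ⟨M₂, hM₂⟩ := usc_bdd (U := fun x t => -U₂ x t) (usc_neg hl)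
    (fun t x k => by simpa using hp₂ t x k) (T + 1)
  set D := |M₁| + |M₂| + 1 with hD
  have hD0 : 0 < D := by positivity
  have hDM : M₁ + M₂ + 1 ≤ D := by
    have := le_abs_self M₁; have := le_abs_self M₂; linarith
  set T' := T - η / D with hT'
  have hη' : 0 < η / D := by positivity
  refine ⟨D, T', by linarith, hD0.le, ?_⟩
  intro β g hβ hβ1 hβ0 hg a b r hr0 hrT hpos
  -- consequences of positivity
  have cons : ∀ x y t s, 0 ≤ t → t < T → 0 ≤ s → s ≤ T + 1 → 0 < Psi U₁ U₂ β g χ x y t s →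
      ‖x - y‖ ≤ D ∧ t ≤ T' ∧ g / 2 * (t - s) ^ 2 ≤ D := by
    intro x y t s h0 h1 h2 h3 h4
    have a1 := hM₁ x t h0 h1.le
    have a2 := hM₂ y s h2 h3
    have a3 := hβ1 (x - y)
    have a4 := hχ' t h0 h1
    have a5 : 0 < η / (T - t) := div_pos hη (by linarith)
    have a6 : 0 ≤ g / 2 * (t - s) ^ 2 := by positivity
    have a7 := hβ0 (x - y)
    simp only [Psi] at h4
    refine ⟨by linarith, ?_, by linarith⟩
    have a8 : η / (T - t) ≤ D := by linarith
    rw [div_le_iff₀ (by linarith)] at a8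
    have : η / D ≤ T - t := by rw [div_le_iff₀ hD0]; linarith
    linarith
  have shift : ∀ k x y t s, Psi U₁ U₂ β g χ (x + iv k) (y + iv k) t s
      = Psi U₁ U₂ β g χ x y t s := by
    intro k x y t s
    simp only [Psi]
    have e1 : U₁ (x + iv k) t = U₁ x t := hp₁ t x k
    have e2 : U₂ (y + iv k) s = U₂ y s := hp₂ s y k
    rw [e1, e2, add_sub_add_right_eq_sub]
  set R := Real.sqrt N + D
  set K : Set ((E N × E N) × (ℝ × ℝ)) :=
    (Metric.closedBall 0 (Real.sqrt N) ×ˢ Metric.closedBall 0 R) ×ˢ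
      (Set.Icc 0 T' ×ˢ Set.Icc 0 (T + 1)) with hK
  have hKc : IsCompact K := ((isCompact_closedBall _ _).prod (isCompact_closedBall _ _)).prod
    (isCompact_Icc.prod isCompact_Icc)
  have toK : ∀ x y t s, 0 ≤ t → t < T → 0 ≤ s → s ≤ T + 1 → 0 < Psi U₁ U₂ β g χ x y t s →
      ∃ k, ((x + iv k, y + iv k), (t, s)) ∈ K := by
    intro x y t s h0 h1 h2 h3 h4
    obtain ⟨b1, b2, -⟩ := cons x y t s h0 h1 h2 h3 h4
    obtain ⟨k, hk⟩ := per_red x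
    refine ⟨k, ⟨⟨by simpa using hk, ?_⟩, ⟨h0, b2⟩, h2, h3⟩⟩
    have : y + iv k = (x + iv k) - (x - y) := by abel
    simp only [Metric.mem_closedBall, dist_zero_right]
    rw [this]
    exact (norm_sub_le _ _).trans (add_le_add hk b1)
  have husc : UpperSemicontinuousOn (fun q : (E N × E N) × (ℝ × ℝ) =>
      Psi U₁ U₂ β g χ q.1.1 q.1.2 q.2.1 q.2.2) K := by
    have c1 : UpperSemicontinuous (fun q : (E N × E N) × (ℝ × ℝ) => U₁ q.1.1 q.2.1) :=
      hu.comp (g := fun q : (E N × E N) × (ℝ × ℝ) => (q.1.1, q.2.1)) (by fun_prop)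
    have c2 : UpperSemicontinuous (fun q : (E N × E N) × (ℝ × ℝ) => -U₂ q.1.2 q.2.2) :=
      (usc_neg hl).comp (g := fun q : (E N × E N) × (ℝ × ℝ) => (q.1.2, q.2.2)) (by fun_prop)
    have c3 : ContinuousOn (fun q : (E N × E N) × (ℝ × ℝ) =>
        - β (q.1.1 - q.1.2) - g / 2 * (q.2.1 - q.2.2) ^ 2 - χ q.2.1) K := by
      refine ContinuousOn.sub (Continuous.continuousOn (by fun_prop)) ?_
      refine hχ.comp (by fun_prop) ?_
      intro q hq
      exact lt_of_le_of_lt hq.2.1.2 (by rw [hT']; linarith)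
    have := ((c1.add c2).upperSemicontinuousOn K).add c3.upperSemicontinuousOn
    have e : (fun q : (E N × E N) × (ℝ × ℝ) => Psi U₁ U₂ β g χ q.1.1 q.1.2 q.2.1 q.2.2) =
        fun z => U₁ z.1.1 z.2.1 + -U₂ z.1.2 z.2.2 +
          (-β (z.1.1 - z.1.2) - g / 2 * (z.2.1 - z.2.2) ^ 2 - χ z.2.1) := by
      funext q; simp only [Psi]; ring
    rw [e]; exact this
  have hPr : 0 < Psi U₁ U₂ β g χ a b r r := by
    simp only [Psi]; simpa using hpos
  obtain ⟨k₀, hk₀⟩ := toK a b r r hr0 hrT hr0 (by linarith) hPr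
  obtain ⟨⟨⟨x, y⟩, ⟨t, s⟩⟩, hq, hmax⟩ := husc.exists_isMaxOn ⟨_, hk₀⟩ hKc
  obtain ⟨⟨hq1, hq2⟩, ⟨hq3, hq4⟩, hq5, hq6⟩ := hq
  simp only at hq1 hq2 hq3 hq4 hq5 hq6
  have hpos' : 0 < Psi U₁ U₂ β g χ x y t s := by
    refine lt_of_lt_of_le ?_ (hmax hk₀)
    simp only [shift]; exact hPr
  obtain ⟨b1, b2, b3⟩ := cons x y t s hq3 (by linarith) hq5 hq6 hpos'
  refine ⟨x, y, t, s, by simpa using hq1, b1, hq3, hq4, hq5, hq6, hpos', b3, ?_⟩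
  intro x' y' t' s' h0 h1 h2 h3
  by_cases hc : 0 < Psi U₁ U₂ β g χ x' y' t' s'
  · obtain ⟨k, hk⟩ := toK x' y' t' s' h0 h1 h2 h3 hc
    have := hmax hk
    simp only [Set.mem_ofPred_eq, shift] at this
    exact this
  · linarith

/-- doubling of variables: convergent sequence of maximum points -/
lemma DBL {U₁ U₂ : E N → ℝ → ℝ} (hu : UpperSemicontinuous fun q : E N × ℝ => U₁ q.1 q.2)
    (hl : LowerSemicontinuous fun q : E N × ℝ => U₂ q.1 q.2)
    (hp₁ : ∀ t : ℝ, ZPeriodic fun x => U₁ x t) (hp₂ : ∀ t : ℝ, ZPeriodic fun x => U₂ x t)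
    {χ : ℝ → ℝ} {T η : ℝ} (hη : 0 < η) (hχ : ContinuousOn χ (Set.Iio T))
    (hχ' : ∀ t, 0 ≤ t → t < T → η / (T - t) ≤ χ t)
    {β : ℕ → E N → ℝ} (hβ : ∀ n, Continuous (β n)) (hβ1 : ∀ n z, ‖z‖ ≤ β n z + 1)
    (hβ0 : ∀ n z, 0 ≤ β n z) {a b : E N} {r : ℝ} (hr0 : 0 ≤ r) (hrT : r < T)
    (hpos : ∀ n, 0 < U₁ a r - U₂ b r - β n (a - b) - χ r) :
    ∃ (X Y : ℕ → E N) (t s : ℕ → ℝ) (φ : ℕ → ℕ) (x y : E N) (τ : ℝ), StrictMono φ ∧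
      Tendsto (X ∘ φ) atTop (𝓝 x) ∧ Tendsto (Y ∘ φ) atTop (𝓝 y) ∧ Tendsto (t ∘ φ) atTop (𝓝 τ) ∧
      Tendsto (s ∘ φ) atTop (𝓝 τ) ∧ 0 ≤ τ ∧ τ < T ∧
      ∀ n, 0 ≤ t n ∧ t n < T ∧ 0 ≤ s n ∧ 0 < Psi U₁ U₂ (β n) n χ (X n) (Y n) (t n) (s n) ∧
      ∀ x' y' t' s', 0 ≤ t' → t' < T → 0 ≤ s' → s' ≤ T + 1 →
        Psi U₁ U₂ (β n) n χ x' y' t' s' ≤ Psi U₁ U₂ (β n) n χ (X n) (Y n) (t n) (s n) := by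
  obtain ⟨D, T', hT', hD, hmax⟩ := Psi_max hu hl hp₁ hp₂ hη hχ hχ'
  have := fun n : ℕ => hmax (β n) n (hβ n) (hβ1 n) (hβ0 n) (Nat.cast_nonneg n) a b r hr0 hrT (hpos n)
  choose X Y t s h1 h2 h3 h4 h5 h6 h7 h8 h9 using this
  set R := Real.sqrt N + D
  set K : Set ((E N × E N) × (ℝ × ℝ)) :=
    (Metric.closedBall 0 (Real.sqrt N) ×ˢ Metric.closedBall 0 R) ×ˢ
      (Set.Icc 0 T' ×ˢ Set.Icc 0 (T + 1)) with hK
  have hKc : IsCompact K := ((isCompact_closedBall _ _).prod (isCompact_closedBall _ _)).prod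
    (isCompact_Icc.prod isCompact_Icc)
  have hin : ∀ n, ((X n, Y n), (t n, s n)) ∈ K := by
    intro n
    refine ⟨⟨by simpa using h1 n, ?_⟩, ⟨h3 n, h4 n⟩, h5 n, h6 n⟩
    have : Y n = X n - (X n - Y n) := by abel
    simp only [Metric.mem_closedBall, dist_zero_right]
    rw [this]
    exact (norm_sub_le _ _).trans (add_le_add (h1 n) (h2 n))
  obtain ⟨⟨⟨x, y⟩, ⟨τ, τ'⟩⟩, hq, φ, hφ, hlim⟩ := hKc.tendsto_subseq hin
  rw [Prod.tendsto_iff] at hlim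
  obtain ⟨l1, l2⟩ := hlim
  rw [Prod.tendsto_iff] at l1 l2
  have heq : τ = τ' := by
    have e1 : Tendsto (fun n => ((t ∘ φ) n - (s ∘ φ) n) ^ 2) atTop (𝓝 ((τ - τ') ^ 2)) :=
      (l2.1.sub l2.2).pow 2
    have e2 : Tendsto (fun n : ℕ => (2 * D) / (φ n : ℝ)) atTop (𝓝 0) :=
      tendsto_const_nhds.div_atTop (tendsto_natCast_atTop_atTop.comp hφ.tendsto_atTop)
    have e3 : (τ - τ') ^ 2 ≤ 0 := by
      refine le_of_tendsto_of_tendsto e1 e2 ?_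
      filter_upwards [hφ.tendsto_atTop.eventually_gt_atTop 0] with n hn
      have : (0:ℝ) < φ n := by exact_mod_cast hn
      rw [le_div_iff₀ this]
      have := h8 (φ n)
      simp only [Function.comp]; linarith
    have e4 : (τ - τ') ^ 2 = 0 := le_antisymm e3 (sq_nonneg _)
    have := pow_eq_zero_iff (two_ne_zero) |>.1 e4
    linarith
  subst heq
  refine ⟨X, Y, t, s, φ, x, y, τ, hφ, l1.1, l1.2, l2.1, l2.2, hq.2.1.1,
    lt_of_le_of_lt hq.2.1.2 hT', fun n => ⟨h3 n, (h4 n).trans_lt hT', h5 n, h7 n, h9 n⟩⟩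

/-- two point inequality at a maximum of the doubled function -/
lemma TPM {σ : Θ → E N → Matrix (Fin N) (Fin N) ℝ} {F : Θ → E N → ℝ → E N → ℝ} {C : ℝ} (hC : 0 ≤ C)
    (hσb : ∀ θ x i j, |σ θ x i j| ≤ C)
    (hσl : ∀ θ x y i j, |σ θ x i j - σ θ y i j| ≤ C * ‖x - y‖)
    (hF : EquiC F) {U₁ U₂ : E N → ℝ → ℝ}
    (hu : UpperSemicontinuous fun q : E N × ℝ => U₁ q.1 q.2)
    (hl : LowerSemicontinuous fun q : E N × ℝ => U₂ q.1 q.2)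
    (h1 : SubF σ F U₁) (h2 : SupF σ F U₂) {β : E N → ℝ} {χ : ℝ → ℝ} {g T : ℝ} (hg : 0 ≤ g)
    {x y p : E N} {t s a b c : ℝ} (ht : 0 < t) (htT : t < T) (hs : 0 < s) (hsT : s < T + 1)
    (hb : 0 ≤ b) (hc : 0 ≤ c)
    (hmax : ∀ x' y' t' s', 0 ≤ t' → t' < T → 0 ≤ s' → s' ≤ T + 1 →
        Psi U₁ U₂ β g χ x' y' t' s' ≤ Psi U₁ U₂ β g χ x y t s)
    (hβ : ∀ h, β (x - y + h) ≤ β (x - y) + ⟪p, h⟫ + b / 2 * ‖h‖ ^ 2)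
    (hχ : ∀ᶠ t' in 𝓝 t, χ t' ≤ χ t + a * (t' - t) + c * (t' - t) ^ 2) {κ : ℝ} (hκ : 0 < κ) :
    ∃ θ, a + F θ x (U₁ x t) p - F θ y (U₂ y s) p ≤ b * mnorm (σ θ x - σ θ y) ^ 2 + κ := by
  have := TP hC hσb hσl hF hu hl h1 h2 (x₀ := x) (y₀ := y) (p := p) (t₀ := t) (s₀ := s)
    (a := g * (t - s) + a) (a' := - (g * (t - s))) (b := b) (c := g + c) ht hs hb ?_ hκ
  · obtain ⟨θ, hθ⟩ := this
    exact ⟨θ, by linarith⟩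
  · have n1 : ∀ᶠ q : (E N × ℝ) × (E N × ℝ) in 𝓝 ((x, t), (y, s)),
        χ q.1.2 ≤ χ t + a * (q.1.2 - t) + c * (q.1.2 - t) ^ 2 := by
      have : Tendsto (fun q : (E N × ℝ) × (E N × ℝ) => q.1.2) (𝓝 ((x, t), (y, s))) (𝓝 t) :=
        Continuous.tendsto' (by fun_prop) _ _ rfl
      exact this.eventually hχ
    have n2 : ∀ᶠ q : (E N × ℝ) × (E N × ℝ) in 𝓝 ((x, t), (y, s)),
        0 < q.1.2 ∧ q.1.2 < T ∧ 0 < q.2.2 ∧ q.2.2 < T + 1 := by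
      have k1 : Tendsto (fun q : (E N × ℝ) × (E N × ℝ) => q.1.2) (𝓝 ((x, t), (y, s))) (𝓝 t) :=
        Continuous.tendsto' (by fun_prop) _ _ rfl
      have k2 : Tendsto (fun q : (E N × ℝ) × (E N × ℝ) => q.2.2) (𝓝 ((x, t), (y, s))) (𝓝 s) :=
        Continuous.tendsto' (by fun_prop) _ _ rfl
      filter_upwards [k1.eventually (lt_mem_nhds ht), k1.eventually (gt_mem_nhds htT),
        k2.eventually (lt_mem_nhds hs), k2.eventually (gt_mem_nhds hsT)] with q a b c d
      exact ⟨a, b, c, d⟩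
    filter_upwards [n1, n2] with q q1 ⟨q2, q3, q4, q5⟩
    have m := hmax q.1.1 q.2.1 q.1.2 q.2.2 q2.le q3 q4.le q5.le
    have m2 := hβ ((q.1.1 - x) - (q.2.1 - y))
    rw [show x - y + ((q.1.1 - x) - (q.2.1 - y)) = q.1.1 - q.2.1 by abel] at m2
    simp only [Psi] at m
    have m3 : g / 2 * (q.1.2 - q.2.2) ^ 2 ≤ g / 2 * (t - s) ^ 2 + g * (t - s) * (q.1.2 - t)
        - g * (t - s) * (q.2.2 - s) + g * ((q.1.2 - t) ^ 2 + (q.2.2 - s) ^ 2) := by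
      have : g / 2 * (t - s) ^ 2 + g * (t - s) * (q.1.2 - t)
        - g * (t - s) * (q.2.2 - s) + g * ((q.1.2 - t) ^ 2 + (q.2.2 - s) ^ 2)
        - g / 2 * (q.1.2 - q.2.2) ^ 2 = g / 2 * ((q.1.2 - t) + (q.2.2 - s)) ^ 2 := by ring
      have : 0 ≤ g / 2 * ((q.1.2 - t) + (q.2.2 - s)) ^ 2 := by positivity
      linarith
    have m4 : 0 ≤ c * (q.2.2 - s) ^ 2 := by positivity
    linarith

/-- time penalisation -/
def chi (ν M η T t : ℝ) : ℝ := Real.exp (-ν * t) * M + η / (T - t)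

lemma chi_cont (ν M η T : ℝ) : ContinuousOn (chi ν M η T) (Set.Iio T) := by
  unfold chi
  refine ContinuousOn.add (Continuous.continuousOn (by fun_prop)) ?_
  refine ContinuousOn.div continuousOn_const (by fun_prop) fun t ht => ?_
  have : t < T := ht
  linarith

lemma chi_taylor {ν M η T t : ℝ} (hM : 0 ≤ M) (hη : 0 ≤ η) (ht : t < T) :
    ∃ c, 0 ≤ c ∧ ∀ᶠ t' in 𝓝 t, chi ν M η T t' ≤ chi ν M η T t
      + (- ν * (Real.exp (-ν * t) * M) + η / (T - t) ^ 2) * (t' - t) + c * (t' - t) ^ 2 := by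
  set d := T - t with hd
  have hd0 : 0 < d := by linarith
  refine ⟨Real.exp (-ν * t) * M * ν ^ 2 + η * (2 / d ^ 3), by positivity, ?_⟩
  have e1 : ∀ᶠ t' in 𝓝 t, |(-ν) * (t' - t)| ≤ 1 := by
    have : Tendsto (fun t' => |(-ν) * (t' - t)|) (𝓝 t) (𝓝 0) :=
      Continuous.tendsto' (by fun_prop) _ _ (by simp)
    exact this.eventually (eventually_le_nhds one_pos)
  have e2 : ∀ᶠ t' in 𝓝 t, t' - t ≤ d / 2 := by
    have : Tendsto (fun t' => t' - t) (𝓝 t) (𝓝 0) :=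
      Continuous.tendsto' (by fun_prop) _ _ (by simp)
    exact this.eventually (eventually_le_nhds (by positivity))
  filter_upwards [e1, e2] with t' h1 h2
  have a1 := (abs_le.1 (Real.abs_exp_sub_one_sub_id_le h1)).2
  have a2 : Real.exp (-ν * t') = Real.exp (-ν * t) * Real.exp (-ν * (t' - t)) := by
    rw [← Real.exp_add]; ring_nf
  set h := t' - t with hh
  have a3 : 1 / (T - t') ≤ 1 / d + h / d ^ 2 + 2 / d ^ 3 * h ^ 2 := by
    have hT' : T - t' = d - h := by rw [hd, hh]; ring
    have hp : 0 < d - h := by linarith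
    rw [hT']
    have : 1 / d + h / d ^ 2 + 2 / d ^ 3 * h ^ 2 - 1 / (d - h)
      = h ^ 2 * (d - 2 * h) / (d ^ 3 * (d - h)) := by
      field_simp; ring
    have : 0 ≤ h ^ 2 * (d - 2 * h) / (d ^ 3 * (d - h)) := by
      apply div_nonneg (mul_nonneg (sq_nonneg _) (by linarith)) (by positivity)
    linarith
  have a4 := mul_le_mul_of_nonneg_left a3 hη
  have a5 : 0 ≤ Real.exp (-ν * t) * M := by positivity
  have a6 : Real.exp (-ν * h) ≤ 1 + -ν * h + (-ν * h) ^ 2 := by linarith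
  have a7 := mul_le_mul_of_nonneg_left a6 a5
  unfold chi
  rw [a2]
  have e3 : η / (T - t') = η * (1 / (T - t')) := by ring
  have e4 : η / d = η * (1 / d) := by ring
  have e5 : η / d ^ 2 * h = η * (h / d ^ 2) := by ring
  rw [e3, e4, add_mul, e5]
  linarith

/-- linear zeroth order term -/
def Fl (lam : ℝ) (G : Θ → E N → E N → ℝ) : Θ → E N → ℝ → E N → ℝ := fun θ x r p => lam * r + G θ x p

lemma mnorm_lip {S T : Matrix (Fin N) (Fin N) ℝ} {c : ℝ} (h : ∀ i j, |S i j - T i j| ≤ c) :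
    mnorm (S - T) ^ 2 ≤ N ^ 2 * c ^ 2 := by
  rw [mnorm_sq]
  refine sum2_le fun i j => ?_
  rw [← sq_abs]
  gcongr
  exact h i j

lemma CMP {σ : Θ → E N → Matrix (Fin N) (Fin N) ℝ} {G : Θ → E N → E N → ℝ} {C lam : ℝ}
    (hC : 0 ≤ C) (hlam : 0 ≤ lam)
    (hσb : ∀ θ x i j, |σ θ x i j| ≤ C)
    (hσl : ∀ θ x y i j, |σ θ x i j - σ θ y i j| ≤ C * ‖x - y‖)
    (hF : EquiC (Fl lam G)) {U₁ U₂ : E N → ℝ → ℝ}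
    (hu : UpperSemicontinuous fun q : E N × ℝ => U₁ q.1 q.2)
    (hl : LowerSemicontinuous fun q : E N × ℝ => U₂ q.1 q.2)
    (hp₁ : ∀ t : ℝ, ZPeriodic fun x => U₁ x t) (hp₂ : ∀ t : ℝ, ZPeriodic fun x => U₂ x t)
    (h1 : SubF σ (Fl lam G) U₁) (h2 : SupF σ (Fl lam G) U₂) {K : ℝ} (hK : 0 ≤ K)
    (hreg : (∀ θ x y p, |G θ x p - G θ y p| ≤ K * ‖x - y‖) ∨ ∃ L : ℝ, 0 ≤ L ∧
      (∀ θ x y p, ‖p‖ ≤ 2 * L → |G θ x p - G θ y p| ≤ K * ‖x - y‖) ∧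
      ((∀ x y t, 0 ≤ t → U₁ x t - U₁ y t ≤ L * ‖x - y‖) ∨
        (∀ x y t, 0 ≤ t → U₂ x t - U₂ y t ≤ L * ‖x - y‖)))
    {M : ℝ} (hM : 0 ≤ M) (h0 : ∀ x, U₁ x 0 - U₂ x 0 ≤ M) (x₁ : E N) (t₁ : ℝ) (ht₁ : 0 ≤ t₁) :
    U₁ x₁ t₁ - U₂ x₁ t₁ ≤ Real.exp (-lam * t₁) * M := by
  by_contra! hcon
  set d := U₁ x₁ t₁ - U₂ x₁ t₁ - Real.exp (-lam * t₁) * M with hd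
  have hd0 : 0 < d := by linarith
  set η := d / 3 with hη
  have hη0 : 0 < η := by positivity
  set T := t₁ + 1 with hT
  have hT0 : 0 < T := by linarith
  set χ := chi lam (M + η) η T with hχ
  have hexp : ∀ t, 0 ≤ t → Real.exp (-lam * t) ≤ 1 := fun t ht =>
    Real.exp_le_one_iff.2 (by nlinarith)
  have hχ' : ∀ t, 0 ≤ t → t < T → η / (T - t) ≤ χ t := by
    intro t _ _
    have : 0 ≤ Real.exp (-lam * t) * (M + η) := by positivity
    simp only [hχ, chi]; linarith
  set β : ℕ → E N → ℝ := fun n z => ((n : ℝ) + 1) / 2 * ‖z‖ ^ 2 with hβ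
  obtain ⟨X, Y, t, s, φ, x, y, τ, hφ, lX, lY, lt, ls, hτ0, hτT, hmax⟩ :=
    DBL hu hl hp₁ hp₂ hη0 (chi_cont lam (M + η) η T) hχ' (β := β)
      (fun n => by simp only [hβ]; fun_prop)
      (fun n z => by
        have hn : (0:ℝ) ≤ n := Nat.cast_nonneg n
        have := sq_nonneg (‖z‖ - 1)
        have := mul_nonneg hn (sq_nonneg ‖z‖)
        simp only [hβ]; nlinarith)
      (fun n z => by simp only [hβ]; positivity) (a := x₁) (b := x₁) ht₁ (by linarith) (by
        intro n
        have a1 := hexp t₁ ht₁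
        have a2 := mul_le_mul_of_nonneg_right a1 hη0.le
        have a3 : T - t₁ = 1 := by rw [hT]; ring
        simp only [hβ, hχ, chi, sub_self, norm_zero, a3, div_one]
        have : d = 3 * η := by rw [hη]; ring
        rw [mul_add]
        have z0 : ((n : ℝ) + 1) / 2 * 0 ^ 2 = 0 := by ring
        linarith)
  have hpX : Tendsto (fun n => ((X ∘ φ) n, (t ∘ φ) n)) atTop (𝓝 (x, τ)) := lX.prodMk_nhds lt
  have hpY : Tendsto (fun n => ((Y ∘ φ) n, (s ∘ φ) n)) atTop (𝓝 (y, τ)) := lY.prodMk_nhds ls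
  have hχc : Tendsto (fun n => χ ((t ∘ φ) n)) atTop (𝓝 (χ τ)) :=
    ((chi_cont lam (M + η) η T).continuousAt (Iio_mem_nhds hτT)).tendsto.comp lt
  have ev : ∀ ε > 0, ∀ᶠ n in atTop, U₁ (X (φ n)) (t (φ n)) < U₁ x τ + ε ∧
      U₂ y τ - ε < U₂ (Y (φ n)) (s (φ n)) ∧ χ τ - ε < χ (t (φ n)) := by
    intro ε hε
    filter_upwards [hpX.eventually (hu (x, τ) (U₁ x τ + ε) (by change U₁ x τ < _; linarith)),
      hpY.eventually (hl (y, τ) (U₂ y τ - ε) (by change _ < U₂ y τ; linarith)),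
      hχc.eventually (lt_mem_nhds (show χ τ - ε < χ τ by linarith))] with n n1 n2 n3
    exact ⟨n1, n2, n3⟩
  have hφ1 : Tendsto (fun n => (φ n : ℝ) + 1) atTop atTop :=
    tendsto_atTop_add_const_right _ _ (tendsto_natCast_atTop_atTop.comp hφ.tendsto_atTop)
  have hdist : Tendsto (fun n => ‖X (φ n) - Y (φ n)‖) atTop (𝓝 ‖x - y‖) := (lX.sub lY).norm
  have hχpos : ∀ t', 0 ≤ t' → t' < T → 0 ≤ χ t' := fun t' a b =>
    (div_nonneg hη0.le (by linarith)).trans (hχ' t' a b)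
  have hxy : x = y := by
    have e2 : Tendsto (fun n => 2 * (U₁ x τ - U₂ y τ + 2) / ((φ n : ℝ) + 1)) atTop (𝓝 0) :=
      tendsto_const_nhds.div_atTop hφ1
    have e3 : ‖x - y‖ ^ 2 ≤ 0 := by
      refine le_of_tendsto_of_tendsto (hdist.pow 2) e2 ?_
      filter_upwards [ev 1 one_pos] with n hn
      obtain ⟨m1, m2, m3, m4, -⟩ := hmax (φ n)
      have m5 := hχpos _ m1 m2
      have m6 : 0 ≤ (φ n : ℝ) / 2 * (t (φ n) - s (φ n)) ^ 2 := by positivity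
      rw [le_div_iff₀ (by positivity)]
      simp only [Psi, hβ] at m4
      linarith [hn.1, hn.2.1]
    have e4 : ‖x - y‖ = 0 := by
      have := pow_eq_zero_iff (two_ne_zero) |>.1 (le_antisymm e3 (sq_nonneg _))
      exact this
    exact sub_eq_zero.1 (norm_eq_zero.1 e4)
  subst hxy
  have hβs : ∀ ε > 0, ∀ᶠ n in atTop, ((φ n : ℝ) + 1) * ‖X (φ n) - Y (φ n)‖ ^ 2 ≤ 6 * ε := by
    intro ε hε
    filter_upwards [ev ε hε] with n hn
    obtain ⟨m1, m2, m3, m4, m5⟩ := hmax (φ n)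
    have m6 := m5 x x τ τ hτ0 hτT hτ0 (by linarith)
    have m7 : 0 ≤ (φ n : ℝ) / 2 * (t (φ n) - s (φ n)) ^ 2 := by positivity
    simp only [Psi, hβ, sub_self, norm_zero] at m6
    norm_num at m6
    linarith [hn.1, hn.2.1, hn.2.2]
  have hτp : 0 < τ := by
    rcases hτ0.lt_or_eq with h | h
    · exact h
    exfalso
    subst h
    obtain ⟨n, hn⟩ := (ev (η / 3) (by positivity)).exists
    obtain ⟨m1, m2, m3, m4, m5⟩ := hmax (φ n)
    have m6 : 0 ≤ β (φ n) (X (φ n) - Y (φ n)) := by simp only [hβ]; positivity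
    have m7 : 0 ≤ (φ n : ℝ) / 2 * (t (φ n) - s (φ n)) ^ 2 := by positivity
    have m8 : M + η ≤ χ 0 := by
      have : 0 < η / T := by positivity
      simp only [hχ, chi]; simp; linarith
    simp only [Psi] at m4
    linarith [hn.1, hn.2.1, hn.2.2, h0 x]
  -- final contradiction
  set e₀ := η / T ^ 2 with he₀
  have he0 : 0 < e₀ := by positivity
  have ev2 : ∀ᶠ n in atTop, K * ‖X (φ n) - Y (φ n)‖ < e₀ / 4 := by
    have : Tendsto (fun n => K * ‖X (φ n) - Y (φ n)‖) atTop (𝓝 (K * ‖x - x‖)) :=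
      hdist.const_mul K
    rw [sub_self, norm_zero, mul_zero] at this
    exact this.eventually (gt_mem_nhds (by positivity))
  set Q := (N : ℝ) ^ 2 * C ^ 2 with hQ
  have hQ0 : 0 ≤ Q := by positivity
  obtain ⟨n, n1, n2, n3, n4, n5⟩ := (ev2.and ((hβs (e₀ / (24 * (Q + 1))) (by positivity)).and
    ((lt.eventually (lt_mem_nhds hτp)).and ((ls.eventually (lt_mem_nhds hτp)).and
      (ls.eventually (gt_mem_nhds (show τ < T + 1 by linarith))))))).exists
  obtain ⟨m1, m2, m3, m4, m5⟩ := hmax (φ n)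
  simp only [Function.comp] at n3 n4 n5
  set g : ℝ := (φ n : ℝ) + 1 with hg
  have hg0 : 0 < g := by positivity
  set Xn := X (φ n)
  set Yn := Y (φ n)
  set tn := t (φ n)
  set sn := s (φ n)
  obtain ⟨c, hc, htay⟩ := chi_taylor (ν := lam) (M := M + η) (η := η) (T := T) (t := tn)
    (by positivity) hη0.le m2
  obtain ⟨θ, hθ⟩ := TPM hC hσb hσl hF hu hl h1 h2 (β := β (φ n)) (χ := χ) (g := (φ n : ℝ)) (T := T)
    (Nat.cast_nonneg _) (x := Xn) (y := Yn) (p := g • (Xn - Yn)) (t := tn) (s := sn)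
    (b := g) n3 m2 n4 n5 hg0.le hc m5 (by
      intro h
      simp only [hβ]
      rw [norm_add_sq_real, inner_smul_left, conj_trivial]
      refine le_of_eq ?_
      ring) htay (κ := e₀ / 4) (by positivity)
  have hr : χ tn ≤ U₁ Xn tn - U₂ Yn sn := by
    have m6 : 0 ≤ β (φ n) (Xn - Yn) := by simp only [hβ]; positivity
    have m7 : 0 ≤ (φ n : ℝ) / 2 * (tn - sn) ^ 2 := by positivity
    simp only [Psi] at m4
    linarith
  have hr2 : Real.exp (-lam * tn) * (M + η) ≤ U₁ Xn tn - U₂ Yn sn := by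
    refine le_trans ?_ hr
    have : 0 ≤ η / (T - tn) := div_nonneg hη0.le (by linarith)
    simp only [hχ, chi]; linarith
  have hr3 := mul_le_mul_of_nonneg_left hr2 hlam
  have hG : |G θ Xn (g • (Xn - Yn)) - G θ Yn (g • (Xn - Yn))| ≤ K * ‖Xn - Yn‖ := by
    rcases hreg with h | ⟨L, hL, h, h'⟩
    · exact h _ _ _ _
    · refine h _ _ _ _ ?_
      rw [norm_smul, Real.norm_eq_abs, abs_of_pos hg0]
      have hq : g / 2 * ‖Xn - Yn‖ ^ 2 ≤ L * ‖Xn - Yn‖ := by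
        rcases h' with h' | h'
        · have k1 := m5 Yn Yn tn sn m1 m2 m3 n5.le
          have k2 := h' Xn Yn tn m1
          simp only [Psi, hβ, sub_self, norm_zero] at k1
          norm_num at k1
          linarith
        · have k1 := m5 Xn Xn tn sn m1 m2 m3 n5.le
          have k2 := h' Xn Yn sn m3
          simp only [Psi, hβ, sub_self, norm_zero] at k1
          norm_num at k1
          linarith
      rcases (norm_nonneg (Xn - Yn)).lt_or_eq with k | k
      · have : g / 2 * ‖Xn - Yn‖ ≤ L := by
          refine le_of_mul_le_mul_right ?_ k
          linarith
        linarith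
      · rw [← k]; simp; exact hL
  have hmn : mnorm (σ θ Xn - σ θ Yn) ^ 2 ≤ Q * ‖Xn - Yn‖ ^ 2 := by
    refine (mnorm_lip (hσl θ Xn Yn)).trans (le_of_eq ?_)
    rw [hQ]; ring
  have hmn2 : g * mnorm (σ θ Xn - σ θ Yn) ^ 2 ≤ e₀ / 4 := by
    calc g * mnorm (σ θ Xn - σ θ Yn) ^ 2 ≤ g * (Q * ‖Xn - Yn‖ ^ 2) := by gcongr
      _ = Q * (g * ‖Xn - Yn‖ ^ 2) := by ring
      _ ≤ Q * (6 * (e₀ / (24 * (Q + 1)))) := by gcongr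
      _ = Q / (Q + 1) * (e₀ / 4) := by field_simp; ring
      _ ≤ 1 * (e₀ / 4) := by
          gcongr
          rw [div_le_one (by positivity)]; linarith
      _ = _ := one_mul _
  have hT2 : e₀ ≤ η / (T - tn) ^ 2 := by
    have : 0 < T - tn := by linarith
    rw [he₀]
    gcongr
    linarith
  simp only [Fl] at hθ
  have := (abs_le.1 hG).1
  linarith

lemma norm_jet {V : Type*} [NormedAddCommGroup V] [InnerProductSpace ℝ V] {z : V} (hz : z ≠ 0)
    {L : ℝ} (hL : 0 ≤ L) (h : V) :
    L * ‖z + h‖ ≤ L * ‖z‖ + ⟪(L / ‖z‖) • z, h⟫ + (L / ‖z‖) / 2 * ‖h‖ ^ 2 := by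
  have hn : 0 < ‖z‖ := norm_pos_iff.2 hz
  have a1 := norm_add_sq_real z h
  have a2 : 0 ≤ (L / ‖z‖) / 2 * (‖z + h‖ - ‖z‖) ^ 2 := by positivity
  rw [inner_smul_left, conj_trivial]
  have e : L / ‖z‖ * ‖z‖ = L := by field_simp
  have e2 : (L / ‖z‖) / 2 * (‖z + h‖ - ‖z‖) ^ 2
      = (L / ‖z‖) / 2 * ‖z + h‖ ^ 2 - (L / ‖z‖ * ‖z‖) * ‖z + h‖
        + (L / ‖z‖ * ‖z‖) / 2 * ‖z‖ := by ring
  rw [e2, a1, e] at a2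
  have e3 : (L / ‖z‖) / 2 * (‖z‖ ^ 2 + 2 * ⟪z, h⟫ + ‖h‖ ^ 2) =
    (L / ‖z‖ * ‖z‖) / 2 * ‖z‖ + L / ‖z‖ * ⟪z, h⟫ + (L / ‖z‖) / 2 * ‖h‖ ^ 2 := by ring
  rw [e3, e] at a2
  linarith

lemma LIP {σ : Θ → E N → Matrix (Fin N) (Fin N) ℝ} {F : Θ → E N → ℝ → E N → ℝ} {C ν L B : ℝ}
    (hC : 0 ≤ C) (hν : 0 ≤ ν) (hL : 1 ≤ L)
    (hσb : ∀ θ x i j, |σ θ x i j| ≤ C)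
    (hσl : ∀ θ x y i j, |σ θ x i j - σ θ y i j| ≤ C * ‖x - y‖)
    (hF : EquiC F) {v : E N → ℝ → ℝ} (hv : Continuous fun q : E N × ℝ => v q.1 q.2)
    (hp : ∀ t : ℝ, ZPeriodic fun x => v x t) (h1 : SubF σ F v) (h2 : SupF σ F v)
    (hvb : ∀ x t, 0 ≤ t → 0 ≤ v x t ∧ v x t ≤ B)
    (hpath : ∀ θ x y p r₁ r₂, ‖p‖ = L → x ≠ y → 0 ≤ r₂ → r₁ ≤ B → L * ‖x - y‖ ≤ r₁ - r₂ →
      L / ‖x - y‖ * mnorm (σ θ x - σ θ y) ^ 2 + ν * (r₁ - r₂) ≤ F θ x r₁ p - F θ y r₂ p)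
    {M : ℝ} (hM : 0 ≤ M) (h0 : ∀ x y, v x 0 - v y 0 ≤ L * ‖x - y‖ + M)
    (x₁ y₁ : E N) (t₁ : ℝ) (ht₁ : 0 ≤ t₁) :
    v x₁ t₁ - v y₁ t₁ ≤ L * ‖x₁ - y₁‖ + Real.exp (-ν * t₁) * M := by
  by_contra! hcon
  set d := v x₁ t₁ - v y₁ t₁ - L * ‖x₁ - y₁‖ - Real.exp (-ν * t₁) * M with hd
  have hd0 : 0 < d := by linarith
  set η := d / 3 with hη
  have hη0 : 0 < η := by positivity
  set T := t₁ + 1 with hT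
  have hT0 : 0 < T := by linarith
  set χ := chi ν (M + η) η T with hχ
  have hexp : ∀ t, 0 ≤ t → Real.exp (-ν * t) ≤ 1 := fun t ht =>
    Real.exp_le_one_iff.2 (by nlinarith)
  have hχ' : ∀ t, 0 ≤ t → t < T → η / (T - t) ≤ χ t := by
    intro t _ _
    have : 0 ≤ Real.exp (-ν * t) * (M + η) := by positivity
    simp only [hχ, chi]; linarith
  set β : ℕ → E N → ℝ := fun _ z => L * ‖z‖ with hβ
  obtain ⟨X, Y, t, s, φ, x, y, τ, hφ, lX, lY, lt, ls, hτ0, hτT, hmax⟩ :=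
    DBL hv.upperSemicontinuous hv.lowerSemicontinuous hp hp hη0 (chi_cont ν (M + η) η T) hχ' (β := β)
      (fun n => by simp only [hβ]; fun_prop)
      (fun n z => by
        have := mul_le_mul_of_nonneg_right hL (norm_nonneg z)
        simp only [hβ]; linarith)
      (fun n z => by simp only [hβ]; positivity) (a := x₁) (b := y₁) ht₁ (by linarith) (by
        intro n
        have a1 := hexp t₁ ht₁
        have a2 := mul_le_mul_of_nonneg_right a1 hη0.le
        have a3 : T - t₁ = 1 := by rw [hT]; ring
        simp only [hβ, chi, a3, div_one]
        have : d = 3 * η := by rw [hη]; ring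
        rw [mul_add]
        linarith)
  have hpX : Tendsto (fun n => v (X (φ n)) (t (φ n))) atTop (𝓝 (v x τ)) :=
    (hv.tendsto (x, τ)).comp (lX.prodMk_nhds lt)
  have hpY : Tendsto (fun n => v (Y (φ n)) (s (φ n))) atTop (𝓝 (v y τ)) :=
    (hv.tendsto (y, τ)).comp (lY.prodMk_nhds ls)
  have hχc : Tendsto (fun n => χ (t (φ n))) atTop (𝓝 (χ τ)) :=
    ((chi_cont ν (M + η) η T).continuousAt (Iio_mem_nhds hτT)).tendsto.comp lt
  have hdist : Tendsto (fun n => ‖X (φ n) - Y (φ n)‖) atTop (𝓝 ‖x - y‖) := (lX.sub lY).norm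
  have hr : ∀ n, L * ‖X n - Y n‖ + χ (t n) ≤ v (X n) (t n) - v (Y n) (s n) := by
    intro n
    obtain ⟨m1, m2, m3, m4, -⟩ := hmax n
    have m7 : 0 ≤ (n : ℝ) / 2 * (t n - s n) ^ 2 := by positivity
    simp only [Psi, hβ] at m4
    linarith
  have hlim : L * ‖x - y‖ + χ τ ≤ v x τ - v y τ :=
    le_of_tendsto_of_tendsto ((hdist.const_mul L).add hχc) (hpX.sub hpY)
      (Eventually.of_forall fun n => hr (φ n))
  have hχpos : ∀ t', 0 ≤ t' → t' < T → 0 < χ t' := fun t' a b =>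
    (div_pos hη0 (by linarith)).trans_le (hχ' t' a b)
  have hxy : x ≠ y := by
    rintro rfl
    have := hχpos τ hτ0 hτT
    simp at hlim; linarith
  have hτp : 0 < τ := by
    rcases hτ0.lt_or_eq with h | h
    · exact h
    exfalso
    subst h
    have m8 : M + η ≤ χ 0 := by
      have : 0 < η / T := by positivity
      simp only [hχ, chi]; simp; linarith
    linarith [h0 x y]
  have hne : 0 < ‖x - y‖ := norm_pos_iff.2 (sub_ne_zero.2 hxy)
  obtain ⟨n, n2, n3, n4, n5⟩ := ((hdist.eventually (lt_mem_nhds hne)).and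
    ((lt.eventually (lt_mem_nhds hτp)).and ((ls.eventually (lt_mem_nhds hτp)).and
      (ls.eventually (gt_mem_nhds (show τ < T + 1 by linarith)))))).exists
  obtain ⟨m1, m2, m3, m4, m5⟩ := hmax (φ n)
  have hrn := hr (φ n)
  simp only [Function.comp] at n3 n4 n5
  set Xn := X (φ n)
  set Yn := Y (φ n)
  set tn := t (φ n)
  set sn := s (φ n)
  obtain ⟨c, hc, htay⟩ := chi_taylor (ν := ν) (M := M + η) (η := η) (T := T) (t := tn)
    (by positivity) hη0.le m2
  have hz : Xn - Yn ≠ 0 := norm_pos_iff.1 n2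
  set e₀ := η / T ^ 2 with he₀
  have he0 : 0 < e₀ := by positivity
  obtain ⟨θ, hθ⟩ := TPM hC hσb hσl hF hv.upperSemicontinuous hv.lowerSemicontinuous h1 h2
    (β := β (φ n)) (χ := χ) (g := (φ n : ℝ)) (T := T)
    (Nat.cast_nonneg _) (x := Xn) (y := Yn) (p := (L / ‖Xn - Yn‖) • (Xn - Yn)) (t := tn) (s := sn)
    (b := L / ‖Xn - Yn‖) n3 m2 n4 n5 (by positivity) hc m5
    (fun h => norm_jet hz (by linarith) h) htay (κ := e₀ / 2) (by positivity)
  have hχt := hχpos tn m1 m2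
  have hr2 : Real.exp (-ν * tn) * (M + η) ≤ v Xn tn - v Yn sn := by
    have : 0 ≤ η / (T - tn) := div_nonneg hη0.le (by linarith)
    have : 0 ≤ L * ‖Xn - Yn‖ := by positivity
    simp only [hχ, chi] at hrn; linarith
  have hr3 := mul_le_mul_of_nonneg_left hr2 hν
  have hpa := hpath θ Xn Yn ((L / ‖Xn - Yn‖) • (Xn - Yn)) (v Xn tn) (v Yn sn) (by
    rw [norm_smul, Real.norm_eq_abs, abs_of_nonneg (by positivity)]
    field_simp) (sub_ne_zero.1 hz) (hvb _ _ m3).1 (hvb _ _ m1).2 (by linarith)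
  have hT2 : e₀ ≤ η / (T - tn) ^ 2 := by
    have : 0 < T - tn := by linarith
    rw [he₀]
    gcongr
    linarith
  linarith

lemma ac_lower {g : ℝ → ℝ} {c : ℝ} (hg : AbsolutelyContinuousOnInterval g 0 1)
    (h : ∀ᵐ s : ℝ, s ∈ Set.Icc (0:ℝ) 1 → ∃ g', HasDerivAt g g' s ∧ c ≤ g') : c ≤ g 1 - g 0 := by
  rw [← hg.integral_deriv_eq_sub]
  have : ∫ _ in (0:ℝ)..1, c = c := by simp
  rw [← this]
  refine intervalIntegral.integral_mono_ae_restrict zero_le_one (by simp)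
    hg.intervalIntegrable_deriv ?_
  refine (MeasureTheory.ae_restrict_iff' measurableSet_Icc).2 ?_
  filter_upwards [h] with s hs hs1
  obtain ⟨g', h1, h2⟩ := hs hs1
  rw [h1.deriv]; exact h2

lemma ac_sum {ι : Type*} (s : Finset ι) {f : ι → ℝ → ℝ}
    (h : ∀ i ∈ s, AbsolutelyContinuousOnInterval (f i) 0 1) :
    AbsolutelyContinuousOnInterval (fun x => ∑ i ∈ s, f i x) 0 1 := by
  classical
  induction s using Finset.induction_on with
  | empty => 
    simp only [Finset.sum_empty]
    exact (contDiff_const (n := 1)).contDiffOn.absolutelyContinuousOnInterval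
  | insert a s ha ih =>
    simp only [Finset.sum_insert ha]
    exact (h a (by simp)).fun_add (ih fun i hi => h i (by simp [hi]))

lemma ae_path {P : E N × E N → Prop} (hP : ∀ᵐ z, P z) (d : E N) (r Δ : ℝ) :
    ∀ᵐ z : E N × E N, ∀ᵐ s : ℝ, P (z.1 + s • d, Real.exp (r + s * Δ) • z.2) := by
  have hq : MeasureTheory.Measure.QuasiMeasurePreserving
      (fun w : (E N × E N) × ℝ => (w.1.1 + w.2 • d, Real.exp (r + w.2 * Δ) • w.1.2))
      (MeasureTheory.volume.prod MeasureTheory.volume) MeasureTheory.volume := by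
    refine MeasureTheory.QuasiMeasurePreserving.prod_of_left ?_ ?_
    · refine Continuous.measurable ?_
      fun_prop
    · refine Filter.Eventually.of_forall fun s => ?_
      exact MeasureTheory.QuasiMeasurePreserving.prodMap
        (MeasureTheory.measurePreserving_add_right MeasureTheory.volume (s • d)).quasiMeasurePreserving
        (MeasureTheory.Measure.quasiMeasurePreserving_smul MeasureTheory.volume
          (Real.exp_pos (r + s * Δ)).ne')
  exact MeasureTheory.Measure.ae_ae_of_ae_prod (hq.ae hP)

lemma ae_diffH {H : E N → E N → ℝ}
    (hH : ∀ R > (0:ℝ), ∃ CR > (0:ℝ), ∀ (x y p q : E N),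
      ‖p‖ ≤ R → ‖q‖ ≤ R → |H x p - H y q| ≤ CR * (‖x - y‖ + ‖p - q‖)) :
    ∀ᵐ z : E N × E N, DifferentiableAt ℝ (fun z : E N × E N => H z.1 z.2) z := by
  have h : ∀ n : ℕ, ∀ᵐ z : E N × E N, z ∈ {z : E N × E N | ‖z.2‖ < n + 1} →
      DifferentiableWithinAt ℝ (fun z : E N × E N => H z.1 z.2) {z : E N × E N | ‖z.2‖ < n + 1} z := by
    intro n
    haveI : (MeasureTheory.volume : MeasureTheory.Measure (E N × E N)).IsAddHaarMeasure :=
      MeasureTheory.Measure.prod.instIsAddHaarMeasure MeasureTheory.volume MeasureTheory.volume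
    obtain ⟨CR, h0, h⟩ := hH (n + 1) (by positivity)
    refine LipschitzOnWith.ae_differentiableWithinAt_of_mem (C := (2 * CR).toNNReal) ?_
    refine LipschitzOnWith.of_dist_le_mul fun z hz w hw => ?_
    rw [Real.dist_eq, Real.coe_toNNReal _ (by positivity), dist_eq_norm]
    refine (h z.1 w.1 z.2 w.2 (le_of_lt hz) (le_of_lt hw)).trans ?_
    have := norm_fst_le (z - w)
    have := norm_snd_le (z - w)
    simp only [Prod.fst_sub, Prod.snd_sub] at *
    rw [mul_comm 2 CR, mul_assoc]
    gcongr
    linarith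
  filter_upwards [MeasureTheory.ae_all_iff.2 h] with z hz
  obtain ⟨n, hn⟩ := exists_nat_gt ‖z.2‖
  have hm : z ∈ {z : E N × E N | ‖z.2‖ < n + 1} := by
    simp only [Set.mem_ofPred_eq]; linarith
  exact (hz n hm).differentiableAt ((isOpen_lt (by fun_prop) (by fun_prop)).mem_nhds hm)

lemma bilin_le (M : Matrix (Fin N) (Fin N) ℝ) (p : E N) :
    ∑ i, ∑ j, M i j * (p i * p j) ≤ mnorm M * ‖p‖ ^ 2 := by
  have h1 := Finset.sum_mul_sq_le_sq_mul_sq (Finset.univ : Finset (Fin N × Fin N))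
    (fun z => M z.1 z.2) (fun z => p z.1 * p z.2)
  simp only [Fintype.sum_prod_type] at h1
  have h2 : ∑ i, ∑ j, (p i * p j) ^ 2 = (‖p‖ ^ 2) ^ 2 := by
    rw [EuclideanSpace.real_norm_sq_eq, sq (∑ i, _), Finset.sum_mul_sum]
    simp only [mul_pow]
  rw [h2, ← mnorm_sq, ← mul_pow] at h1
  exact le_of_sq_le_sq h1 (mul_nonneg (Real.sqrt_nonneg _) (by positivity))
where le_of_sq_le_sq {a b : ℝ} (h : a ^ 2 ≤ b ^ 2) (hb : 0 ≤ b) : a ≤ b :=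
  abs_le_of_sq_le_sq' h hb |>.2

/-- squared norm of Sᵀp -/
def qs (S : Matrix (Fin N) (Fin N) ℝ) (p : E N) : ℝ := ∑ j, (∑ i, S i j * p i) ^ 2

/-- log-transformed Hamiltonian -/
def FL (σ : E N → Matrix (Fin N) (Fin N) ℝ) (H : E N → E N → ℝ) (k : ℝ) (x : E N) (r : ℝ)
    (p : E N) : ℝ := Real.exp (-r) * (H x (Real.exp r • p) + k) - qs (σ x) p

lemma qs_deriv {σ : ℝ → Matrix (Fin N) (Fin N) ℝ} {D : Matrix (Fin N) (Fin N) ℝ} {s : ℝ}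
    (h : ∀ i j, HasDerivAt (fun s => σ s i j) (D i j) s) (p : E N) :
    HasDerivAt (fun s => qs (σ s) p) (∑ i, ∑ l, ((2:ℝ) • (σ s * Matrix.of fun i j => D j i)) i l
      * (p i * p l)) s := by
  have h1 : HasDerivAt (fun s => qs (σ s) p)
      (∑ j, 2 * (∑ i, σ s i j * p i) * (∑ l, D l j * p l)) s := by
    unfold qs
    refine HasDerivAt.fun_sum fun j _ => ?_
    have h2 : HasDerivAt (fun s => ∑ i, σ s i j * p i) (∑ l, D l j * p l) s :=
      HasDerivAt.fun_sum fun i _ => (h i j).mul_const _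
    simpa using h2.fun_pow 2
  convert h1 using 1
  simp only [Matrix.smul_apply, Matrix.mul_apply, Matrix.of_apply, smul_eq_mul]
  simp only [mul_assoc, Finset.mul_sum, Finset.sum_mul]
  rw [Finset.sum_comm' (t' := Finset.univ) (s' := fun _ => Finset.univ) (by simp), Finset.sum_comm]
  rw [Finset.sum_comm]
  have : ∀ i : Fin N, ∑ l : Fin N, ∑ j, 2 * (σ s i j * (D l j * (p i * p l)))
      = ∑ j, ∑ l, 2 * (σ s i j * (p i * (D l j * p l))) := fun i => by
    rw [Finset.sum_comm]
    refine Finset.sum_congr rfl fun j _ => Finset.sum_congr rfl fun l _ => by ring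
  rw [Finset.sum_comm]
  simp only [this]
  rw [Finset.sum_comm]
  exact Finset.sum_congr rfl fun y _ => Finset.sum_comm

lemma pathA {σ : E N → Matrix (Fin N) (Fin N) ℝ} {H : E N → E N → ℝ} {C L₁ K Sg : ℝ}
    {S : E N → ℝ}
    (hσl : ∀ i j, LipschitzWith C.toNNReal fun x => σ x i j)
    (hH : ∀ R > (0:ℝ), ∃ CR > (0:ℝ), ∀ (x y p q : E N),
      ‖p‖ ≤ R → ‖q‖ ≤ R → |H x p - H y q| ≤ CR * (‖x - y‖ + ‖p - q‖))
    (hL₁ : 1 ≤ L₁)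
    (hS : ∀ x w, mnorm ((2:ℝ) • (σ x * Matrix.of fun i j => fderiv ℝ (fun y => σ y j i) x w))
      ≤ S x * ‖w‖) (hS0 : ∀ x, 0 ≤ S x)
    (hBS : ∀ᵐ z : E N × E N, L₁ ≤ ‖z.2‖ →
      0 ≤ L₁ * ((fderiv ℝ (fun p => H z.1 p) z.2) z.2 - H z.1 z.2 - S z.1 * ‖z.2‖ - K)
        - ‖fderiv ℝ (fun y => H y z.2) z.1‖ - N * Sg ^ 2 * ‖z.2‖)
    {k k0 r Δ : ℝ} (d : E N) (hr : 0 ≤ r) (hk0 : 0 ≤ k0) (hk : k + k0 ≤ K) :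
    ∀ᵐ z : E N × E N, L₁ ≤ ‖z.2‖ → ‖z.2‖ * ‖d‖ ≤ Δ →
      N * Sg ^ 2 * ‖z.2‖ * ‖d‖ + k0 * Real.exp (-(r + Δ)) * Δ
        ≤ FL σ H k (z.1 + d) (r + Δ) z.2 - FL σ H k z.1 r z.2 := by
  have hσd : ∀ᵐ z : E N × E N, ∀ i j, DifferentiableAt ℝ (fun x => σ x i j) z.1 := by
    have : ∀ᵐ x : E N, ∀ i j, DifferentiableAt ℝ (fun x => σ x i j) x := by
      simp only [MeasureTheory.ae_all_iff]
      exact fun i j => (hσl i j).ae_differentiableAt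
    exact MeasureTheory.Measure.quasiMeasurePreserving_fst.ae this
  filter_upwards [ae_path ((hBS.and (ae_diffH hH)).and hσd) d r Δ] with z hz hz1 hz2
  obtain ⟨y, p⟩ := z
  simp only at hz hz1 hz2 ⊢
  have hΔ : 0 ≤ Δ := le_trans (by positivity) hz2
  set q : ℝ → E N × E N := fun s => (y + s • d, Real.exp (r + s * Δ) • p) with hq
  set g : ℝ → ℝ := fun s => Real.exp (-(r + s * Δ)) * (H (q s).1 (q s).2 + k)
    - qs (σ (y + s • d)) p with hg
  have e1 : g 1 = FL σ H k (y + d) (r + Δ) p := by simp [hg, hq, FL]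
  have e0 : g 0 = FL σ H k y r p := by simp [hg, hq, FL]
  rw [← e1, ← e0]
  refine ac_lower ?_ ?_
  · have a1 : AbsolutelyContinuousOnInterval (fun s => Real.exp (-(r + s * Δ))) 0 1 := by
      refine ContDiffOn.absolutelyContinuousOnInterval (ContDiff.contDiffOn ?_)
      fun_prop
    have a2 : AbsolutelyContinuousOnInterval (fun s => H (q s).1 (q s).2 + k) 0 1 := by
      have c1 : ContDiff ℝ 1 q := by fun_prop
      obtain ⟨K, hK⟩ := c1.contDiffOn.exists_lipschitzOnWith (s := Set.uIcc (0:ℝ) 1) (by decide)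
        (convex_uIcc _ _) isCompact_uIcc
      obtain ⟨CR, h0, h⟩ := hH (Real.exp (r + Δ) * ‖p‖ + 1) (by positivity)
      have hb : ∀ s ∈ Set.uIcc (0:ℝ) 1, ‖(q s).2‖ ≤ Real.exp (r + Δ) * ‖p‖ + 1 := fun s hs => by
        rw [Set.uIcc_of_le zero_le_one] at hs
        simp only [hq, norm_smul, Real.norm_eq_abs, Real.abs_exp]
        have : Real.exp (r + s * Δ) ≤ Real.exp (r + Δ) := 
          Real.exp_le_exp.2 (by nlinarith [hs.1, hs.2])
        nlinarith [norm_nonneg p]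
      refine (LipschitzOnWith.of_dist_le_mul (K := (CR * (2 * K)).toNNReal)
        fun s hs t ht => ?_).absolutelyContinuousOnInterval
      rw [Real.coe_toNNReal _ (by positivity), Real.dist_eq]
      have h1 := h (q s).1 (q t).1 (q s).2 (q t).2 (hb s hs) (hb t ht)
      have h2 := hK.dist_le_mul s hs t ht
      rw [dist_eq_norm] at h2
      have := norm_fst_le (q s - q t)
      have := norm_snd_le (q s - q t)
      simp only [Prod.fst_sub, Prod.snd_sub] at *
      rw [add_sub_add_right_eq_sub]
      refine h1.trans ?_
      rw [mul_assoc]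
      gcongr
      linarith
    refine (a1.fun_mul a2).fun_sub (ac_sum _ fun j _ => ?_)
    have a3 : AbsolutelyContinuousOnInterval (fun s => ∑ i, σ (y + s • d) i j * p i) 0 1 := by
      refine ac_sum _ fun i _ => ?_
      have : LipschitzWith (C.toNNReal * ‖d‖₊) (fun s : ℝ => σ (y + s • d) i j) := by
        refine (hσl i j).comp (LipschitzWith.of_dist_le_mul fun s t => ?_)
        rw [dist_add_left, dist_eq_norm, ← sub_smul, norm_smul, Real.dist_eq, mul_comm]
        rfl
      have := ((this.lipschitzOnWith (s := Set.uIcc (0:ℝ) 1)).absolutelyContinuousOnInterval).const_mul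
        (p i)
      simpa only [mul_comm] using this
    simpa only [sq] using a3.fun_mul a3
  filter_upwards [hz] with s hs hs1
  obtain ⟨⟨hbs, hdH⟩, hdσ⟩ := hs
  have hq1 : ‖Real.exp (r + s * Δ) • p‖ = Real.exp (r + s * Δ) * ‖p‖ := by
    rw [norm_smul, Real.norm_eq_abs, Real.abs_exp]
  set ρ := r + s * Δ with hρ
  have hρ0 : 0 ≤ ρ := by nlinarith [mul_nonneg hs1.1 hΔ]
  have hρ1 : ρ ≤ r + Δ := by nlinarith [hs1.2]
  have hexp : 1 ≤ Real.exp ρ := Real.one_le_exp hρ0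
  have hbs' := hbs (by rw [hq1]; nlinarith)
  set f' := fderiv ℝ (fun z : E N × E N => H z.1 z.2) (y + s • d, Real.exp ρ • p) with hf'
  have hf := hdH.hasFDerivAt
  have p1 : HasFDerivAt (fun p' => H (y + s • d) p') (f'.comp (.inr ℝ (E N) (E N))) (Real.exp ρ • p) :=
    HasFDerivAt.comp (g := fun z : E N × E N => H z.1 z.2) (Real.exp ρ • p) hf
      (hasFDerivAt_prodMk_right (y + s • d) (Real.exp ρ • p))
  have p2 : HasFDerivAt (fun y' => H y' (Real.exp ρ • p)) (f'.comp (.inl ℝ (E N) (E N))) (y + s • d) :=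
    HasFDerivAt.comp (g := fun z : E N × E N => H z.1 z.2) (f := fun y' => (y', Real.exp ρ • p))
      (y + s • d) hf
      (hasFDerivAt_prodMk_left (y + s • d) (Real.exp ρ • p))
  rw [p1.fderiv, p2.fderiv, hq1] at hbs'
  have hρd : HasDerivAt (fun s : ℝ => r + s * Δ) Δ s := by
    simpa using ((hasDerivAt_id s).mul_const Δ).const_add r
  have hx : HasDerivAt (fun s : ℝ => y + s • d) d s := by
    simpa using ((hasDerivAt_id s).smul_const d).const_add y
  have hqd : HasDerivAt q (d, (Real.exp ρ * Δ) • p) s := 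
    hx.prodMk (hρd.exp.smul_const p)
  have hHd : HasDerivAt (fun s => H (q s).1 (q s).2) (f' (d, (Real.exp ρ * Δ) • p)) s :=
    HasFDerivAt.comp_hasDerivAt (l := fun z : E N × E N => H z.1 z.2) s hf hqd
  have hσq := qs_deriv (σ := fun s => σ (y + s • d))
    (D := Matrix.of fun i j => fderiv ℝ (fun x => σ x i j) (y + s • d) d)
    (s := s) (fun i j => HasFDerivAt.comp_hasDerivAt (l := fun x => σ x i j)
      (f := fun s : ℝ => y + s • d) s (hdσ i j).hasFDerivAt hx) p
  refine ⟨_, (hρd.neg.exp.mul (hHd.add_const k)).sub hσq, ?_⟩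
  have b1 := bilin_le ((2:ℝ) • (σ (y + s • d) *
    Matrix.of fun i j => fderiv ℝ (fun x => σ x j i) (y + s • d) d)) p
  have b2 := hS (y + s • d) d
  have split : f' (d, (Real.exp ρ * Δ) • p) = f' (d, 0) + Δ * f' (0, Real.exp ρ • p) := by
    rw [← smul_eq_mul Δ, ← map_smul, ← map_add]
    congr 1
    simp [smul_smul, mul_comm]
  rw [split]
  have b3 := (f'.comp (.inl ℝ (E N) (E N))).le_opNorm (-d)
  rw [norm_neg] at b3
  have b4 := (le_abs_self _).trans b3
  set Dx := ‖f'.comp (.inl ℝ (E N) (E N))‖ with hDx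
  have v1 : (f'.comp (.inl ℝ (E N) (E N))) (-d) = - f' (d, 0) := by
    rw [map_neg]; rfl
  have v2 : (f'.comp (.inr ℝ (E N) (E N))) (Real.exp ρ • p) = f' (0, Real.exp ρ • p) := rfl
  rw [v1] at b4
  rw [v2] at hbs'
  simp only [Matrix.of_apply]
  have hee : Real.exp (-ρ) * Real.exp ρ = 1 := by rw [← Real.exp_add]; simp
  have hDx0 : 0 ≤ Dx := norm_nonneg _
  have hSx := hS0 (y + s • d)
  have hen : Real.exp (-(r + Δ)) ≤ Real.exp (-ρ) := Real.exp_le_exp.2 (by linarith)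
  have hep := Real.exp_pos (-ρ)
  generalize f' (d, 0) = A at *
  generalize f' (0, Real.exp ρ • p) = B at *
  clear_value Dx
  change 0 ≤ L₁ * (B - H (y + s • d) (Real.exp ρ • p) - S (y + s • d) * (Real.exp ρ * ‖p‖) - K)
    - Dx - N * Sg ^ 2 * (Real.exp ρ * ‖p‖) at hbs'
  change _ ≤ Real.exp (-ρ) * -Δ * (H (y + s • d) (Real.exp ρ • p) + k) + Real.exp (-ρ) * (A + Δ * B)
    - _
  have hsum := b1.trans (mul_le_mul_of_nonneg_right b2 (sq_nonneg ‖p‖))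
  refine le_trans ?_ (sub_le_sub_left hsum _)
  generalize H (y + s • d) (Real.exp ρ • p) = h at *
  generalize S (y + s • d) = Sx at *
  clear hsum b1 b2 hσq hHd hqd hx p1 p2 hf hbs
  have hn := norm_nonneg p
  have hd := norm_nonneg d
  have hNS : 0 ≤ (N:ℝ) * Sg ^ 2 := by positivity
  set P := B - h - Sx * (Real.exp ρ * ‖p‖) - K with hP
  have hB : B = P + h + Sx * (Real.exp ρ * ‖p‖) + K := by rw [hP]; ring
  have hP0 : 0 ≤ P := by
    have : 0 ≤ N * Sg ^ 2 * (Real.exp ρ * ‖p‖) := by positivity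
    by_contra hneg
    push Not at hneg
    have := mul_neg_of_pos_of_neg (by linarith : 0 < L₁) hneg
    linarith
  have hP1 : ‖d‖ * (Dx + N * Sg ^ 2 * (Real.exp ρ * ‖p‖)) ≤ Δ * P := by
    have u1 : ‖d‖ * (Dx + N * Sg ^ 2 * (Real.exp ρ * ‖p‖)) ≤ ‖d‖ * (L₁ * P) :=
      mul_le_mul_of_nonneg_left (by linarith) hd
    have u2 : L₁ * ‖d‖ ≤ Δ := (mul_le_mul_of_nonneg_right hz1 hd).trans hz2
    have u3 := mul_le_mul_of_nonneg_right u2 hP0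
    linarith
  have t1 : Real.exp (-ρ) * -Δ * (h + k) + Real.exp (-ρ) * (A + Δ * B)
      = Real.exp (-ρ) * (Δ * P + A) + (Real.exp (-ρ) * Real.exp ρ) * (Δ * Sx * ‖p‖)
        + Real.exp (-ρ) * (Δ * (K - k)) := by
    rw [hB]; ring
  rw [t1, hee]
  have t2 : Real.exp (-ρ) * (‖d‖ * (N * Sg ^ 2 * (Real.exp ρ * ‖p‖)))
      ≤ Real.exp (-ρ) * (Δ * P + A) := mul_le_mul_of_nonneg_left (by linarith) hep.le
  have t3 : Real.exp (-ρ) * (‖d‖ * (N * Sg ^ 2 * (Real.exp ρ * ‖p‖)))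
      = (Real.exp (-ρ) * Real.exp ρ) * (N * Sg ^ 2 * ‖p‖ * ‖d‖) := by ring
  rw [t3, hee] at t2
  have t4 : k0 * Real.exp (-(r + Δ)) * Δ ≤ Real.exp (-ρ) * (Δ * (K - k)) := by
    have : k0 * Real.exp (-(r + Δ)) * Δ ≤ k0 * Real.exp (-ρ) * Δ := by gcongr
    have w : Real.exp (-ρ) * (Δ * k0) ≤ Real.exp (-ρ) * (Δ * (K - k)) := by
      gcongr; linarith
    linarith
  have t5 : Sx * ‖d‖ * ‖p‖ ^ 2 ≤ Δ * Sx * ‖p‖ := by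
    have := mul_le_mul_of_nonneg_left hz2 (mul_nonneg hSx hn)
    linarith
  linarith

lemma contH {H : E N → E N → ℝ}
    (hH : ∀ R > (0:ℝ), ∃ CR > (0:ℝ), ∀ (x y p q : E N),
      ‖p‖ ≤ R → ‖q‖ ≤ R → |H x p - H y q| ≤ CR * (‖x - y‖ + ‖p - q‖)) :
    Continuous fun z : E N × E N => H z.1 z.2 := by
  rw [continuous_iff_continuousAt]
  intro z
  obtain ⟨CR, h0, h⟩ := hH (‖z.2‖ + 1) (by positivity)
  have h1 : Tendsto (fun w : E N × E N => CR * (‖w.1 - z.1‖ + ‖w.2 - z.2‖)) (𝓝 z) (𝓝 0) :=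
    Continuous.tendsto' (by fun_prop) _ _ (by simp)
  rw [ContinuousAt, tendsto_iff_dist_tendsto_zero]
  refine squeeze_zero' (Eventually.of_forall fun _ => dist_nonneg) ?_ h1
  have : ∀ᶠ w : E N × E N in 𝓝 z, ‖w.2‖ < ‖z.2‖ + 1 :=
    (continuous_snd.norm.tendsto z).eventually_lt_const (by simp)
  filter_upwards [this] with w hw
  rw [Real.dist_eq]
  exact h _ _ _ _ hw.le (by simp)

lemma contFL {σ : E N → Matrix (Fin N) (Fin N) ℝ} {H : E N → E N → ℝ}
    (hσ : ∀ i j, Continuous fun x => σ x i j) (hH : Continuous fun z : E N × E N => H z.1 z.2)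
    (k : ℝ) {X : Type*} [TopologicalSpace X] {x p : X → E N} {r : X → ℝ} (hx : Continuous x)
    (hr : Continuous r) (hp : Continuous p) : Continuous fun s => FL σ H k (x s) (r s) (p s) := by
  unfold FL qs
  have h1 : Continuous fun s => H (x s) (Real.exp (r s) • p s) :=
    hH.comp (f := fun s => (x s, Real.exp (r s) • p s)) (by fun_prop)
  have h2 : ∀ i j, Continuous fun s => σ (x s) i j := fun i j => (hσ i j).comp hx
  fun_prop

lemma vol_haar : (MeasureTheory.volume : MeasureTheory.Measure (E N × E N)).IsAddHaarMeasure :=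
  MeasureTheory.Measure.prod.instIsAddHaarMeasure MeasureTheory.volume MeasureTheory.volume

lemma pathB {σ : E N → Matrix (Fin N) (Fin N) ℝ} {H : E N → E N → ℝ} {C L₁ K Sg : ℝ}
    {S : E N → ℝ}
    (hσl : ∀ i j, LipschitzWith C.toNNReal fun x => σ x i j)
    (hH : ∀ R > (0:ℝ), ∃ CR > (0:ℝ), ∀ (x y p q : E N),
      ‖p‖ ≤ R → ‖q‖ ≤ R → |H x p - H y q| ≤ CR * (‖x - y‖ + ‖p - q‖))
    (hL₁ : 1 ≤ L₁)
    (hS : ∀ x w, mnorm ((2:ℝ) • (σ x * Matrix.of fun i j => fderiv ℝ (fun y => σ y j i) x w))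
      ≤ S x * ‖w‖) (hS0 : ∀ x, 0 ≤ S x)
    (hBS : ∀ᵐ z : E N × E N, L₁ ≤ ‖z.2‖ →
      0 ≤ L₁ * ((fderiv ℝ (fun p => H z.1 p) z.2) z.2 - H z.1 z.2 - S z.1 * ‖z.2‖ - K)
        - ‖fderiv ℝ (fun y => H y z.2) z.1‖ - N * Sg ^ 2 * ‖z.2‖)
    {k k0 r r' : ℝ} (hr : 0 ≤ r) (hk0 : 0 ≤ k0) (hk : k + k0 ≤ K) {x y p : E N}
    (hp : L₁ ≤ ‖p‖) (hd : ‖p‖ * ‖x - y‖ ≤ r' - r) :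
    N * Sg ^ 2 * ‖p‖ * ‖x - y‖ + k0 * Real.exp (-r') * (r' - r)
        ≤ FL σ H k x r' p - FL σ H k y r p := by
  have hσc : ∀ i j, Continuous fun x => σ x i j := fun i j => (hσl i j).continuous
  have hHc := contH hH
  have := @vol_haar N
  have key : ∀ Δ : ℝ, ∀ z : E N × E N, (L₁ < ‖z.2‖ ∧ ‖z.2‖ * ‖x - y‖ < Δ) →
      N * Sg ^ 2 * ‖z.2‖ * ‖x - y‖ + k0 * Real.exp (-(r + Δ)) * Δ
        ≤ FL σ H k (z.1 + (x - y)) (r + Δ) z.2 - FL σ H k z.1 r z.2 := by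
    intro Δ
    have hcl : IsClosed {z : E N × E N | (L₁ < ‖z.2‖ ∧ ‖z.2‖ * ‖x - y‖ < Δ) →
      N * Sg ^ 2 * ‖z.2‖ * ‖x - y‖ + k0 * Real.exp (-(r + Δ)) * Δ
        ≤ FL σ H k (z.1 + (x - y)) (r + Δ) z.2 - FL σ H k z.1 r z.2} := by
      simp only [imp_iff_not_or]
      have o1 : IsOpen {z : E N × E N | L₁ < ‖z.2‖ ∧ ‖z.2‖ * ‖x - y‖ < Δ} :=
        (isOpen_lt (f := fun _ => L₁) (g := fun z : E N × E N => ‖z.2‖) (by fun_prop)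
          (by fun_prop)).inter (isOpen_lt (f := fun z : E N × E N => ‖z.2‖ * ‖x - y‖)
            (g := fun _ => Δ) (by fun_prop) (by fun_prop))
      refine IsClosed.union o1.isClosed_compl ?_
      · refine isClosed_le (f := fun z : E N × E N => N * Sg ^ 2 * ‖z.2‖ * ‖x - y‖
          + k0 * Real.exp (-(r + Δ)) * Δ) (by fun_prop) ?_
        exact (contFL hσc hHc k (by fun_prop) (by fun_prop) (by fun_prop)).sub
          (contFL hσc hHc k (by fun_prop) (by fun_prop) (by fun_prop))
    have hae : ∀ᵐ z : E N × E N, (L₁ < ‖z.2‖ ∧ ‖z.2‖ * ‖x - y‖ < Δ) →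
      N * Sg ^ 2 * ‖z.2‖ * ‖x - y‖ + k0 * Real.exp (-(r + Δ)) * Δ
        ≤ FL σ H k (z.1 + (x - y)) (r + Δ) z.2 - FL σ H k z.1 r z.2 := by
      filter_upwards [pathA hσl hH hL₁ hS hS0 hBS (Δ := Δ) (x - y) hr hk0 hk] with z hz h
      exact hz h.1.le h.2.le
    have hde := MeasureTheory.Measure.dense_of_ae hae
    intro z
    have := hcl.closure_eq ▸ hde z
    exact this
  have hcl : IsClosed {ε : ℝ | 
      N * Sg ^ 2 * ‖(1 + ε) • p‖ * ‖x - y‖ + k0 * Real.exp (-(r + ((1 + ε) * (r' - r) + ε)))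
        * ((1 + ε) * (r' - r) + ε)
        ≤ FL σ H k (y + (x - y)) (r + ((1 + ε) * (r' - r) + ε)) ((1 + ε) • p)
          - FL σ H k y r ((1 + ε) • p)} := by
    refine isClosed_le (by fun_prop) ?_
    exact (contFL hσc hHc k (by fun_prop) (by fun_prop) (by fun_prop)).sub
          (contFL hσc hHc k (by fun_prop) (by fun_prop) (by fun_prop))
  have hsub : Set.Ioi (0:ℝ) ⊆ _ := fun ε (hε : 0 < ε) => key ((1 + ε) * (r' - r) + ε) (y, (1 + ε) • p) (by
    have : ‖(1 + ε) • p‖ = (1 + ε) * ‖p‖ := by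
      rw [norm_smul, Real.norm_eq_abs, abs_of_pos (by linarith)]
    simp only [this]
    constructor
    · nlinarith
    · have := mul_le_mul_of_nonneg_left hd (by linarith : 0 ≤ 1 + ε)
      linarith)
  have h0 : (0:ℝ) ∈ closure (Set.Ioi (0:ℝ)) := by rw [closure_Ioi]; simp
  have := (hcl.closure_subset_iff.2 hsub) h0
  simp only [Set.mem_ofPred_eq, add_zero, one_smul, one_mul, add_sub_cancel] at this
  exact this

lemma mnorm_path {σ : E N → Matrix (Fin N) (Fin N) ℝ} {C Sg : ℝ} (hSg : 0 ≤ Sg)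
    (hσl : ∀ i j, LipschitzWith C.toNNReal fun x => σ x i j)
    (hS : ∀ x w, mnorm (Matrix.of fun i j => fderiv ℝ (fun y => σ y i j) x w) ≤ Sg * ‖w‖)
    (x y : E N) : mnorm (σ x - σ y) ≤ Sg * ‖x - y‖ := by
  have := @vol_haar N
  set d := x - y with hd
  set D := σ x - σ y with hD
  have hσc : ∀ i j, Continuous fun x => σ x i j := fun i j => (hσl i j).continuous
  have hσd : ∀ᵐ z : E N × E N, ∀ i j, DifferentiableAt ℝ (fun x => σ x i j) z.1 := by
    have : ∀ᵐ x : E N, ∀ i j, DifferentiableAt ℝ (fun x => σ x i j) x := by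
      simp only [MeasureTheory.ae_all_iff]
      exact fun i j => (hσl i j).ae_differentiableAt
    exact MeasureTheory.Measure.quasiMeasurePreserving_fst.ae this
  have hcs : ∀ M : Matrix (Fin N) (Fin N) ℝ, ∑ i, ∑ j, D i j * M i j ≤ mnorm D * mnorm M := by
    intro M
    have h1 := Finset.sum_mul_sq_le_sq_mul_sq (Finset.univ : Finset (Fin N × Fin N))
      (fun z => D z.1 z.2) (fun z => M z.1 z.2)
    simp only [Fintype.sum_prod_type] at h1
    rw [← mnorm_sq, ← mnorm_sq, ← mul_pow] at h1
    exact (abs_le_of_sq_le_sq' h1 (mul_nonneg (Real.sqrt_nonneg _) (Real.sqrt_nonneg _))).2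
  have hae : ∀ᵐ z : E N × E N, ∑ i, ∑ j, D i j * (σ (z.1 + d) i j - σ z.1 i j)
      ≤ mnorm D * (Sg * ‖d‖) := by
    filter_upwards [ae_path hσd d 0 0] with z hz
    have hac : AbsolutelyContinuousOnInterval
        (fun s : ℝ => ∑ i, ∑ j, (-D i j) * σ (z.1 + s • d) i j) 0 1 := by
      refine ac_sum _ fun i _ => ac_sum _ fun j _ => ?_
      have : LipschitzWith (C.toNNReal * ‖d‖₊) (fun s : ℝ => σ (z.1 + s • d) i j) := by
        refine (hσl i j).comp (LipschitzWith.of_dist_le_mul fun s t => ?_)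
        rw [dist_add_left, dist_eq_norm, ← sub_smul, norm_smul, Real.dist_eq, mul_comm]
        rfl
      exact ((this.lipschitzOnWith (s := Set.uIcc (0:ℝ) 1)).absolutelyContinuousOnInterval).const_mul _
    have h := ac_lower (c := -(mnorm D * (Sg * ‖d‖))) hac (by
      filter_upwards [hz] with s hs _
      have hx : HasDerivAt (fun s : ℝ => z.1 + s • d) d s := by
        simpa using ((hasDerivAt_id s).smul_const d).const_add z.1
      refine ⟨_, HasDerivAt.fun_sum fun i _ => HasDerivAt.fun_sum fun j _ =>
        (HasFDerivAt.comp_hasDerivAt (l := fun x => σ x i j)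
          (f := fun s : ℝ => z.1 + s • d) s (hs i j).hasFDerivAt hx).const_mul (-D i j), ?_⟩
      have h1 := hcs (Matrix.of fun i j => fderiv ℝ (fun y => σ y i j) (z.1 + s • d) d)
      have h2 := mul_le_mul_of_nonneg_left (hS (z.1 + s • d) d) (Real.sqrt_nonneg _ : 0 ≤ mnorm D)
      simp only [neg_mul, Finset.sum_neg_distrib]
      exact neg_le_neg (h1.trans h2))
    simp only [zero_smul, one_smul, add_zero, neg_mul, Finset.sum_neg_distrib] at h
    simp only [mul_sub, Finset.sum_sub_distrib]
    linarith
  have hcl : IsClosed {z : E N × E N | ∑ i, ∑ j, D i j * (σ (z.1 + d) i j - σ z.1 i j)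
      ≤ mnorm D * (Sg * ‖d‖)} := by
    refine isClosed_le ?_ (by fun_prop)
    have h2 : ∀ i j, Continuous fun z : E N × E N => σ (z.1 + d) i j := fun i j =>
      (hσc i j).comp (by fun_prop)
    have h3 : ∀ i j, Continuous fun z : E N × E N => σ z.1 i j := fun i j =>
      (hσc i j).comp (by fun_prop)
    fun_prop
  have h1 : (y, (0 : E N)) ∈ closure _ := MeasureTheory.Measure.dense_of_ae hae (y, (0 : E N))
  have h2 : ∑ i, ∑ j, D i j * (σ (y + d) i j - σ y i j) ≤ mnorm D * (Sg * ‖d‖) :=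
    (hcl.closure_eq ▸ h1 :)
  have h3 : mnorm D ^ 2 ≤ mnorm D * (Sg * ‖d‖) := by
    rw [mnorm_sq]
    convert h2 using 4
    rw [sq, hd, add_sub_cancel, hD]; rfl
  have h4 : 0 ≤ mnorm D := Real.sqrt_nonneg _
  rcases h4.eq_or_lt with h | h
  · rw [← h]; positivity
  · exact le_of_mul_le_mul_left (by rw [← sq]; exact h3) h

lemma mnorm_smul (a : ℝ) (M : Matrix (Fin N) (Fin N) ℝ) : mnorm (a • M) = |a| * mnorm M := by
  unfold mnorm
  simp only [Matrix.smul_apply, smul_eq_mul, mul_pow, ← Finset.mul_sum]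
  rw [Real.sqrt_mul (sq_nonneg a), Real.sqrt_sq_eq_abs]

lemma mnorm_bd {M : Matrix (Fin N) (Fin N) ℝ} {B : ℝ} (hB : 0 ≤ B) (h : ∀ i j, |M i j| ≤ B) :
    mnorm M ≤ N * B := by
  refine Real.sqrt_le_iff.2 ⟨by positivity, ?_⟩
  have := mnorm_lip (S := M) (T := 0) (c := B) (by simpa using h)
  rw [sub_zero, mnorm_sq] at this
  rw [mul_pow]; exact this

lemma sup_ball {D : E N → Matrix (Fin N) (Fin N) ℝ} (hD : ∀ (c : ℝ) w, D (c • w) = c • D w)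
    {s : ℝ} (h : ∀ w : E N, ‖w‖ ≤ 1 → mnorm (D w) ≤ s) (w : E N) : mnorm (D w) ≤ s * ‖w‖ := by
  rcases eq_or_ne w 0 with rfl | hw
  · have : D 0 = 0 := by simpa using hD 0 0
    rw [this]; simp [mnorm]
  · have hn : ‖w‖ ≠ 0 := norm_ne_zero_iff.2 hw
    have e : w = ‖w‖ • (‖w‖⁻¹ • w) := by rw [smul_smul, mul_inv_cancel₀ hn, one_smul]
    conv_lhs => rw [e]
    rw [hD, mnorm_smul, abs_of_nonneg (norm_nonneg w), mul_comm]
    refine mul_le_mul_of_nonneg_right (h _ ?_) (norm_nonneg w)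
    rw [norm_smul, norm_inv, norm_norm, inv_mul_cancel₀ hn]

lemma PATH {σ : E N → Matrix (Fin N) (Fin N) ℝ} {H : E N → E N → ℝ} {C L₁ : ℝ} (hC : 0 ≤ C)
    (hσb : ∀ x i j, |σ x i j| ≤ C)
    (hσl : ∀ i j, LipschitzWith C.toNNReal fun x => σ x i j)
    (hH : ∀ R > (0:ℝ), ∃ CR > (0:ℝ), ∀ (x y p q : E N),
      ‖p‖ ≤ R → ‖q‖ ≤ R → |H x p - H y q| ≤ CR * (‖x - y‖ + ‖p - q‖))
    (hL₁ : 1 ≤ L₁)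
    (hBS : ∀ᵐ z : E N × E N ∂MeasureTheory.volume, L₁ ≤ ‖z.2‖ →
      0 ≤ L₁ * ((fderiv ℝ (fun p => H z.1 p) z.2) z.2 - H z.1 z.2
            - (⨆ w : Metric.closedBall (0 : E N) 1,
                mnorm ((2:ℝ) • (σ z.1 * Matrix.of fun i j =>
                  fderiv ℝ (fun y => σ y j i) z.1 (w : E N)))) * ‖z.2‖
            - (⨆ y : E N, |H y 0|))
          - ‖fderiv ℝ (fun y => H y z.2) z.1‖
          - (N : ℝ) * (⨆ w : E N × Metric.closedBall (0 : E N) 1,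
              mnorm (Matrix.of fun i j =>
                fderiv ℝ (fun y => σ y i j) w.1 (w.2 : E N)))^2 * ‖z.2‖)
    {k k0 r r' : ℝ} (hr : 0 ≤ r) (hk0 : 0 ≤ k0) (hk : k + k0 ≤ ⨆ y : E N, |H y 0|) {x y p : E N}
    (hp : L₁ ≤ ‖p‖) (hd : ‖p‖ * ‖x - y‖ ≤ r' - r) (hxy : x ≠ y) :
    ‖p‖ / ‖x - y‖ * mnorm (σ x - σ y) ^ 2 + k0 * Real.exp (-r') * (r' - r)
        ≤ FL σ H k x r' p - FL σ H k y r p := by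
  have hfd : ∀ i j x (w : E N), |fderiv ℝ (fun y => σ y i j) x w| ≤ C * ‖w‖ := fun i j x w => by
    refine ((fderiv ℝ (fun y => σ y i j) x).le_opNorm w).trans ?_
    have := norm_fderiv_le_of_lipschitz ℝ (hσl i j) (x₀ := x)
    rw [Real.coe_toNNReal _ hC] at this
    gcongr
  have hfd1 : ∀ i j x (w : Metric.closedBall (0 : E N) 1),
      |fderiv ℝ (fun y => σ y i j) x (w : E N)| ≤ C := fun i j x w => by
    refine (hfd i j x w).trans ?_
    have := mem_closedBall_zero_iff.1 w.2
    nlinarith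
  have hb1 : ∀ x, BddAbove (Set.range fun w : Metric.closedBall (0 : E N) 1 =>
      mnorm ((2:ℝ) • (σ x * Matrix.of fun i j => fderiv ℝ (fun y => σ y j i) x (w : E N)))) := by
    intro x
    refine ⟨N * (2 * (N * (C * C))), ?_⟩
    rintro _ ⟨w, rfl⟩
    refine mnorm_bd (by positivity) fun i j => ?_
    rw [Matrix.smul_apply, smul_eq_mul, abs_mul, abs_two, Matrix.mul_apply]
    gcongr
    refine (Finset.abs_sum_le_sum_abs _ _).trans ?_
    refine (Finset.sum_le_card_nsmul _ _ (C * C) fun l _ => ?_).trans (by simp)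
    rw [abs_mul]
    exact mul_le_mul (hσb _ _ _) (hfd1 _ _ _ _) (abs_nonneg _) hC
  have hb2 : BddAbove (Set.range fun w : E N × Metric.closedBall (0 : E N) 1 =>
      mnorm (Matrix.of fun i j => fderiv ℝ (fun y => σ y i j) w.1 (w.2 : E N))) := by
    refine ⟨N * C, ?_⟩
    rintro _ ⟨w, rfl⟩
    exact mnorm_bd hC fun i j => hfd1 _ _ _ _
  set Sg := ⨆ w : E N × Metric.closedBall (0 : E N) 1,
    mnorm (Matrix.of fun i j => fderiv ℝ (fun y => σ y i j) w.1 (w.2 : E N)) with hSg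
  have hSg0 : 0 ≤ Sg := Real.iSup_nonneg fun _ => Real.sqrt_nonneg _
  have h1 := pathB (S := fun x => ⨆ w : Metric.closedBall (0 : E N) 1,
      mnorm ((2:ℝ) • (σ x * Matrix.of fun i j => fderiv ℝ (fun y => σ y j i) x (w : E N))))
      hσl hH hL₁ ?_ (fun x => Real.iSup_nonneg fun _ => Real.sqrt_nonneg _) hBS hr hk0 hk hp hd
  · have h2 := mnorm_path hSg0 hσl (fun x w => sup_ball
      (D := fun w => Matrix.of fun i j => fderiv ℝ (fun y => σ y i j) x w)
      (fun c w => by ext i j; simp) (s := Sg)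
      (fun w hw => le_ciSup hb2 (x, ⟨w, mem_closedBall_zero_iff.2 hw⟩)) w) x y
    refine le_trans (add_le_add ?_ le_rfl) h1
    have hxy' : 0 < ‖x - y‖ := norm_pos_iff.2 (sub_ne_zero.2 hxy)
    have hN : (1:ℝ) ≤ N := by
      rcases Nat.eq_zero_or_pos N with h | h
      · subst h; exact absurd (Subsingleton.elim x y) hxy
      · exact_mod_cast h
    have h3 : mnorm (σ x - σ y) ^ 2 ≤ (Sg * ‖x - y‖) ^ 2 := by
      have : 0 ≤ mnorm (σ x - σ y) := Real.sqrt_nonneg _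
      gcongr
    calc ‖p‖ / ‖x - y‖ * mnorm (σ x - σ y) ^ 2 ≤ ‖p‖ / ‖x - y‖ * (Sg * ‖x - y‖) ^ 2 := by gcongr
      _ = 1 * Sg ^ 2 * ‖p‖ * ‖x - y‖ := by field_simp
      _ ≤ _ := by gcongr
  · intro x w
    exact sup_ball (D := fun w => (2:ℝ) • (σ x * Matrix.of fun i j => fderiv ℝ (fun y => σ y j i) x w))
      (fun c w => by
        rw [smul_comm c, ← Matrix.mul_smul (σ x) c]
        exact congrArg (fun M => (2:ℝ) • (σ x * M)) (by ext i j; simp))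
      (fun w hw => le_ciSup (hb1 x) ⟨w, mem_closedBall_zero_iff.2 hw⟩) w

/-- quadratic polynomials -/
def QP (a : ℝ) (p : E N) (X : Matrix (Fin N) (Fin N) ℝ) (c : ℝ) (h : E N) (τ : ℝ) : ℝ :=
  a * τ + ⟪p, h⟫ + 1 / 2 * qf X h + c * τ ^ 2

/-- matrix times vector -/
def mv (X : Matrix (Fin N) (Fin N) ℝ) (h : E N) : E N := WithLp.toLp 2 fun i => ∑ j, X i j * h j

lemma mv_cont (X : Matrix (Fin N) (Fin N) ℝ) : Continuous (mv X) := by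
  unfold mv; fun_prop

lemma qf_cont (X : Matrix (Fin N) (Fin N) ℝ) : Continuous (qf X) := by
  unfold qf; fun_prop

lemma QP_cont (a : ℝ) (p : E N) (X : Matrix (Fin N) (Fin N) ℝ) (c : ℝ) :
    Continuous fun z : E N × ℝ => QP a p X c z.1 z.2 := by
  have := qf_cont X
  unfold QP; fun_prop

lemma UJ_iff {u : E N → ℝ → ℝ} {x t a p X c} : UJ u x t a p X c ↔
    ∀ᶠ q : E N × ℝ in 𝓝 (x, t), u q.1 q.2 ≤ u x t + QP a p X c (q.1 - x) (q.2 - t) := by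
  unfold UJ QP
  simp only [add_assoc]

lemma qf_shift {X : Matrix (Fin N) (Fin N) ℝ} (hX : X.IsSymm) (h k : E N) :
    qf X (h + k) = qf X h + 2 * ⟪mv X h, k⟫ + qf X k := by
  have e1 : ⟪mv X h, k⟫ = ∑ i, ∑ j, X i j * h j * k i := by
    simp only [mv, PiLp.inner_apply, RCLike.inner_apply, conj_trivial]
    refine Finset.sum_congr rfl fun i _ => ?_
    rw [mul_comm, Finset.sum_mul]
  have e2 : ⟪mv X h, k⟫ = ∑ i, ∑ j, X i j * k j * h i := by
    rw [e1, Finset.sum_comm]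
    refine Finset.sum_congr rfl fun i _ => Finset.sum_congr rfl fun j _ => ?_
    rw [hX.apply]; ring
  rw [two_mul]; nth_rewrite 1 [e1]; rw [e2]
  simp only [qf, ← Finset.sum_add_distrib]
  refine Finset.sum_congr rfl fun i _ => Finset.sum_congr rfl fun j _ => ?_
  simp only [PiLp.add_apply]; ring

lemma QP_shift {X : Matrix (Fin N) (Fin N) ℝ} (hX : X.IsSymm) (a : ℝ) (p : E N) (c : ℝ)
    (h k : E N) (τ s : ℝ) : QP a p X c (h + k) (τ + s) =
      QP a p X c h τ + QP (a + 2 * c * τ) (p + mv X h) X c k s := by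
  unfold QP
  rw [qf_shift hX, inner_add_right, inner_add_left]; ring

lemma lin_quad {α β : ℝ} (h : ∀ᶠ s in 𝓝 (0:ℝ), α * s + β * s ^ 2 ≤ 0) : α = 0 ∧ β ≤ 0 := by
  obtain ⟨r, hr, h⟩ := Metric.eventually_nhds_iff.1 h
  have h' : ∀ s, 0 < s → s < r → α + β * s ≤ 0 ∧ -α + β * s ≤ 0 := by
    intro s hs hsr
    have a1 := h (y := s) (by rw [Real.dist_eq, sub_zero, abs_of_pos hs]; exact hsr)
    have a2 := h (y := -s) (by rw [Real.dist_eq, sub_zero, abs_neg, abs_of_pos hs]; exact hsr)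
    constructor <;> (by_contra hc; push Not at hc; have := mul_pos hc hs; nlinarith)
  have lim : ∀ α' : ℝ, (∀ s, 0 < s → s < r → α' + β * s ≤ 0) → α' ≤ 0 := by
    intro α' hh
    have ht : Tendsto (fun s : ℝ => α' + β * s) (𝓝[>] 0) (𝓝 α') :=
      ((Continuous.tendsto' (by fun_prop) _ _ (by simp)).mono_left nhdsWithin_le_nhds)
    refine le_of_tendsto ht ?_
    filter_upwards [Ioo_mem_nhdsGT hr] with s hs using hh s hs.1 hs.2
  have b1 := lim α fun s a b => (h' s a b).1
  have b2 := lim (-α) fun s a b => (h' s a b).2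
  have e : α = 0 := by linarith
  refine ⟨e, ?_⟩
  have := (h' (r / 2) (by linarith) (by linarith)).1
  rw [e] at this
  by_contra hc; push Not at hc
  have := mul_pos hc (half_pos hr); linarith

lemma jet_cmp {a₁ a₂ : ℝ} {p₁ p₂ : E N} {X₁ X₂ : Matrix (Fin N) (Fin N) ℝ} {c₁ c₂ : ℝ}
    (h : ∀ᶠ z : E N × ℝ in 𝓝 (0, 0), QP a₁ p₁ X₁ c₁ z.1 z.2 ≤ QP a₂ p₂ X₂ c₂ z.1 z.2) :
    a₁ = a₂ ∧ p₁ = p₂ ∧ (∀ k, qf X₁ k ≤ qf X₂ k) := by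
  have q0 : ∀ X : Matrix (Fin N) (Fin N) ℝ, qf X 0 = 0 := fun X => by simp [qf]
  have hs : ∀ (X : Matrix (Fin N) (Fin N) ℝ) (s : ℝ) (k : E N), qf X (s • k) = s ^ 2 * qf X k := by
    intro X s k
    simp only [qf, Finset.mul_sum]
    refine Finset.sum_congr rfl fun i _ => Finset.sum_congr rfl fun j _ => ?_
    simp only [PiLp.smul_apply, smul_eq_mul]; ring
  have hk : ∀ k : E N, ⟪p₁, k⟫ - ⟪p₂, k⟫ = 0 ∧ 1 / 2 * (qf X₁ k - qf X₂ k) ≤ 0 := by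
    intro k
    refine lin_quad ?_
    have ht : Tendsto (fun s : ℝ => ((s • k, 0) : E N × ℝ)) (𝓝 0) (𝓝 (0, 0)) :=
      Continuous.tendsto' (by fun_prop) _ _ (by simp)
    filter_upwards [ht.eventually h] with s h
    simp only [QP, hs, inner_smul_right] at h
    linarith
  have e1 : a₁ - a₂ = 0 := by
    refine (lin_quad (α := a₁ - a₂) (β := c₁ - c₂) ?_).1
    have ht : Tendsto (fun s : ℝ => ((0, s) : E N × ℝ)) (𝓝 0) (𝓝 (0, 0)) :=
      Continuous.tendsto' (by fun_prop) _ _ (by simp)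
    filter_upwards [ht.eventually h] with s h
    simp only [QP, q0, inner_zero_right] at h
    linarith
  refine ⟨by linarith, ext_inner_right ℝ fun k => by linarith [(hk k).1], fun k => by
    linarith [(hk k).2]⟩

lemma trace_mono {X₁ X₂ : Matrix (Fin N) (Fin N) ℝ} (h : ∀ k, qf X₁ k ≤ qf X₂ k)
    (S : Matrix (Fin N) (Fin N) ℝ) :
    Matrix.trace (S * Sᵀ * X₁) ≤ Matrix.trace (S * Sᵀ * X₂) := by
  rw [trace_qf, trace_qf]
  exact Finset.sum_le_sum fun k _ => h _

lemma QP_add (a : ℝ) (p : E N) (X : Matrix (Fin N) (Fin N) ℝ) (c δ : ℝ) (h : E N) (τ : ℝ) :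
    QP a p (X + δ • 1) (c + δ / 2) h τ = QP a p X c h τ + δ / 2 * (‖h‖ ^ 2 + τ ^ 2) := by
  unfold QP; rw [qf_add, qf_smul_one]; ring

lemma symm_add {X : Matrix (Fin N) (Fin N) ℝ} (hX : X.IsSymm) (δ : ℝ) :
    (X + δ • (1 : Matrix (Fin N) (Fin N) ℝ)).IsSymm :=
  hX.add (Matrix.isSymm_one.smul δ)

lemma dist_sq_le (q z : E N × ℝ) : dist q z ^ 2 ≤ ‖q.1 - z.1‖ ^ 2 + (q.2 - z.2) ^ 2 := by
  rw [Prod.dist_eq, dist_eq_norm, Real.dist_eq, ← sq_abs (q.2 - z.2)]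
  rcases max_choice ‖q.1 - z.1‖ |q.2 - z.2| with h | h <;> rw [h] <;> nlinarith [sq_nonneg ‖q.1 - z.1‖, sq_nonneg |q.2 - z.2|]

lemma STAB {u : E N → ℝ → ℝ} {x t a p X c} (hX : X.IsSymm) (hJ : UJ u x t a p X c)
    (W : (E N → ℝ → ℝ) → Prop) {ρ : ℝ} (hρ : 0 < ρ)
    (happ : ∀ δ > (0:ℝ), ∃ w, W w ∧ UpperSemicontinuous (fun q : E N × ℝ => w q.1 q.2) ∧
      (∀ q : E N × ℝ, dist q (x, t) ≤ ρ → w q.1 q.2 ≤ u q.1 q.2 + δ) ∧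
      ∃ z : E N × ℝ, dist z (x, t) < δ ∧ u x t - δ ≤ w z.1 z.2) {δ : ℝ} (hδ : 0 < δ) :
    ∃ w, W w ∧ ∃ x' t' a' p' c', ‖x' - x‖ < δ ∧ |t' - t| < δ ∧ |a' - a| < δ ∧ ‖p' - p‖ < δ ∧
      |w x' t' - u x t| < δ ∧ UJ w x' t' a' p' (X + δ • 1) c' := by
  rw [UJ_iff] at hJ
  obtain ⟨r₀, hr₀, hJ⟩ := Metric.eventually_nhds_iff.1 hJ
  set X' := X + δ • (1 : Matrix (Fin N) (Fin N) ℝ)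
  have hX' : X'.IsSymm := symm_add hX δ
  set c' := c + δ / 2
  set ψ : E N × ℝ → ℝ := fun q => QP a p X' c' (q.1 - x) (q.2 - t)
  have hψ : Continuous ψ := (QP_cont a p X' c').comp
    (g := fun z : E N × ℝ => QP a p X' c' z.1 z.2)
    (f := fun q : E N × ℝ => (q.1 - x, q.2 - t)) (by fun_prop)
  have hψ0 : ψ (x, t) = 0 := by simp [ψ, QP, qf]
  -- closeness radius
  have hcl : ∀ᶠ q : E N × ℝ in 𝓝 (x, t), ‖q.1 - x‖ < δ ∧ |q.2 - t| < δ ∧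
      |a + 2 * c' * (q.2 - t) - a| < δ ∧ ‖p + mv X' (q.1 - x) - p‖ < δ ∧ |ψ q| < δ / 4 := by
    have hm := mv_cont X'
    have k1 : ∀ {f : E N × ℝ → ℝ}, Continuous f → f (x, t) = 0 → ∀ {e : ℝ}, 0 < e →
      ∀ᶠ q in 𝓝 (x, t), f q < e := fun hf h0 e he =>
        (hf.tendsto' _ _ h0).eventually (gt_mem_nhds he)
    refine (k1 (by fun_prop) (by simp) hδ).and <| (k1 (by fun_prop) (by simp) hδ).and <|
      (k1 (by fun_prop) (by simp) hδ).and <| (k1 (f := fun q : E N × ℝ => ‖p + mv X' (q.1 - x) - p‖)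
        ?_ (by simp [mv]; rfl) hδ).and <| k1 (f := fun q => |ψ q|) (by fun_prop) (by simp [hψ0])
        (by linarith)
    exact ((continuous_const.add (hm.comp (by fun_prop))).sub continuous_const).norm
  obtain ⟨r₁, hr₁, hcl⟩ := Metric.eventually_nhds_iff.1 hcl
  set r := min ρ (min (r₀ / 2) (r₁ / 2))
  have hr : 0 < r := by positivity
  have hrρ : r ≤ ρ := min_le_left _ _
  have hrr0 : r < r₀ := lt_of_le_of_lt ((min_le_right _ _).trans (min_le_left _ _)) (by linarith)
  have hrr1 : r < r₁ := lt_of_le_of_lt ((min_le_right _ _).trans (min_le_right _ _)) (by linarith)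
  -- small parameter
  set e := min (δ / 4) (δ / 2 * r ^ 2 / 4) with he
  have hep : 0 < e := by positivity
  have hz : ∀ᶠ q in 𝓝 (x, t), ψ q < e := (hψ.tendsto' _ _ hψ0).eventually (gt_mem_nhds hep)
  obtain ⟨r₂, hr₂, hz⟩ := Metric.eventually_nhds_iff.1 hz
  obtain ⟨w, hW, hw, hle, z, hzd, hzw⟩ := happ (min (min (e / 2) r) r₂) (by positivity)
  set d := min (min (e / 2) r) r₂
  have hde : d ≤ e / 2 := (min_le_left _ _).trans (min_le_left _ _)
  have hdr : d ≤ r := (min_le_left _ _).trans (min_le_right _ _)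
  have hdr2 : d ≤ r₂ := min_le_right _ _
  have husc : UpperSemicontinuousOn (fun q : E N × ℝ => w q.1 q.2 - ψ q)
      (Metric.closedBall (x, t) r) := by
    have := (hw.add hψ.neg.upperSemicontinuous).upperSemicontinuousOn (s := Metric.closedBall (x, t) r)
    simpa [sub_eq_add_neg] using this
  obtain ⟨q, hq, hmax⟩ := husc.exists_isMaxOn ⟨(x, t), by simp [hr.le]⟩ (isCompact_closedBall _ _)
  have hmax : ∀ q' : E N × ℝ, dist q' (x, t) ≤ r → w q'.1 q'.2 - ψ q' ≤ w q.1 q.2 - ψ q :=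
    fun q' h => hmax (Metric.mem_closedBall.2 h)
  have hqd : dist q (x, t) ≤ r := hq
  have m1 := hmax z (by linarith)
  have m2 := hz (lt_of_lt_of_le hzd hdr2)
  have m3 := hle q (by linarith)
  have m4 := hJ (lt_of_le_of_lt hqd hrr0)
  have m5 : ψ q = QP a p X c (q.1 - x) (q.2 - t) + δ / 2 * (‖q.1 - x‖ ^ 2 + (q.2 - t) ^ 2) :=
    QP_add _ _ _ _ _ _ _
  have m6 := dist_sq_le q (x, t)
  simp only at m6
  have m7 : δ / 2 * dist q (x, t) ^ 2 ≤ δ / 2 * (‖q.1 - x‖ ^ 2 + (q.2 - t) ^ 2) := by gcongr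
  have m8 : δ / 2 * dist q (x, t) ^ 2 ≤ δ / 2 * r ^ 2 / 2 := by
    have : e ≤ δ / 2 * r ^ 2 / 4 := min_le_right _ _
    linarith
  have hlt : dist q (x, t) < r := by
    by_contra hc; push Not at hc
    have e1 : dist q (x, t) = r := le_antisymm hqd hc
    rw [e1] at m8
    have : 0 < δ / 2 * r ^ 2 := by positivity
    linarith
  obtain ⟨n1, n2, n3, n4, n5⟩ := hcl (lt_trans hlt hrr1)
  have he4 : e ≤ δ / 4 := min_le_left _ _
  refine ⟨w, hW, q.1, q.2, _, _, c', n1, n2, n3, n4, ?_, ?_⟩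
  · rw [abs_lt] at n5 ⊢
    have : 0 ≤ δ / 2 * dist q (x, t) ^ 2 := by positivity
    constructor <;> linarith [n5.1, n5.2]
  · rw [UJ_iff]
    have : ∀ᶠ q' in 𝓝 (q.1, q.2), dist q' (x, t) < r :=
      Metric.isOpen_ball.eventually_mem (by exact hlt)
    filter_upwards [this] with q' hq'
    have h1 := hmax q' hq'.le
    have h2 : ψ q' = ψ q + QP (a + 2 * c' * (q.2 - t)) (p + mv X' (q.1 - x)) X' c' (q'.1 - q.1)
        (q'.2 - q.2) := by
      rw [← QP_shift hX']; simp only [ψ]; congr 1 <;> abel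
    linarith

lemma opclose {σ : Θ → E N → Matrix (Fin N) (Fin N) ℝ} {F : Θ → E N → ℝ → E N → ℝ} {C : ℝ}
    (hC : 0 ≤ C) (hσb : ∀ θ x i j, |σ θ x i j| ≤ C)
    (hσl : ∀ θ x y i j, |σ θ x i j - σ θ y i j| ≤ C * ‖x - y‖) (hF : EquiC F)
    (x : E N) (r : ℝ) (p : E N) (a : ℝ) (X : Matrix (Fin N) (Fin N) ℝ) {κ : ℝ} (hκ : 0 < κ) :
    ∃ δ > (0:ℝ), ∀ θ x' r' p' a' d, ‖x' - x‖ ≤ δ → |r' - r| ≤ δ → ‖p' - p‖ ≤ δ → |a' - a| ≤ δ →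
      |d| ≤ δ → |(a' - Matrix.trace (σ θ x' * (σ θ x')ᵀ * (X + d • 1)) + F θ x' r' p') -
        (a - Matrix.trace (σ θ x * (σ θ x)ᵀ * X) + F θ x r p)| ≤ κ := by
  obtain ⟨δ₀, hδ₀, hF⟩ := hF x r p (κ / 4) (by linarith)
  set D := ∑ i, ∑ j, |X i j| with hD
  have hD0 : 0 ≤ D := by positivity
  set B := N * (D * (2 * C * C)) + N ^ 2 * C ^ 2 + 1 with hB
  have hB1 : 1 ≤ B := by have : 0 ≤ N * (D * (2 * C * C)) + N ^ 2 * C ^ 2 := by positivity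
                         linarith
  refine ⟨min δ₀ (κ / (4 * B)), by positivity, fun θ x' r' p' a' d hx hr hp ha hd => ?_⟩
  have f1 := hF θ x' r' p' (hx.trans (min_le_left _ _)) (hr.trans (min_le_left _ _))
    (hp.trans (min_le_left _ _))
  set δ := min δ₀ (κ / (4 * B))
  have hδ0 : 0 ≤ δ := by positivity
  have hδB : δ * B ≤ κ / 4 := by
    have : δ ≤ κ / (4 * B) := min_le_right _ _
    rw [le_div_iff₀ (by linarith)] at this; linarith
  have g1 : |Matrix.trace (σ θ x' * (σ θ x')ᵀ * X) - Matrix.trace (σ θ x * (σ θ x)ᵀ * X)|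
      ≤ N * (D * (2 * C * C)) * δ := by
    have e1 : ∀ k, |qf X (colv (σ θ x') k) - qf X (colv (σ θ x) k)| ≤ D * (2 * C * C) * δ := by
      intro k
      simp only [qf, colv, ← Finset.sum_sub_distrib, hD, Finset.sum_mul]
      refine (Finset.abs_sum_le_sum_abs _ _).trans (Finset.sum_le_sum fun i _ =>
        (Finset.abs_sum_le_sum_abs _ _).trans (Finset.sum_le_sum fun j _ => ?_))
      have h1 := hσb θ x' i k
      have h2 := hσb θ x j k
      have hl : ∀ i, |σ θ x' i k - σ θ x i k| ≤ C * δ := fun i => (hσl θ x' x i k).trans (by gcongr)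
      have : X i j * σ θ x' i k * σ θ x' j k - X i j * σ θ x i k * σ θ x j k
        = X i j * (σ θ x' i k * (σ θ x' j k - σ θ x j k) + (σ θ x' i k - σ θ x i k) * σ θ x j k) := by
        ring
      rw [this, abs_mul, mul_assoc, mul_assoc]
      refine mul_le_mul_of_nonneg_left ((abs_add_le _ _).trans ?_) (abs_nonneg _)
      rw [abs_mul, abs_mul]
      have := mul_le_mul h1 (hl j) (abs_nonneg _) hC
      have := mul_le_mul (hl i) h2 (abs_nonneg _) (by positivity)
      linarith
    rw [trace_qf, trace_qf, ← Finset.sum_sub_distrib]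
    refine (Finset.abs_sum_le_sum_abs _ _).trans ((Finset.sum_le_sum fun k _ => e1 k).trans ?_)
    simp; linarith
  have g2 : |Matrix.trace (σ θ x' * (σ θ x')ᵀ * (d • 1))| ≤ N ^ 2 * C ^ 2 * δ := by
    rw [trace_qf]
    simp only [qf_smul_one, ← Finset.mul_sum, abs_mul]
    have h1 := col_bd (hσb θ x')
    rw [abs_of_nonneg (a := ∑ i, ‖colv (σ θ x') i‖ ^ 2) (by positivity), mul_comm]
    exact mul_le_mul h1 hd (abs_nonneg _) (by positivity)
  rw [Matrix.mul_add, Matrix.trace_add]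
  have hb : (N * (D * (2 * C * C)) + N ^ 2 * C ^ 2 + 1) * δ ≤ κ / 4 := by rw [← hB]; linarith
  rw [abs_le] at *
  constructor <;> linarith [f1.1, f1.2, g1.1, g1.2, g2.1, g2.2, ha.1, ha.2]

/-- subsolutions on a set of times -/
def SubO (O : Set ℝ) (σ : Θ → E N → Matrix (Fin N) (Fin N) ℝ) (F : Θ → E N → ℝ → E N → ℝ)
    (u : E N → ℝ → ℝ) : Prop :=
  ∀ θ x t a p X c, t ∈ O → X.IsSymm → UJ u x t a p X c →
    a - Matrix.trace (σ θ x * (σ θ x)ᵀ * X) + F θ x (u x t) p ≤ 0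

/-- supersolutions on a set of times -/
def SupO (O : Set ℝ) (σ : Θ → E N → Matrix (Fin N) (Fin N) ℝ) (F : Θ → E N → ℝ → E N → ℝ)
    (u : E N → ℝ → ℝ) : Prop :=
  ∀ x t a p X c, t ∈ O → X.IsSymm → UJ (fun x t => -u x t) x t (-a) (-p) (-X) (-c) →
    ∀ κ > (0:ℝ), ∃ θ, -κ ≤ a - Matrix.trace (σ θ x * (σ θ x)ᵀ * X) + F θ x (u x t) p

/-- upper semicontinuous envelope -/
def env (u : E N → ℝ → ℝ) (x : E N) (t : ℝ) : ℝ :=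
  sInf {b | ∀ᶠ q : E N × ℝ in 𝓝 (x, t), u q.1 q.2 ≤ b}

/-- continuity of curried functions -/
abbrev CC (f : E N → ℝ → ℝ) : Prop := Continuous fun q : E N × ℝ => f q.1 q.2

/-- upper semicontinuity of curried functions -/
abbrev USC (f : E N → ℝ → ℝ) : Prop := UpperSemicontinuous fun q : E N × ℝ => f q.1 q.2

lemma env_le {u : E N → ℝ → ℝ} {x t b} (h : ∀ᶠ q : E N × ℝ in 𝓝 (x, t), u q.1 q.2 ≤ b) :
    env u x t ≤ b :=
  csInf_le ⟨u x t, fun _ hb => Eventually.self_of_nhds (p := fun q : E N × ℝ => u q.1 q.2 ≤ _) hb⟩ h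

lemma env_lt {u f : E N → ℝ → ℝ} (hf : CC f) (h : ∀ x t, u x t ≤ f x t) {x t b}
    (hb : env u x t < b) : ∀ᶠ q : E N × ℝ in 𝓝 (x, t), u q.1 q.2 < b := by
  have hne : {b | ∀ᶠ q : E N × ℝ in 𝓝 (x, t), u q.1 q.2 ≤ b}.Nonempty := by
    refine ⟨f x t + 1, ?_⟩
    have : ∀ᶠ q : E N × ℝ in 𝓝 (x, t), f q.1 q.2 < f x t + 1 :=
      hf.continuousAt.eventually (gt_mem_nhds (by simp))
    filter_upwards [this] with q hq
    exact (h _ _).trans hq.le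
  obtain ⟨b', hb', hlt⟩ := exists_lt_of_csInf_lt hne hb
  filter_upwards [hb'] with q hq using hq.trans_lt hlt

lemma le_env {u f : E N → ℝ → ℝ} (hf : CC f) (h : ∀ x t, u x t ≤ f x t) (x : E N) (t : ℝ) :
    u x t ≤ env u x t := by
  by_contra hc; push Not at hc
  exact lt_irrefl _ (env_lt hf h hc).self_of_nhds

lemma env_usc {u f : E N → ℝ → ℝ} (hf : CC f) (h : ∀ x t, u x t ≤ f x t) : USC (env u) := by
  intro q b hb
  obtain ⟨b', h1, h2⟩ := exists_between hb
  have := (env_lt (x := q.1) (t := q.2) hf h h1).eventually_nhds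
  filter_upwards [this] with q' hq'
  exact (env_le (hq'.mono fun _ h => h.le)).trans_lt h2

lemma env_le_of {u f : E N → ℝ → ℝ} (hf : CC f) (h : ∀ x t, u x t ≤ f x t) (x : E N) (t : ℝ) :
    env u x t ≤ f x t := by
  refine le_of_forall_pos_le_add fun e he => env_le ?_
  have : ∀ᶠ q : E N × ℝ in 𝓝 (x, t), f q.1 q.2 < f x t + e :=
    hf.continuousAt.eventually (gt_mem_nhds (by simpa using he))
  filter_upwards [this] with q hq using (h _ _).trans hq.le

lemma UJ_touch {u w : E N → ℝ → ℝ} {x t a p X c} (h : UJ w x t a p X c)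
    (hle : ∀ y s, u y s ≤ w y s) (he : u x t = w x t) : UJ u x t a p X c := by
  rw [UJ_iff] at *
  filter_upwards [h] with q hq
  rw [he]; exact (hle _ _).trans hq

lemma QP_neg (a : ℝ) (p : E N) (X : Matrix (Fin N) (Fin N) ℝ) (c : ℝ) (h : E N) (τ : ℝ) :
    QP (-a) (-p) (-X) (-c) h τ = -QP a p X c h τ := by
  unfold QP; rw [qf_neg, inner_neg_left]; ring

lemma UJ_shift {w : E N → ℝ → ℝ} {k s x t a p X c}
    (h : UJ (fun x t => w (x + k) (t + s)) x t a p X c) : UJ w (x + k) (t + s) a p X c := by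
  rw [UJ_iff] at *
  have ht : Tendsto (fun q : E N × ℝ => (q.1 - k, q.2 - s)) (𝓝 (x + k, t + s)) (𝓝 (x, t)) :=
    Continuous.tendsto' (by fun_prop) _ _ (by simp)
  filter_upwards [ht.eventually h] with q hq
  simp only [sub_add_cancel] at hq
  rwa [sub_sub, sub_sub, add_comm k, add_comm s] at hq

lemma env_shift (u : E N → ℝ → ℝ) (k : E N) (s : ℝ) (x : E N) (t : ℝ) :
    env (fun x t => u (x + k) (t + s)) x t = env u (x + k) (t + s) := by
  unfold env
  congr 1; ext b
  have h1 : Tendsto (fun q : E N × ℝ => (q.1 - k, q.2 - s)) (𝓝 (x + k, t + s)) (𝓝 (x, t)) :=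
    Continuous.tendsto' (by fun_prop) _ _ (by simp)
  have h2 : Tendsto (fun q : E N × ℝ => (q.1 + k, q.2 + s)) (𝓝 (x, t)) (𝓝 (x + k, t + s)) :=
    Continuous.tendsto' (by fun_prop) _ _ (by simp)
  constructor
  · intro h
    exact (h1.eventually h).mono fun q hq => by simpa using hq
  · intro h
    exact h2.eventually h

/-- Perron class -/
def InS (O : Set ℝ) (σ : Θ → E N → Matrix (Fin N) (Fin N) ℝ) (F : Θ → E N → ℝ → E N → ℝ)
    (g f w : E N → ℝ → ℝ) : Prop :=
  USC w ∧ SubO O σ F w ∧ ∀ x t, g x t ≤ w x t ∧ w x t ≤ f x t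

section perron
variable {σ : Θ → E N → Matrix (Fin N) (Fin N) ℝ} {F : Θ → E N → ℝ → E N → ℝ} {C : ℝ}
  {O : Set ℝ} {f g : E N → ℝ → ℝ}

lemma perron_max (hC : 0 ≤ C) (hσb : ∀ θ x i j, |σ θ x i j| ≤ C)
    (hσl : ∀ θ x y i j, |σ θ x i j - σ θ y i j| ≤ C * ‖x - y‖) (hF : EquiC F) (hO : IsOpen O)
    (hf : CC f) (hg : CC g) (hgs : SubO O σ F g) (hgf : ∀ x t, g x t ≤ f x t) :
    ∃ u, InS O σ F g f u ∧ ∀ w, InS O σ F g f w → ∀ x t, w x t ≤ u x t := by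
  have hgS : InS O σ F g f g := ⟨hg.upperSemicontinuous, hgs, fun x t => ⟨le_rfl, hgf x t⟩⟩
  set u₀ : E N → ℝ → ℝ := fun x t => sSup {b | ∃ w, InS O σ F g f w ∧ b = w x t}
  have hle : ∀ w, InS O σ F g f w → ∀ x t, w x t ≤ u₀ x t := fun w hw x t =>
    le_csSup ⟨f x t, by rintro b ⟨w', hw', rfl⟩; exact (hw'.2.2 x t).2⟩ ⟨w, hw, rfl⟩
  have hne : ∀ x t, {b | ∃ w, InS O σ F g f w ∧ b = w x t}.Nonempty := fun x t => ⟨_, g, hgS, rfl⟩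
  have h0f : ∀ x t, u₀ x t ≤ f x t := fun x t =>
    csSup_le (hne x t) (by rintro b ⟨w', hw', rfl⟩; exact (hw'.2.2 x t).2)
  have hle' : ∀ w, InS O σ F g f w → ∀ x t, w x t ≤ env u₀ x t := fun w hw x t =>
    (hle w hw x t).trans (le_env hf h0f x t)
  refine ⟨env u₀, ⟨env_usc hf h0f, ?_, fun x t => ⟨hle' g hgS x t, env_le_of hf h0f x t⟩⟩, hle'⟩
  intro θ x t a p X c ht hX hJ
  refine le_of_forall_pos_le_add fun κ hκ => ?_
  obtain ⟨δ, hδ, hop⟩ := opclose hC hσb hσl hF x (env u₀ x t) p a X hκ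
  obtain ⟨r, hr, hOr⟩ := Metric.isOpen_iff.1 hO t ht
  obtain ⟨w, hw, x', t', a', p', c', h1, h2, h3, h4, h5, h6⟩ := STAB hX hJ (InS O σ F g f)
    one_pos (fun e he => by
      have : ∃ᶠ q : E N × ℝ in 𝓝 (x, t), env u₀ x t - e < u₀ q.1 q.2 := by
        intro hc
        have := env_le (u := u₀) (x := x) (t := t) (b := env u₀ x t - e)
          (hc.mono fun q hq => not_lt.1 hq)
        linarith
      obtain ⟨z, hz1, hz2⟩ := (this.and_eventually (Metric.ball_mem_nhds (x, t) he)).exists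
      obtain ⟨_, ⟨w, hw, rfl⟩, hzw⟩ := exists_lt_of_lt_csSup (hne z.1 z.2) hz1
      exact ⟨w, hw, hw.1, fun q _ => (hle' w hw q.1 q.2).trans (by linarith), z, hz2, hzw.le⟩)
    (lt_min hδ hr)
  have hm := min_le_left δ r
  have hsub := hw.2.1 θ x' t' a' p' _ c'
    (hOr (by rw [Metric.mem_ball, Real.dist_eq]; exact h2.trans_le (min_le_right _ _)))
    (symm_add hX _) h6
  have := hop θ x' (w x' t') p' a' (min δ r) (h1.le.trans hm) (h5.le.trans hm) (h4.le.trans hm)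
    (h3.le.trans hm) (by rw [abs_of_pos (lt_min hδ hr)]; exact hm)
  rw [abs_le] at this
  linarith [this.1]

lemma perron_sup (hC : 0 ≤ C) (hσb : ∀ θ x i j, |σ θ x i j| ≤ C)
    (hσl : ∀ θ x y i j, |σ θ x i j - σ θ y i j| ≤ C * ‖x - y‖) (hF : EquiC F)
    (hf : CC f) (hg : CC g) (hfs : SupO O σ F f) {u : E N → ℝ → ℝ}
    (hu : InS O σ F g f u) (hmax : ∀ w, InS O σ F g f w → ∀ x t, w x t ≤ u x t) :
    SupO O σ F fun x t => -env (fun x t => -u x t) x t := by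
  set V := env fun x t => -u x t with hV
  have hng : CC fun x t => -g x t := hg.neg
  have hub : ∀ x t, -u x t ≤ -g x t := fun x t => neg_le_neg (hu.2.2 x t).1
  have huV : ∀ x t, -u x t ≤ V x t := le_env hng hub
  intro x t a p X c ht hX hJ κ hκ
  simp only [neg_neg] at hJ
  by_contra hcon; push Not at hcon
  have hVf : ∀ x t, -f x t ≤ V x t := fun x t => (neg_le_neg (hu.2.2 x t).2).trans (huV x t)
  rcases eq_or_lt_of_le (hVf x t) with he | hlt
  · have := hfs x t a p X c ht hX (UJ_touch hJ hVf he) κ hκ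
    obtain ⟨θ, hθ⟩ := this
    have := hcon θ
    rw [← he, neg_neg] at this
    linarith
  set U₀ := -V x t with hU₀
  obtain ⟨δ, hδ, hop⟩ := opclose hC hσb hσl hF x U₀ p a X hκ
  set X' := X + (-δ) • (1 : Matrix (Fin N) (Fin N) ℝ) with hX'd
  have hX' : X'.IsSymm := symm_add hX _
  set c' := c + (-δ) / 2 with hc'
  set e₀ := (f x t - U₀) / 2 with he₀
  have he₀p : 0 < e₀ := by linarith
  set ψ : E N × ℝ → ℝ := fun q => QP a p X' c' (q.1 - x) (q.2 - t)
  have hψ : Continuous ψ := (QP_cont a p X' c').comp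
    (g := fun z : E N × ℝ => QP a p X' c' z.1 z.2)
    (f := fun q : E N × ℝ => (q.1 - x, q.2 - t)) (by fun_prop)
  have hψ0 : ψ (x, t) = 0 := by simp [ψ, QP, qf]
  have hcl : ∀ᶠ q : E N × ℝ in 𝓝 (x, t), ‖q.1 - x‖ < δ ∧ |a + 2 * c' * (q.2 - t) - a| < δ ∧
      ‖p + mv X' (q.1 - x) - p‖ < δ ∧ |ψ q| < δ / 2 ∧ U₀ + ψ q - f q.1 q.2 + e₀ < 0 := by
    have hm := mv_cont X'
    have k1 : ∀ {f : E N × ℝ → ℝ}, Continuous f → ∀ {e : ℝ}, f (x, t) < e →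
      ∀ᶠ q in 𝓝 (x, t), f q < e := fun hf e he =>
        hf.continuousAt.eventually (gt_mem_nhds he)
    refine (k1 (by fun_prop) (by simpa using hδ)).and <|
      (k1 (by fun_prop) (by simpa using hδ)).and <|
      (k1 (f := fun q : E N × ℝ => ‖p + mv X' (q.1 - x) - p‖) ?_ ?_).and <|
      (k1 (f := fun q => |ψ q|) (by fun_prop) (by simp [hψ0, hδ])).and <|
      k1 (f := fun q => U₀ + ψ q - f q.1 q.2 + e₀) ?_ (by simp only [hψ0]; linarith)
    · exact ((continuous_const.add (hm.comp (by fun_prop))).sub continuous_const).norm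
    · have : mv X' 0 = 0 := by simp [mv]; rfl
      simpa [this] using hδ
    · exact ((continuous_const.add hψ).sub hf).add continuous_const
  rw [UJ_iff] at hJ
  obtain ⟨r, hr, hcl⟩ := Metric.eventually_nhds_iff.1 (hcl.and hJ)
  set η := min (min (δ / 2) e₀) (δ / 2 * (r / 2) ^ 2) with hη
  have hηp : 0 < η := by positivity
  have hη1 : η ≤ δ / 2 := (min_le_left _ _).trans (min_le_left _ _)
  have hη2 : η ≤ e₀ := (min_le_left _ _).trans (min_le_right _ _)
  have hη3 : η ≤ δ / 2 * (r / 2) ^ 2 := min_le_right _ _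
  set φ : E N × ℝ → ℝ := fun q => U₀ + ψ q + η with hφ
  have hφc : Continuous φ := by fun_prop
  have hann : ∀ q : E N × ℝ, r / 2 < dist q (x, t) → dist q (x, t) < r → φ q < u q.1 q.2 := by
    intro q h1 h2
    have b1 := (hcl h2).2
    rw [QP_neg] at b1
    have b2 : ψ q = QP a p X c (q.1 - x) (q.2 - t) + -δ / 2 * (‖q.1 - x‖ ^ 2 + (q.2 - t) ^ 2) :=
      QP_add _ _ _ _ _ _ _
    have b3 := dist_sq_le q (x, t)
    have b4 : δ / 2 * dist q (x, t) ^ 2 ≤ δ / 2 * (‖q.1 - x‖ ^ 2 + (q.2 - t) ^ 2) := by gcongr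
    have b5 : δ / 2 * (r / 2) ^ 2 < δ / 2 * dist q (x, t) ^ 2 := by gcongr
    have b6 := huV q.1 q.2
    simp only [hφ]; linarith
  set w : E N → ℝ → ℝ := fun y s =>
    if dist (y, s) (x, t) < r then max (u y s) (φ (y, s)) else u y s with hw
  have huw : ∀ y s, u y s ≤ w y s := by
    intro y s; simp only [hw]; split_ifs
    · exact le_max_left _ _
    · exact le_rfl
  have hwd : ∀ q : E N × ℝ, w q.1 q.2 = u q.1 q.2 ∨
      (dist q (x, t) < r ∧ w q.1 q.2 = φ q) := by
    intro q; simp only [hw]; split_ifs with h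
    · rcases max_choice (u q.1 q.2) (φ (q.1, q.2)) with h' | h' <;> rw [h'] <;> tauto
    · exact Or.inl rfl
  have hφw : ∀ q : E N × ℝ, dist q (x, t) < r → φ q ≤ w q.1 q.2 := by
    intro q h; simp only [hw]; rw [if_pos h]; exact le_max_right _ _
  have hwS : InS O σ F g f w := by
    refine ⟨?_, ?_, fun y s => ⟨((hu.2.2 y s).1).trans (huw y s), ?_⟩⟩
    · intro q b hb
      have h1 := hu.1 q b ((huw _ _).trans_lt hb)
      by_cases hq : dist q (x, t) < r
      · have h2 : ∀ᶠ q' in 𝓝 q, φ q' < b :=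
          hφc.continuousAt.eventually (gt_mem_nhds ((hφw q hq).trans_lt hb))
        filter_upwards [h1, h2] with q' h1 h2
        rcases hwd q' with h | h
        · rw [h]; exact h1
        · rw [h.2]; exact h2
      · have h2 : ∀ᶠ q' in 𝓝 q, r / 2 < dist q' (x, t) :=
          (continuous_id.dist continuous_const).continuousAt.eventually
            (lt_mem_nhds (by show r / 2 < dist q (x, t); linarith))
        filter_upwards [h1, h2] with q' h1 h2
        rcases hwd q' with h | h
        · rw [h]; exact h1
        · have := hann q' h2 h.1
          rw [h.2]; exact this.trans h1
    · intro θ y s a' p' Y c₁ hs hY hJw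
      rcases hwd (y, s) with h | ⟨h, h'⟩
      · simp only at h
        have := hu.2.1 θ y s a' p' Y c₁ hs hY (UJ_touch hJw huw h.symm)
        rwa [h]
      · simp only at h'
        rw [UJ_iff] at hJw
        obtain ⟨j1, j2, j3⟩ := jet_cmp (a₁ := a + 2 * c' * (s - t)) (p₁ := p + mv X' (y - x))
          (X₁ := X') (c₁ := c') (a₂ := a') (p₂ := p') (X₂ := Y) (c₂ := c₁) (by
            have ht : Tendsto (fun z : E N × ℝ => (y + z.1, s + z.2)) (𝓝 (0, 0)) (𝓝 (y, s)) :=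
              Continuous.tendsto' (by fun_prop) _ _ (by simp)
            have hb : ∀ᶠ q : E N × ℝ in 𝓝 (y, s), dist q (x, t) < r :=
              Metric.isOpen_ball.eventually_mem (by exact h)
            filter_upwards [ht.eventually hJw, ht.eventually hb] with z h1 h2
            have h3 := hφw _ h2
            have h4 : ψ (y + z.1, s + z.2) = ψ (y, s) + QP (a + 2 * c' * (s - t))
                (p + mv X' (y - x)) X' c' z.1 z.2 := by
              rw [← QP_shift hX']; simp only [ψ]; congr 1 <;> abel
            simp only [add_sub_cancel_left, h'] at h1
            simp only [hφ, h4] at h1 h3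
            linarith)
        obtain ⟨⟨n1, n2, n3, n4, n5⟩, -⟩ := hcl h
        have := hop θ y (φ (y, s)) _ _ (-δ) n1.le (by
          rw [abs_lt] at n4
          simp only [hφ]; rw [abs_le]; constructor <;> linarith [n4.1, n4.2]) n3.le n2.le
          (by rw [abs_neg, abs_of_pos hδ])
        rw [← hX'd] at this
        rw [abs_le] at this
        have t1 := trace_mono j3 (σ θ y)
        have := hcon θ
        rw [h', ← j1, ← j2]
        linarith
    · rcases hwd (y, s) with h | ⟨h, h'⟩
      · exact h.le.trans (hu.2.2 y s).2
      · obtain ⟨⟨n1, n2, n3, n4, n5⟩, -⟩ := hcl h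
        simp only at h' n5
        rw [h']; simp only [hφ]; linarith
  have hfin : V x t ≤ -U₀ - η / 2 := by
    refine env_le ?_
    have h1 : ∀ᶠ q in 𝓝 (x, t), U₀ + η / 2 < φ q :=
      hφc.continuousAt.eventually (lt_mem_nhds (by simp only [hφ, hψ0]; linarith))
    filter_upwards [h1, Metric.ball_mem_nhds (x, t) hr] with q h1 h2
    have := (hφw q h2).trans (hmax w hwS q.1 q.2)
    linarith
  linarith

lemma perron_shift {u : E N → ℝ → ℝ} (hu : InS O σ F g f u)
    (hmax : ∀ w, InS O σ F g f w → ∀ x t, w x t ≤ u x t) (k : E N) (s : ℝ)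
    (hf : ∀ x t, f (x + k) (t + s) = f x t) (hg : ∀ x t, g (x + k) (t + s) = g x t)
    (hσ : ∀ θ x, σ θ (x + k) = σ θ x) (hF : ∀ θ x r p, F θ (x + k) r p = F θ x r p)
    (hO : ∀ t, t ∈ O → t + s ∈ O) (x : E N) (t : ℝ) : u (x + k) (t + s) ≤ u x t := by
  refine hmax (fun x t => u (x + k) (t + s)) ⟨?_, ?_, fun x t => ?_⟩ x t
  · exact hu.1.comp (g := fun q : E N × ℝ => (q.1 + k, q.2 + s)) (by fun_prop)
  · intro θ x t a p X c ht hX hJ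
    have := hu.2.1 θ _ _ a p X c (hO t ht) hX (UJ_shift hJ)
    rwa [hσ, hF] at this
  · rw [← hf, ← hg]; exact hu.2.2 _ _

lemma perron_shift_eq {u : E N → ℝ → ℝ} (hu : InS O σ F g f u)
    (hmax : ∀ w, InS O σ F g f w → ∀ x t, w x t ≤ u x t) (k : E N) (s : ℝ)
    (hf : ∀ x t, f (x + k) (t + s) = f x t) (hg : ∀ x t, g (x + k) (t + s) = g x t)
    (hσ : ∀ θ x, σ θ (x + k) = σ θ x) (hF : ∀ θ x r p, F θ (x + k) r p = F θ x r p)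
    (hO : ∀ t, t ∈ O ↔ t + s ∈ O) (x : E N) (t : ℝ) : u (x + k) (t + s) = u x t := by
  refine le_antisymm (perron_shift hu hmax k s hf hg hσ hF (fun t => (hO t).1) x t) ?_
  have := perron_shift hu hmax (-k) (-s) (fun x t => by rw [← hf]; simp)
    (fun x t => by rw [← hg]; simp) (fun θ x => by rw [← hσ]; simp)
    (fun θ x r p => by rw [← hF]; simp) (fun t ht => (hO _).2 (by simpa using ht)) (x + k) (t + s)
  simpa using this
end perron

/-- quadratic barriers -/
def QB (u₀ : E N → ℝ) (L B K : ℝ) (i : E N × Set.Ioi (0:ℝ)) (x : E N) (t : ℝ) : ℝ :=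
  u₀ i.1 + L * ((i.2 : ℝ) / 2 + (‖x - i.1‖ ^ 2 + B * max t 0) / (2 * i.2)) + K * max t 0

/-- the upper barrier -/
def bar (u₀ : E N → ℝ) (L B K : ℝ) (x : E N) (t : ℝ) : ℝ :=
  ⨅ i : E N × Set.Ioi (0:ℝ), QB u₀ L B K i x t

section barrier
variable {u₀ : E N → ℝ} {L B K : ℝ}

lemma QB_ge (hL : 0 ≤ L) (hB : 0 ≤ B) (hK : 0 ≤ K) (hu : ∀ x y, u₀ x - u₀ y ≤ L * ‖x - y‖)
    (i : E N × Set.Ioi (0:ℝ)) (x : E N) (t : ℝ) : u₀ x ≤ QB u₀ L B K i x t := by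
  obtain ⟨z, ε, hε⟩ := i
  have hε : 0 < ε := hε
  have h1 : ‖x - z‖ ≤ ε / 2 + (‖x - z‖ ^ 2 + B * max t 0) / (2 * ε) := by
    have h0 : 0 ≤ B * max t 0 := by positivity
    have : ε / 2 + (‖x - z‖ ^ 2 + B * max t 0) / (2 * ε) - ‖x - z‖ =
      ((ε - ‖x - z‖) ^ 2 + B * max t 0) / (2 * ε) := by field_simp; ring
    have : 0 ≤ ((ε - ‖x - z‖) ^ 2 + B * max t 0) / (2 * ε) := by positivity
    linarith
  have h2 := mul_le_mul_of_nonneg_left h1 hL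
  have h3 := hu x z
  have h4 : 0 ≤ K * max t 0 := by positivity
  simp only [QB]; linarith

instance : Nonempty (E N × Set.Ioi (0:ℝ)) := ⟨(0, ⟨1, Set.mem_Ioi.2 one_pos⟩)⟩

lemma bar_bdd (hL : 0 ≤ L) (hB : 0 ≤ B) (hK : 0 ≤ K) (hu : ∀ x y, u₀ x - u₀ y ≤ L * ‖x - y‖)
    (x : E N) (t : ℝ) : BddBelow (Set.range fun i : E N × Set.Ioi (0:ℝ) => QB u₀ L B K i x t) :=
  ⟨u₀ x, by rintro _ ⟨i, rfl⟩; exact QB_ge hL hB hK hu i x t⟩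

lemma bar_ge (hL : 0 ≤ L) (hB : 0 ≤ B) (hK : 0 ≤ K) (hu : ∀ x y, u₀ x - u₀ y ≤ L * ‖x - y‖)
    (x : E N) (t : ℝ) : u₀ x ≤ bar u₀ L B K x t := le_ciInf fun i => QB_ge hL hB hK hu i x t

lemma bar_zero (hL : 0 ≤ L) (hB : 0 ≤ B) (hK : 0 ≤ K) (hu : ∀ x y, u₀ x - u₀ y ≤ L * ‖x - y‖)
    (x : E N) {t : ℝ} (ht : t ≤ 0) : bar u₀ L B K x t = u₀ x := by
  refine le_antisymm (le_of_forall_pos_le_add fun e he => ?_) (bar_ge hL hB hK hu x t)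
  have hε : 0 < e / (L + 1) := by positivity
  refine (ciInf_le (bar_bdd hL hB hK hu x t) (x, ⟨e / (L + 1), hε⟩)).trans ?_
  simp only [QB, max_eq_right ht, sub_self, norm_zero]
  have : L * (e / (L + 1)) ≤ e := by
    rw [mul_div_assoc', div_le_iff₀ (by linarith)]; nlinarith
  simp; linarith

lemma bar_per (hu : ZPeriodic u₀) (t : ℝ) : ZPeriodic fun x => bar u₀ L B K x t := by
  intro x k
  simp only [bar]
  refine (Equiv.iInf_congr ((Equiv.addRight ((WithLp.equiv 2 (Fin N → ℝ)).symm
    fun i => (k i : ℝ))).prodCongr (Equiv.refl _)) fun i => ?_).symm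
  simp only [QB, Equiv.prodCongr_apply, Prod.map, Equiv.coe_addRight, Equiv.refl_apply]
  rw [hu, add_sub_add_right_eq_sub]

lemma bar_cont (hL : 0 ≤ L) (hB : 0 ≤ B) (hK : 0 ≤ K) (hu : ∀ x y, u₀ x - u₀ y ≤ L * ‖x - y‖) :
    CC (bar u₀ L B K) := by
  have hx : ∀ x y t, bar u₀ L B K x t ≤ bar u₀ L B K y t + L * ‖x - y‖ := by
    intro x y t
    rw [← sub_le_iff_le_add]
    refine le_ciInf fun i => ?_
    have h1 := ciInf_le (bar_bdd hL hB hK hu x t) (i.1 + (x - y), i.2)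
    have h2 := hu (i.1 + (x - y)) i.1
    have h3 : x - (i.1 + (x - y)) = y - i.1 := by abel
    simp only [QB, h3, add_sub_cancel_left] at h1 h2 ⊢
    simp only [bar, QB]; linarith
  have ht : ∀ x s t η, 0 < η → bar u₀ L B K x s ≤ bar u₀ L B K x t +
      (L * (η / 2 + B * |s - t| / (2 * η)) + K * |s - t|) := by
    intro x s t η hη
    rw [← sub_le_iff_le_add]
    refine le_ciInf fun ⟨z, ε, hε⟩ => ?_
    have hε : 0 < ε := hε
    have h1 := ciInf_le (bar_bdd hL hB hK hu x s) (z, ⟨ε + η, by show 0 < ε + η; linarith⟩)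
    have hm : max s 0 ≤ max t 0 + |s - t| := by
      have := abs_nonneg (s - t)
      refine max_le ?_ (by positivity)
      linarith [le_abs_self (s - t), le_max_left t 0]
    have k1 : (‖x - z‖ ^ 2 + B * max s 0) / (2 * (ε + η)) ≤
        (‖x - z‖ ^ 2 + B * max t 0) / (2 * ε) + B * |s - t| / (2 * η) := by
      have a1 : ‖x - z‖ ^ 2 + B * max s 0 ≤ (‖x - z‖ ^ 2 + B * max t 0) + B * |s - t| := by
        have := mul_le_mul_of_nonneg_left hm hB; linarith
      refine (div_le_div_of_nonneg_right a1 (by positivity)).trans ?_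
      rw [add_div]
      refine add_le_add ?_ ?_
      · exact div_le_div_of_nonneg_left (by positivity) (by positivity) (by linarith)
      · exact div_le_div_of_nonneg_left (by positivity) (by positivity) (by linarith)
    have k2 := mul_le_mul_of_nonneg_left k1 hL
    have k3 := mul_le_mul_of_nonneg_left hm hK
    simp only [QB] at h1 ⊢
    simp only [bar, QB]; linarith
  have hmaj : ∀ q : E N × ℝ, ∀ e > (0:ℝ), ∃ m : E N × ℝ → ℝ, Continuous m ∧ m q < e ∧
      ∀ q', |bar u₀ L B K q'.1 q'.2 - bar u₀ L B K q.1 q.2| ≤ m q' := by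
    intro q e he
    set η := e / (L + 1)
    have hη : 0 < η := by positivity
    refine ⟨fun q' => L * ‖q'.1 - q.1‖ + (L * (η / 2 + B * |q'.2 - q.2| / (2 * η)) +
      K * |q'.2 - q.2|), by fun_prop, ?_, fun q' => ?_⟩
    · have : L * η < 2 * e := by
        rw [mul_div_assoc', div_lt_iff₀ (by linarith)]; nlinarith
      simp; linarith
    · have a1 := hx q'.1 q.1 q'.2
      have a2 := hx q.1 q'.1 q'.2
      have a3 := ht q.1 q'.2 q.2 η hη
      have a4 := ht q.1 q.2 q'.2 η hη
      rw [norm_sub_rev] at a2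
      rw [abs_sub_comm q.2] at a4
      rw [abs_le]; constructor <;> linarith
  refine continuous_iff_continuousAt.2 fun q => ?_
  rw [ContinuousAt, Metric.tendsto_nhds]
  intro e he
  obtain ⟨m, hm, hq, hle⟩ := hmaj q e he
  filter_upwards [hm.continuousAt.eventually (gt_mem_nhds hq)] with q' h
  rw [Real.dist_eq]; exact (hle q').trans_lt h

lemma BARR {C : ℝ} (hL : 0 ≤ L) (hK : 0 ≤ K) (hu : ∀ x y, u₀ x - u₀ y ≤ L * ‖x - y‖)
    (hB : B = 2 * (N ^ 2 * C ^ 2)) {x t a p X c} (ht : 0 < t) (hX : X.IsSymm)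
    (hJ : UJ (fun x t => -bar u₀ L B K x t) x t a p X c) {S : Matrix (Fin N) (Fin N) ℝ}
    (hS : ∀ i j, |S i j| ≤ C) : a - Matrix.trace (S * Sᵀ * X) ≤ -K := by
  have hB0 : 0 ≤ B := by rw [hB]; positivity
  refine le_of_forall_pos_le_add fun κ hκ => ?_
  set D := (N:ℝ) ^ 2 * C ^ 2 with hD
  have hD0 : 0 ≤ D := by positivity
  set δ := min t (κ / (1 + D)) with hδd
  have hδ : 0 < δ := by positivity
  have hδκ : δ * (1 + D) ≤ κ := by
    have : δ ≤ κ / (1 + D) := min_le_right _ _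
    rwa [le_div_iff₀ (by linarith)] at this
  obtain ⟨w, ⟨⟨z, ε, hε⟩, rfl⟩, x', t', a', p', c', h1, h2, h3, h4, h5, h6⟩ := STAB hX hJ
    (fun w => ∃ i, w = fun x t => -QB u₀ L B K i x t) one_pos (fun e he => by
      obtain ⟨i, hi⟩ := exists_lt_of_ciInf_lt
        (show (⨅ i, QB u₀ L B K i x t) < bar u₀ L B K x t + e by simp only [bar]; linarith)
      refine ⟨_, ⟨i, rfl⟩, Continuous.upperSemicontinuous ?_, fun q _ => ?_, (x, t),
        by simpa using he, by simp only; linarith⟩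
      · simp only [QB]; fun_prop
      · have := ciInf_le (bar_bdd hL hB0 hK hu q.1 q.2) i
        simp only [bar]; linarith) hδ
  have hε : 0 < ε := hε
  have ht' : 0 < t' := by
    have : δ ≤ t := min_le_left _ _
    rw [abs_lt] at h2; linarith [h2.1]
  rw [UJ_iff] at h6
  obtain ⟨j1, -, j3⟩ := jet_cmp (a₁ := -(L * B / (2 * ε) + K)) (p₁ := -(L / ε) • (x' - z))
    (X₁ := (-(L / ε)) • 1) (c₁ := 0) (a₂ := a') (p₂ := p') (X₂ := X + δ • 1) (c₂ := c') (by
      have hT : Tendsto (fun z : E N × ℝ => (x' + z.1, t' + z.2)) (𝓝 (0, 0)) (𝓝 (x', t')) :=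
        Continuous.tendsto' (by fun_prop) _ _ (by simp)
      have hb : ∀ᶠ q : E N × ℝ in 𝓝 (x', t'), 0 < q.2 :=
        continuous_snd.continuousAt.eventually (lt_mem_nhds ht')
      filter_upwards [hT.eventually h6, hT.eventually hb] with k k1 k2
      simp only [add_sub_cancel_left, QB, max_eq_left ht'.le, max_eq_left k2.le] at k1
      have e1 : ‖x' + k.1 - z‖ ^ 2 = ‖x' - z‖ ^ 2 + 2 * ⟪x' - z, k.1⟫ + ‖k.1‖ ^ 2 := by
        rw [add_sub_right_comm, norm_add_sq_real]
      rw [e1] at k1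
      refine le_trans (le_of_eq ?_) (sub_le_iff_le_add'.2 k1)
      simp only [QP, qf_smul_one, inner_smul_left]
      simp; field_simp; ring)
  have t1 := trace_mono j3 S
  rw [Matrix.mul_add, Matrix.trace_add, trace_qf S ((-(L / ε)) • 1), trace_qf S (δ • 1)] at t1
  simp only [qf_smul_one, ← Finset.mul_sum] at t1
  have t2 := col_bd hS
  have t3 : δ * ∑ k, ‖colv S k‖ ^ 2 ≤ δ * D := by gcongr
  have t4 : L / ε * ∑ k, ‖colv S k‖ ^ 2 ≤ L / ε * D := by gcongr
  have t5 : L * B / (2 * ε) = L / ε * D := by rw [hB]; field_simp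
  rw [abs_lt] at h3
  linarith [h3.1]
end barrier

lemma JETLIP {u : E N → ℝ → ℝ} {L : ℝ} {x t a p X c} (hu : ∀ y, u x t - u y t ≤ L * ‖x - y‖)
    (hL : 0 ≤ L) (hJ : UJ u x t a p X c) : ‖p‖ ≤ L := by
  rw [UJ_iff] at hJ
  have ht : Tendsto (fun s : ℝ => ((x - s • p, t) : E N × ℝ)) (𝓝 0) (𝓝 (x, t)) :=
    Continuous.tendsto' (by fun_prop) _ _ (by simp)
  have hs : ∀ (s : ℝ) (k : E N), qf X (-(s • k)) = s ^ 2 * qf X k := by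
    intro s k
    simp only [qf, Finset.mul_sum]
    refine Finset.sum_congr rfl fun i _ => Finset.sum_congr rfl fun j _ => ?_
    simp only [PiLp.smul_apply, PiLp.neg_apply, smul_eq_mul]; ring
  have h1 : ∀ᶠ s : ℝ in 𝓝[>] 0, ‖p‖ ^ 2 - 1 / 2 * qf X p * s ≤ L * ‖p‖ := by
    filter_upwards [nhdsWithin_le_nhds (ht.eventually hJ), self_mem_nhdsWithin] with s h1 h2
    have h2 : 0 < s := h2
    have h3 := hu (x - s • p)
    have h4 : x - s • p - x = -(s • p) := by abel
    simp only [QP, h4, sub_self, hs, inner_neg_right, inner_smul_right, real_inner_self_eq_norm_sq,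
      sub_sub_cancel, norm_smul, Real.norm_eq_abs, abs_of_pos h2] at h1 h3
    by_contra hc; push Not at hc
    have := mul_lt_mul_of_pos_left hc h2
    linarith
  have h2 : ‖p‖ ^ 2 ≤ L * ‖p‖ := by
    refine le_of_tendsto ?_ h1
    exact (Continuous.tendsto' (by fun_prop) _ _ (by simp)).mono_left nhdsWithin_le_nhds
  by_contra hc; push Not at hc
  nlinarith

lemma taylor_abs {V : Type*} [NormedAddCommGroup V] [NormedSpace ℝ V] {f : V → ℝ}
    (hf : ContDiff ℝ 2 f) (z : V) {ε : ℝ} (hε : 0 < ε) : ∀ᶠ k in 𝓝 (0 : V),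
      |f (z + k) - f z - fderiv ℝ f z k - 1 / 2 * fderiv ℝ (fderiv ℝ f) z k k| ≤ ε * ‖k‖ ^ 2 := by
  have h1 : ∀ z, HasFDerivAt f (fderiv ℝ f z) z := fun z =>
    (hf.differentiable (by norm_num) z).hasFDerivAt
  have h2 : HasFDerivAt (fderiv ℝ f) (fderiv ℝ (fderiv ℝ f) z) z :=
    ((hf.fderiv_right (m := 1) (by norm_num)).differentiable (by norm_num) z).hasFDerivAt
  set D := fderiv ℝ (fderiv ℝ f) z
  have hsym : ∀ v w, D v w = D w v := fun v w =>
    (hf.contDiffAt.isSymmSndFDerivAt (by simp)).eq v w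
  set g : V → ℝ := fun k => f (z + k) - f z - fderiv ℝ f z k - 1 / 2 * D k k
  have hg : ∀ k, HasFDerivAt g (fderiv ℝ f (z + k) - fderiv ℝ f z - D k) k := by
    intro k
    have a1 : HasFDerivAt (fun k => f (z + k)) (fderiv ℝ f (z + k)) k := by
      have := (h1 (z + k)).comp (f := fun k => z + k) k ((hasFDerivAt_id k).const_add z)
      rwa [ContinuousLinearMap.comp_id] at this
    have a2 := (D.hasFDerivAt (x := k)).clm_apply (hasFDerivAt_id k)
    have a3 := ((a1.sub_const (f z)).sub (fderiv ℝ f z).hasFDerivAt).sub (a2.const_mul (1 / 2))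
    refine a3.congr_fderiv ?_
    ext v
    simp [hsym v k]; ring
  have hb := h2.isLittleO.def hε
  have ht : Tendsto (fun k : V => z + k) (𝓝 0) (𝓝 z) := Continuous.tendsto' (by fun_prop) _ _ (by simp)
  obtain ⟨r, hr, hb⟩ := Metric.eventually_nhds_iff.1 (ht.eventually hb)
  filter_upwards [Metric.ball_mem_nhds 0 hr] with k hk
  rw [mem_ball_zero_iff] at hk
  have := (convex_closedBall (0:V) ‖k‖).norm_image_sub_le_of_norm_hasFDerivWithin_le (f := g)
    (C := ε * ‖k‖) (x := 0) (y := k) (fun y _ => (hg y).hasFDerivWithinAt) (fun y hy => by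
      rw [mem_closedBall_zero_iff] at hy
      have := hb (y := y) (by rw [dist_zero_right]; linarith)
      rw [add_sub_cancel_left] at this
      exact this.trans (by gcongr)) (by simp) (by simp)
  have g0 : g 0 = 0 := by simp [g]
  rw [g0, sub_zero, sub_zero, Real.norm_eq_abs] at this
  refine this.trans (by rw [pow_two, mul_assoc])

lemma taylor2 {φ : E N → ℝ → ℝ} (hφ : ContDiff ℝ 2 fun q : E N × ℝ => φ q.1 q.2) (x : E N) (t : ℝ) :
    (hessMatrix (fun y => φ y t) x).IsSymm ∧ ∀ ε > (0:ℝ), ∃ c, ∀ᶠ q : E N × ℝ in 𝓝 (x, t),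
      |φ q.1 q.2 - φ x t - QP (deriv (φ x) t) (gradient (fun y => φ y t) x)
        (hessMatrix (fun y => φ y t) x) 0 (q.1 - x) (q.2 - t)| ≤
        ε * ‖q.1 - x‖ ^ 2 + c * (q.2 - t) ^ 2 := by
  set f : E N × ℝ → ℝ := fun q => φ q.1 q.2 with hf
  have h1 : ∀ z, HasFDerivAt f (fderiv ℝ f z) z := fun z =>
    (hφ.differentiable (by norm_num) z).hasFDerivAt
  have h2 : HasFDerivAt (fderiv ℝ f) (fderiv ℝ (fderiv ℝ f) (x, t)) (x, t) :=
    ((hφ.fderiv_right (m := 1) (by norm_num)).differentiable (by norm_num) _).hasFDerivAt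
  set D := fderiv ℝ (fderiv ℝ f) (x, t) with hD
  have hsym : ∀ v w, D v w = D w v := fun v w =>
    (hφ.contDiffAt.isSymmSndFDerivAt (by simp)).eq v w
  have hι : ∀ y : E N, HasFDerivAt (fun y : E N => (y, t)) (ContinuousLinearMap.inl ℝ (E N) ℝ) y :=
    fun y => (hasFDerivAt_id y).prodMk (hasFDerivAt_const t y)
  have hx : ∀ y h, fderiv ℝ (fun y => φ y t) y h = fderiv ℝ f (y, t) (h, 0) := by
    intro y h
    have := ((h1 (y, t)).comp y (hι y)).fderiv
    have e : f ∘ (fun y : E N => (y, t)) = fun y => φ y t := rfl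
    rw [e] at this; rw [this]; simp
  have hH : ∀ i j, hessMatrix (fun y => φ y t) x i j =
      D (EuclideanSpace.single i 1, 0) (EuclideanSpace.single j 1, 0) := by
    intro i j
    simp only [hessMatrix, Matrix.of_apply, hx]
    have a1 : HasFDerivAt (fun y => fderiv ℝ f (y, t)) (D.comp (ContinuousLinearMap.inl ℝ (E N) ℝ)) x :=
      HasFDerivAt.comp (g := fderiv ℝ f) (f := fun y : E N => (y, t)) x h2 (hι x)
    have a2 := a1.clm_apply (hasFDerivAt_const ((EuclideanSpace.single j (1:ℝ), (0:ℝ)) : E N × ℝ) x)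
    rw [a2.fderiv]; simp
  have ht : deriv (φ x) t = fderiv ℝ f (x, t) (0, 1) := by
    have := ((h1 (x, t)).comp_hasDerivAt (f := fun s => (x, s)) t
      ((hasDerivAt_const t x).prodMk (hasDerivAt_id t))).deriv
    exact this
  have hgr : ∀ h, ⟪gradient (fun y => φ y t) x, h⟫ = fderiv ℝ f (x, t) (h, 0) := by
    intro h
    rw [← hx, gradient, InnerProductSpace.toDual_symm_apply]
  have hq : ∀ h, qf (hessMatrix (fun y => φ y t) x) h = D (h, 0) (h, 0) := by
    intro h
    have e : ((h, 0) : E N × ℝ) = ∑ j, h j • ((EuclideanSpace.single j (1:ℝ), (0:ℝ)) : E N × ℝ) := by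
      have := (EuclideanSpace.basisFun (Fin N) ℝ).sum_repr h
      have h3 : h = ∑ j, h j • EuclideanSpace.single j (1 : ℝ) := by simpa using this.symm
      have h4 := congrArg (ContinuousLinearMap.inl ℝ (E N) ℝ) h3
      rw [map_sum] at h4
      simpa using h4
    rw [e]
    simp only [qf, hH, map_sum, map_smul, _root_.sum_apply, _root_.smul_apply, smul_eq_mul,
      Finset.mul_sum]
    rw [Finset.sum_comm]
    refine Finset.sum_congr rfl fun i _ => Finset.sum_congr rfl fun j _ => by ring
  refine ⟨Matrix.IsSymm.ext fun i j => by rw [hH, hH, hsym], fun ε hε => ?_⟩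
  set M := ‖D‖
  set ε' := ε / 2
  have hε' : 0 < ε' := by positivity
  refine ⟨ε' + M ^ 2 / (2 * ε) + M, ?_⟩
  have hT : Tendsto (fun q : E N × ℝ => q - (x, t)) (𝓝 (x, t)) (𝓝 0) :=
    Continuous.tendsto' (by fun_prop) _ _ (by simp)
  filter_upwards [hT.eventually (taylor_abs hφ (x, t) hε')] with q hq'
  rw [add_sub_cancel, ← hD] at hq'
  set h := q.1 - x
  set τ := q.2 - t
  have ek : q - (x, t) = ((h, 0) : E N × ℝ) + τ • ((0, 1) : E N × ℝ) := by
    ext <;> simp [h, τ]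
  have hn : ‖q - (x, t)‖ ^ 2 ≤ ‖h‖ ^ 2 + τ ^ 2 := by
    have := dist_sq_le q (x, t)
    rwa [dist_eq_norm] at this
  have e1 : fderiv ℝ f (x, t) (q - (x, t)) = τ * deriv (φ x) t +
      ⟪gradient (fun y => φ y t) x, h⟫ := by
    rw [ek, map_add, map_smul, hgr, ht, smul_eq_mul]; ring
  have e2 : D (q - (x, t)) (q - (x, t)) = qf (hessMatrix (fun y => φ y t) x) h +
      2 * (τ * D (h, 0) (0, 1)) + τ ^ 2 * D (0, 1) (0, 1) := by
    rw [ek]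
    simp only [map_add, map_smul, _root_.add_apply, _root_.smul_apply, smul_eq_mul, hq,
      hsym (0, 1) (h, 0)]; ring
  have n1 : ‖((0, 1) : E N × ℝ)‖ = 1 := by simp [Prod.norm_def]
  have n2 : ‖((h, 0) : E N × ℝ)‖ = ‖h‖ := by simp [Prod.norm_def]
  have b1 : |D (h, 0) (0, 1)| ≤ M * ‖h‖ := by
    have := D.le_opNorm₂ (h, 0) (0, 1)
    rwa [n1, n2, mul_one] at this
  have b2 : |D (0, 1) (0, 1)| ≤ M := by
    have := D.le_opNorm₂ (0, 1) (0, 1)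
    rwa [n1, mul_one, mul_one] at this
  have b3 : |τ * D (h, 0) (0, 1)| ≤ ε' * ‖h‖ ^ 2 + M ^ 2 / (2 * ε) * τ ^ 2 := by
    rw [abs_mul]
    have c1 := mul_le_mul_of_nonneg_left b1 (abs_nonneg τ)
    have c2 : ε' * ‖h‖ ^ 2 + M ^ 2 / (2 * ε) * τ ^ 2 - |τ| * (M * ‖h‖) =
        (ε * ‖h‖ - M * |τ|) ^ 2 / (2 * ε) := by
      rw [← sq_abs τ]; simp only [ε']; field_simp; ring
    have c3 : 0 ≤ (ε * ‖h‖ - M * |τ|) ^ 2 / (2 * ε) := by positivity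
    linarith
  have b4 : |τ ^ 2 * D (0, 1) (0, 1)| ≤ M * τ ^ 2 := by
    rw [abs_mul, abs_of_nonneg (sq_nonneg τ), mul_comm]
    exact mul_le_mul_of_nonneg_right b2 (sq_nonneg τ)
  have b5 := mul_le_mul_of_nonneg_left hn hε'.le
  rw [e1, e2] at hq'
  have b6 : 0 ≤ M * τ ^ 2 := by positivity
  have e3 : f q = φ q.1 q.2 := rfl
  have e4 : f (x, t) = φ x t := rfl
  have e5 : ε * ‖h‖ ^ 2 = 2 * (ε' * ‖h‖ ^ 2) := by simp only [ε']; ring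
  simp only [QP]
  rw [abs_le] at *
  constructor <;> linarith [b3.1, b3.2, b4.1, b4.2, hq'.1, hq'.2]

section tests
variable {σ A : Θ → E N → Matrix (Fin N) (Fin N) ℝ} {F : Θ → E N → ℝ → E N → ℝ}
  {H : Θ → E N → E N → ℝ} {C lam c : ℝ}

lemma trace_one_bd {S : Matrix (Fin N) (Fin N) ℝ} (h : ∀ i j, |S i j| ≤ C) {ε : ℝ} (hε : 0 ≤ ε) :
    0 ≤ Matrix.trace (S * Sᵀ * (ε • 1)) ∧ Matrix.trace (S * Sᵀ * (ε • 1)) ≤ ε * (N ^ 2 * C ^ 2) := by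
  rw [trace_qf]
  simp only [qf_smul_one, ← Finset.mul_sum]
  exact ⟨by positivity, mul_le_mul_of_nonneg_left (col_bd h) hε⟩

lemma sub_test (hσb : ∀ θ x i j, |σ θ x i j| ≤ C) {u φ : E N → ℝ → ℝ} (h : SubF σ F u)
    (hφ : ContDiff ℝ 2 fun q : E N × ℝ => φ q.1 q.2) {x : E N} {t : ℝ} (ht : 0 < t)
    (hm : IsLocalMax (fun q : E N × ℝ => u q.1 q.2 - φ q.1 q.2) (x, t)) (θ : Θ) :
    deriv (φ x) t - Matrix.trace (σ θ x * (σ θ x)ᵀ * hessMatrix (fun y => φ y t) x)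
      + F θ x (u x t) (gradient (fun y => φ y t) x) ≤ 0 := by
  obtain ⟨hs, hT⟩ := taylor2 hφ x t
  refine le_of_forall_pos_le_add fun κ hκ => ?_
  set D := (N:ℝ) ^ 2 * C ^ 2
  have hD : 0 ≤ D := by positivity
  obtain ⟨c, hc⟩ := hT (κ / (2 * (D + 1))) (by positivity)
  have := h θ x t _ _ _ c ht (symm_add hs (κ / (D + 1))) (by
    rw [UJ_iff]
    filter_upwards [hm, hc] with q h1 h2
    have h3 := (abs_le.1 h2).2
    have e1 : QP (deriv (φ x) t) (gradient (fun y => φ y t) x) (hessMatrix (fun y => φ y t) x +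
      (κ / (D + 1)) • 1) c (q.1 - x) (q.2 - t) = QP (deriv (φ x) t) (gradient (fun y => φ y t) x)
        (hessMatrix (fun y => φ y t) x) 0 (q.1 - x) (q.2 - t) +
        (κ / (2 * (D + 1)) * ‖q.1 - x‖ ^ 2 + c * (q.2 - t) ^ 2) := by
      unfold QP; rw [qf_add, qf_smul_one]; field_simp; ring
    rw [e1]; linarith)
  rw [Matrix.mul_add, Matrix.trace_add] at this
  have h4 := (trace_one_bd (hσb θ x) (ε := κ / (D + 1)) (by positivity)).2
  have h5 : κ / (D + 1) * D ≤ κ := by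
    rw [div_mul_eq_mul_div, div_le_iff₀ (by linarith)]; nlinarith
  linarith

lemma sup_test (hσb : ∀ θ x i j, |σ θ x i j| ≤ C) {u φ : E N → ℝ → ℝ} (h : SupF σ F u)
    (hφ : ContDiff ℝ 2 fun q : E N × ℝ => φ q.1 q.2) {x : E N} {t : ℝ} (ht : 0 < t)
    (hm : IsLocalMin (fun q : E N × ℝ => u q.1 q.2 - φ q.1 q.2) (x, t)) {κ : ℝ} (hκ : 0 < κ) :
    ∃ θ, -κ ≤ deriv (φ x) t - Matrix.trace (σ θ x * (σ θ x)ᵀ * hessMatrix (fun y => φ y t) x)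
      + F θ x (u x t) (gradient (fun y => φ y t) x) := by
  obtain ⟨hs, hT⟩ := taylor2 hφ x t
  set D := (N:ℝ) ^ 2 * C ^ 2
  have hD : 0 ≤ D := by positivity
  set ε := κ / 2 / (D + 1) with hε
  have hεp : 0 < ε := by positivity
  obtain ⟨c, hc⟩ := hT (ε / 2) (by positivity)
  obtain ⟨θ, this⟩ := h x t (deriv (φ x) t) (gradient (fun y => φ y t) x) _ (-c) ht
    (symm_add hs (-ε)) (by
      rw [UJ_iff]
      filter_upwards [hm, hc] with q h1 h2
      have h3 := (abs_le.1 h2).1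
      have e1 : QP (deriv (φ x) t) (gradient (fun y => φ y t) x) (hessMatrix (fun y => φ y t) x +
        (-ε) • 1) (-c) (q.1 - x) (q.2 - t) = QP (deriv (φ x) t) (gradient (fun y => φ y t) x)
          (hessMatrix (fun y => φ y t) x) 0 (q.1 - x) (q.2 - t) -
          (ε / 2 * ‖q.1 - x‖ ^ 2 + c * (q.2 - t) ^ 2) := by
        unfold QP; rw [qf_add, qf_smul_one]; ring
      rw [QP_neg, e1]; linarith) (κ / 2) (by linarith)
  refine ⟨θ, ?_⟩
  rw [Matrix.mul_add, Matrix.trace_add, neg_smul, Matrix.mul_neg, Matrix.trace_neg] at this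
  have h4 := (trace_one_bd (hσb θ x) hεp.le).2
  have h5 : ε * D ≤ κ / 2 := by
    rw [hε, div_mul_eq_mul_div, div_le_iff₀ (by linarith)]; nlinarith
  linarith

lemma QP_test (x : E N) (t a : ℝ) (p : E N) (X : Matrix (Fin N) (Fin N) ℝ) (c : ℝ) :
    ContDiff ℝ 2 (fun q : E N × ℝ => QP a p X c (q.1 - x) (q.2 - t)) ∧
    deriv (fun s => QP a p X c (x - x) (s - t)) t = a ∧
    gradient (fun y => QP a p X c (y - x) (t - t)) x = p ∧
    ∀ S : Matrix (Fin N) (Fin N) ℝ,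
      Matrix.trace (S * Sᵀ * hessMatrix (fun y => QP a p X c (y - x) (t - t)) x) =
      Matrix.trace (S * Sᵀ * X) := by
  have hφ : ContDiff ℝ 2 (fun q : E N × ℝ => QP a p X c (q.1 - x) (q.2 - t)) := by
    unfold QP qf
    have hc : ∀ i, ContDiff ℝ 2 (fun q : E N × ℝ => (q.1 - x) i) := fun i =>
      (contDiff_euclidean.1 (contDiff_fst.sub contDiff_const)) i
    have hi : ContDiff ℝ 2 (fun q : E N × ℝ => ⟪p, q.1 - x⟫) :=
      contDiff_const.inner ℝ (contDiff_fst.sub contDiff_const)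
    have ht : ContDiff ℝ 2 (fun q : E N × ℝ => q.2 - t) := contDiff_snd.sub contDiff_const
    exact (((contDiff_const.mul ht).add hi).add (contDiff_const.mul (ContDiff.sum fun i _ =>
      ContDiff.sum fun j _ => (contDiff_const.mul (hc i)).mul (hc j)))).add
      (contDiff_const.mul (ht.pow 2))
  obtain ⟨hs, hT⟩ := taylor2 (φ := fun y s => QP a p X c (y - x) (s - t)) hφ x t
  have z0 : QP a p X c (x - x) (t - t) = 0 := by simp [QP, qf]
  set a' := deriv (fun s => QP a p X c (x - x) (s - t)) t
  set p' := gradient (fun y => QP a p X c (y - x) (t - t)) x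
  set X' := hessMatrix (fun y => QP a p X c (y - x) (t - t)) x
  have ht : Tendsto (fun z : E N × ℝ => (x + z.1, t + z.2)) (𝓝 (0, 0)) (𝓝 (x, t)) :=
    Continuous.tendsto' (by fun_prop) _ _ (by simp)
  have hj : ∀ ε > (0:ℝ), (a = a' ∧ p = p' ∧ ∀ k, qf X k ≤ qf (X' + (2 * ε) • 1) k) ∧
      ∀ k, qf (X' + (-(2 * ε)) • 1) k ≤ qf X k := by
    intro ε hε
    obtain ⟨c', hc'⟩ := hT ε hε
    have e : ∀ (ε c' : ℝ) h τ, QP a' p' (X' + (2 * ε) • 1) c' h τ = QP a' p' X' 0 h τ +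
        (ε * ‖h‖ ^ 2 + c' * τ ^ 2) := by
      intro ε c' h τ; unfold QP; rw [qf_add, qf_smul_one]; ring
    refine ⟨jet_cmp (c₁ := c) (c₂ := c') ?_, (jet_cmp (a₁ := a') (p₁ := p') (a₂ := a) (p₂ := p)
      (c₁ := -c') (c₂ := c) ?_).2.2⟩
    · filter_upwards [ht.eventually hc'] with z hz
      simp only [add_sub_cancel_left, z0, sub_zero] at hz
      rw [e]; linarith [(abs_le.1 hz).2]
    · filter_upwards [ht.eventually hc'] with z hz
      simp only [add_sub_cancel_left, z0, sub_zero] at hz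
      rw [show -(2 * ε) = 2 * (-ε) by ring, e]; linarith [(abs_le.1 hz).1]
  have hq : ∀ k, qf X' k = qf X k := by
    intro k
    have h1 : ∀ ε > (0:ℝ), |qf X' k - qf X k| ≤ 2 * ε * ‖k‖ ^ 2 := by
      intro ε hε
      have h1 := (hj ε hε).1.2.2 k
      have h2 := (hj ε hε).2 k
      rw [qf_add, qf_smul_one] at h1 h2
      rw [abs_le]; constructor <;> linarith
    have h2 : |qf X' k - qf X k| ≤ 0 := by
      refine le_of_forall_pos_le_add fun e he => (h1 (e / (2 * (‖k‖ ^ 2 + 1))) (by positivity)).trans ?_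
      have : 2 * (e / (2 * (‖k‖ ^ 2 + 1))) * ‖k‖ ^ 2 = e * (‖k‖ ^ 2 / (‖k‖ ^ 2 + 1)) := by
        field_simp
      rw [this, zero_add]
      exact mul_le_of_le_one_right he.le (by rw [div_le_one (by positivity)]; linarith)
    have := abs_eq_zero.1 (le_antisymm h2 (abs_nonneg _))
    linarith
  refine ⟨hφ, (hj 1 one_pos).1.1.symm, (hj 1 one_pos).1.2.1.symm, fun S => ?_⟩
  rw [trace_qf, trace_qf]; simp only [hq]

/-- boundedness of the Hamiltonians uniformly in the parameter -/
def HB (H : Θ → E N → E N → ℝ) : Prop := ∀ p, ∃ b, ∀ θ x, |H θ x p| ≤ b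

lemma op_bdd (hA : ∀ θ x, A θ x = σ θ x * (σ θ x)ᵀ) (hσb : ∀ θ x i j, |σ θ x i j| ≤ C)
    (hH : HB H) (x : E N) (φ : E N → ℝ) : BddAbove (Set.range fun θ => opVal A H θ x φ) := by
  obtain ⟨b, hb⟩ := hH (gradient φ x)
  refine ⟨N * (∑ i, ∑ j, |hessMatrix φ x i j| * (C * C)) + b, ?_⟩
  rintro _ ⟨θ, rfl⟩
  simp only [opVal, hA]
  have h1 : |Matrix.trace (σ θ x * (σ θ x)ᵀ * hessMatrix φ x)| ≤
      N * ∑ i, ∑ j, |hessMatrix φ x i j| * (C * C) := by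
    rw [trace_qf]
    refine (Finset.abs_sum_le_sum_abs _ _).trans ((Finset.sum_le_sum (g := fun _ =>
      ∑ i, ∑ j, |hessMatrix φ x i j| * (C * C)) fun k _ => ?_).trans (by simp))
    simp only [qf, colv]
    refine (Finset.abs_sum_le_sum_abs _ _).trans (Finset.sum_le_sum fun i _ =>
      (Finset.abs_sum_le_sum_abs _ _).trans (Finset.sum_le_sum fun j _ => ?_))
    rw [abs_mul, abs_mul, mul_assoc]
    have h1 := hσb θ x i k
    have h2 := hσb θ x j k
    exact mul_le_mul_of_nonneg_left (mul_le_mul h1 h2 (abs_nonneg _)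
      ((abs_nonneg _).trans h1)) (abs_nonneg _)
  linarith [(abs_le.1 h1).1, (abs_le.1 (hb θ x)).2]

lemma subCP_of [Nonempty Θ] (hA : ∀ θ x, A θ x = σ θ x * (σ θ x)ᵀ)
    (hσb : ∀ θ x i j, |σ θ x i j| ≤ C) {u : E N → ℝ → ℝ} (h : SubF σ (Fl 0 H) u) :
    IsSubSolCP A H u := by
  intro φ hφ x t ht hm
  have : (⨆ θ, opVal A H θ x fun y => φ y t) ≤ -deriv (φ x) t := by
    refine ciSup_le fun θ => ?_
    have := sub_test hσb h hφ ht hm θ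
    simp only [Fl] at this
    simp only [opVal, hA]; linarith
  linarith

lemma supCP_of (hA : ∀ θ x, A θ x = σ θ x * (σ θ x)ᵀ)
    (hσb : ∀ θ x i j, |σ θ x i j| ≤ C) (hH : HB H) {u : E N → ℝ → ℝ} (h : SupF σ (Fl 0 H) u) :
    IsSuperSolCP A H u := by
  intro φ hφ x t ht hm
  refine le_of_forall_pos_le_add fun κ hκ => ?_
  obtain ⟨θ, hθ⟩ := sup_test hσb h hφ ht hm hκ
  have := le_ciSup (op_bdd hA hσb hH x fun y => φ y t) θ
  simp only [Fl] at hθ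
  simp only [opVal, hA] at this ⊢; linarith

lemma of_subCP (hA : ∀ θ x, A θ x = σ θ x * (σ θ x)ᵀ)
    (hσb : ∀ θ x i j, |σ θ x i j| ≤ C) (hH : HB H) {u : E N → ℝ → ℝ} (h : IsSubSolCP A H u) :
    SubF σ (Fl 0 H) u := by
  intro θ x t a p X c ht _ hJ
  obtain ⟨h1, h2, h3, h4⟩ := QP_test x t a p X c
  have := h (fun y s => QP a p X c (y - x) (s - t)) h1 x t ht (by
    rw [UJ_iff] at hJ
    filter_upwards [hJ] with q hq
    have z0 : QP a p X c (x - x) (t - t) = 0 := by simp [QP, qf]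
    simp only [z0]; linarith)
  have h5 := le_ciSup (op_bdd hA hσb hH x fun y => QP a p X c (y - x) (t - t)) θ
  rw [h2] at this
  simp only [opVal, hA, h3, h4] at this h5
  simp only [Fl]; linarith

lemma of_supCP [Nonempty Θ] (hA : ∀ θ x, A θ x = σ θ x * (σ θ x)ᵀ) {u : E N → ℝ → ℝ}
    (h : IsSuperSolCP A H u) : SupF σ (Fl 0 H) u := by
  intro x t a p X c ht _ hJ κ hκ
  obtain ⟨h1, h2, h3, h4⟩ := QP_test x t a p X c
  have := h (fun y s => QP a p X c (y - x) (s - t)) h1 x t ht (by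
    rw [UJ_iff] at hJ
    filter_upwards [hJ] with q hq
    have z0 : QP a p X c (x - x) (t - t) = 0 := by simp [QP, qf]
    rw [QP_neg] at hq
    simp only [z0]; linarith)
  rw [h2] at this
  obtain ⟨θ, hθ⟩ := exists_lt_of_lt_ciSup (show -a - κ < ⨆ θ, opVal A H θ x _ by linarith)
  refine ⟨θ, ?_⟩
  simp only [opVal, hA, h3, h4] at hθ
  simp only [Fl]; linarith

lemma subD_of [Nonempty Θ] (hA : ∀ θ x, A θ x = σ θ x * (σ θ x)ᵀ)
    (hσb : ∀ θ x i j, |σ θ x i j| ≤ C) {w : E N → ℝ}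
    (h : SubF σ (Fl lam fun θ x p => H θ x p - c) fun x _ => w x) {φ : E N → ℝ}
    (hφ : ContDiff ℝ 2 φ) {x : E N} (hm : IsLocalMax (fun x => w x - φ x) x) :
    lam * w x - c + (⨆ θ, opVal A H θ x φ) ≤ 0 := by
  have : (⨆ θ, opVal A H θ x φ) ≤ -(lam * w x - c) := by
    refine ciSup_le fun θ => ?_
    have := sub_test (φ := fun y _ => φ y) hσb h (hφ.comp contDiff_fst) (x := x) one_pos
      (by
        have h' : ∀ᶠ y in 𝓝 x, w y - φ y ≤ w x - φ x := hm
        exact (continuous_fst.tendsto (x, (1:ℝ))).eventually h') θ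
    simp only [Fl, deriv_const'] at this
    simp only [opVal, hA]; linarith
  linarith

lemma supD_of (hA : ∀ θ x, A θ x = σ θ x * (σ θ x)ᵀ)
    (hσb : ∀ θ x i j, |σ θ x i j| ≤ C) (hH : HB H) {w : E N → ℝ}
    (h : SupF σ (Fl lam fun θ x p => H θ x p - c) fun x _ => w x) {φ : E N → ℝ}
    (hφ : ContDiff ℝ 2 φ) {x : E N} (hm : IsLocalMin (fun x => w x - φ x) x) :
    0 ≤ lam * w x - c + (⨆ θ, opVal A H θ x φ) := by
  refine le_of_forall_pos_le_add fun κ hκ => ?_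
  obtain ⟨θ, hθ⟩ := sup_test (φ := fun y _ => φ y) hσb h (hφ.comp contDiff_fst) (x := x) one_pos
      (by
        have h' : ∀ᶠ y in 𝓝 x, w x - φ x ≤ w y - φ y := hm
        exact (continuous_fst.tendsto (x, (1:ℝ))).eventually h') hκ
  have := le_ciSup (op_bdd hA hσb hH x φ) θ
  simp only [Fl, deriv_const'] at hθ
  simp only [opVal, hA] at this ⊢; linarith

lemma UJ_stat {w : E N → ℝ} {x t a p X c} (hJ : UJ (fun x _ => w x) x t a p X c) :
    a = 0 ∧ ∀ᶠ y in 𝓝 x, w y ≤ w x + QP 0 p X c (y - x) (t - t) := by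
  rw [UJ_iff] at hJ
  have e1 : a = 0 := by
    have := (lin_quad (α := -a) (β := -c) ?_).1
    · linarith
    have ht : Tendsto (fun s : ℝ => ((x, t + s) : E N × ℝ)) (𝓝 0) (𝓝 (x, t)) :=
      Continuous.tendsto' (by fun_prop) _ _ (by simp)
    filter_upwards [ht.eventually hJ] with s hs
    simp [QP, qf] at hs; linarith
  refine ⟨e1, ?_⟩
  subst e1
  have ht : Tendsto (fun y : E N => ((y, t) : E N × ℝ)) (𝓝 x) (𝓝 (x, t)) :=
    Continuous.tendsto' (by fun_prop) _ _ (by simp)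
  exact ht.eventually hJ

lemma of_subD (hA : ∀ θ x, A θ x = σ θ x * (σ θ x)ᵀ)
    (hσb : ∀ θ x i j, |σ θ x i j| ≤ C) (hH : HB H) {w : E N → ℝ} (h : IsSubSolDisc A H lam w) :
    SubF σ (Fl lam H) fun x _ => w x := by
  intro θ x t a p X c ht _ hJ
  obtain ⟨rfl, hJ'⟩ := UJ_stat hJ
  obtain ⟨h1, -, h3, h4⟩ := QP_test x t 0 p X c
  have := h (fun y => QP 0 p X c (y - x) (t - t)) (h1.comp (g := fun q : E N × ℝ => QP 0 p X c (q.1 - x) (q.2 - t))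
    (f := fun y : E N => (y, t)) (by fun_prop)) x (by
    filter_upwards [hJ'] with q hq
    have z0 : QP 0 p X c (x - x) (t - t) = 0 := by simp [QP, qf]
    rw [z0]; linarith)
  have h5 := le_ciSup (op_bdd hA hσb hH x fun y => QP 0 p X c (y - x) (t - t)) θ
  simp only [opVal, hA, h3, h4] at this h5
  simp only [Fl]; linarith

lemma of_supD [Nonempty Θ] (hA : ∀ θ x, A θ x = σ θ x * (σ θ x)ᵀ) {w : E N → ℝ}
    (h : IsSuperSolDisc A H lam w) : SupF σ (Fl lam H) fun x _ => w x := by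
  intro x t a p X c ht _ hJ κ hκ
  obtain ⟨ha, hJ⟩ := UJ_stat (w := fun x => - w x) hJ
  obtain ⟨h1, -, h3, h4⟩ := QP_test x t 0 p X c
  have := h (fun y => QP 0 p X c (y - x) (t - t)) (h1.comp (g := fun q : E N × ℝ => QP 0 p X c (q.1 - x) (q.2 - t))
    (f := fun y : E N => (y, t)) (by fun_prop)) x (by
    filter_upwards [hJ] with q hq
    have z0 : QP 0 p X c (x - x) (t - t) = 0 := by simp [QP, qf]
    have e := QP_neg 0 p X c (q - x) (t - t)
    rw [neg_zero] at e
    rw [z0]; linarith)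
  obtain ⟨θ, hθ⟩ := exists_lt_of_lt_ciSup (show -(lam * w x) - κ < ⨆ θ, opVal A H θ x _ by linarith)
  refine ⟨θ, ?_⟩
  simp only [opVal, hA, h3, h4] at hθ
  simp only [Fl]; linarith
end tests

lemma qf_abs (X : Matrix (Fin N) (Fin N) ℝ) (h : E N) :
    |qf X h| ≤ (∑ i, ∑ j, |X i j|) * ‖h‖ ^ 2 := by
  simp only [qf, Finset.sum_mul]
  refine (Finset.abs_sum_le_sum_abs _ _).trans (Finset.sum_le_sum fun i _ =>
    (Finset.abs_sum_le_sum_abs _ _).trans (Finset.sum_le_sum fun j _ => ?_))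
  rw [abs_mul, abs_mul, mul_assoc, sq]
  have h1 : ∀ i, |h i| ≤ ‖h‖ := fun i => PiLp.norm_apply_le h i
  exact mul_le_mul_of_nonneg_left (mul_le_mul (h1 i) (h1 j) (abs_nonneg _) (norm_nonneg _))
    (abs_nonneg _)

lemma EXPJ (a : ℝ) (p : E N) (X : Matrix (Fin N) (Fin N) ℝ) (c : ℝ) {ε : ℝ} (hε : 0 < ε) :
    ∃ c', ∀ᶠ z : E N × ℝ in 𝓝 (0, 0), |Real.exp (QP a p X c z.1 z.2) -
      (1 + a * z.2 + ⟪p, z.1⟫ + 1 / 2 * qf X z.1 + 1 / 2 * ⟪p, z.1⟫ ^ 2)| ≤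
        ε * ‖z.1‖ ^ 2 + c' * z.2 ^ 2 := by
  set Q := ∑ i, ∑ j, |X i j|
  have hQ : 0 ≤ Q := Finset.sum_nonneg fun i _ => Finset.sum_nonneg fun j _ => abs_nonneg _
  set B := Q + |c|
  have hB : 0 ≤ B := by positivity
  set K := 2 * (‖p‖ ^ 2 + a ^ 2 + B + 1)
  have hK : 0 < K := by positivity
  set η := min (min 1 (ε / 4 / K)) (ε / 4 / (B + 1))
  have hη : 0 < η := by positivity
  have hη1 : η ≤ 1 := (min_le_left _ _).trans (min_le_left _ _)
  have hη2 : η * K ≤ ε / 4 := (le_div_iff₀ hK).1 ((min_le_left _ _).trans (min_le_right _ _))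
  have hη3 : η * (B + 1) ≤ ε / 4 := (le_div_iff₀ (by positivity)).1 (min_le_right _ _)
  refine ⟨ε + |c| + a ^ 2 + a ^ 2 * ‖p‖ ^ 2 / ε, ?_⟩
  have c1 : Continuous fun z : E N × ℝ => QP a p X c z.1 z.2 := QP_cont a p X c
  have v1 : ∀ᶠ z : E N × ℝ in 𝓝 (0, 0), |QP a p X c z.1 z.2| < η :=
    c1.abs.continuousAt.eventually (gt_mem_nhds (by simpa [QP, qf] using hη))
  have v2 : ∀ᶠ z : E N × ℝ in 𝓝 (0, 0), |⟪p, z.1⟫| < η :=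
    (show Continuous fun z : E N × ℝ => |⟪p, z.1⟫| by fun_prop).continuousAt.eventually
      (gt_mem_nhds (by simpa using hη))
  have v4 : ∀ᶠ z : E N × ℝ in 𝓝 (0, 0), |a * z.2| < η :=
    (show Continuous fun z : E N × ℝ => |a * z.2| by fun_prop).continuousAt.eventually
      (gt_mem_nhds (by simpa using hη))
  filter_upwards [v1, v2, v4] with z w1 w2 w4
  set s := QP a p X c z.1 z.2 with hs
  set l := ⟪p, z.1⟫
  set τ := z.2
  set n := ‖z.1‖ ^ 2 with hn
  have hn0 : 0 ≤ n := by positivity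
  set e2 := 1 / 2 * qf X z.1 + c * τ ^ 2 with he2
  have se : s = l + a * τ + e2 := by rw [hs, he2]; unfold QP; ring
  have b1 := abs_le.1 (qf_abs X z.1)
  have b2 : |e2| ≤ B * (n + τ ^ 2) := by
    have hc := abs_le.1 (le_refl |c|)
    have t0 := sq_nonneg τ
    have := mul_le_mul_of_nonneg_right hc.1 t0
    have := mul_le_mul_of_nonneg_right hc.2 t0
    have := mul_nonneg hQ hn0
    have := mul_nonneg hQ t0
    have := mul_nonneg (abs_nonneg c) hn0
    have e : B * (n + τ ^ 2) = Q * n + Q * τ ^ 2 + |c| * n + |c| * τ ^ 2 := by simp only [B]; ring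
    rw [abs_le, e, he2]; constructor <;> linarith
  have l2 : l ^ 2 ≤ ‖p‖ ^ 2 * n := by
    rw [hn, ← mul_pow, ← sq_abs]
    exact pow_le_pow_left₀ (abs_nonneg _) (abs_real_inner_le_norm p z.1) 2
  have b3 : ∀ r k : ℝ, |r| ≤ k * η → |e2 * r| ≤ k * (η * B) * (n + τ ^ 2) := fun r k hr => by
    rw [abs_mul]
    exact (mul_le_mul b2 hr (abs_nonneg _) (by positivity)).trans_eq (by ring)
  have s2 : s ^ 2 ≤ K * (n + τ ^ 2) := by
    have h1 := (abs_le.1 (b3 s 1 (by linarith))).2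
    have h2 := mul_le_mul_of_nonneg_right hη1 (mul_nonneg hB (by positivity : 0 ≤ n + τ ^ 2))
    have e : K * (n + τ ^ 2) = 2 * (‖p‖ ^ 2 * n) + 2 * (‖p‖ ^ 2 * τ ^ 2) + 2 * (a ^ 2 * n)
      + 2 * (a * τ) ^ 2 + 2 * (B * (n + τ ^ 2)) + 2 * (n + τ ^ 2) := by simp only [K]; ring
    have h3 : s ^ 2 ≤ (l + a * τ) ^ 2 + 2 * (e2 * s) := by
      have := sq_nonneg (s - (l + a * τ))
      have : s * s = s * (l + a * τ) + s * e2 := by nth_rw 2 [se]; ring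
      linarith
    have h4 := sq_nonneg (l - a * τ)
    have h5 : 0 ≤ ‖p‖ ^ 2 * τ ^ 2 := by positivity
    have h6 : 0 ≤ a ^ 2 * n := by positivity
    have h7 := sq_nonneg τ
    linarith
  have x3 : |Real.exp s - (1 + s + s ^ 2 / 2)| ≤ ε / 4 * (n + τ ^ 2) := by
    have := Real.exp_bound (x := s) (w1.le.trans hη1) (n := 3) (by norm_num)
    simp only [Finset.sum_range_succ, Finset.range_zero, Finset.sum_empty] at this
    norm_num [Nat.factorial] at this
    refine this.trans ?_
    have h1 : |s| ^ 3 ≤ η * s ^ 2 := by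
      rw [pow_succ, sq_abs, mul_comm]; exact mul_le_mul_of_nonneg_right w1.le (sq_nonneg s)
    have h2 := mul_le_mul_of_nonneg_left s2 hη.le
    have h3 := mul_le_mul_of_nonneg_right hη2 (by positivity : 0 ≤ n + τ ^ 2)
    have h4 : 0 ≤ |s| ^ 3 := by positivity
    linarith
  have x4 : |s ^ 2 / 2 - l ^ 2 / 2| ≤ a ^ 2 * ‖p‖ ^ 2 / ε * τ ^ 2 + a ^ 2 * τ ^ 2 + ε / 4 * n
      + 3 / 8 * ε * (n + τ ^ 2) := by
    have h1 := b3 (s + l + a * τ) 3 (by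
      have := abs_add_le (s + l) (a * τ)
      have := abs_add_le s l
      linarith)
    have h2 := mul_le_mul_of_nonneg_right hη3 (by positivity : 0 ≤ n + τ ^ 2)
    have h3 : |a * τ * l| ≤ a ^ 2 * ‖p‖ ^ 2 / ε * τ ^ 2 + ε / 4 * n := by
      have h4 : |a * τ * l| ≤ |a * τ| * ‖p‖ * ‖z.1‖ := by
        rw [abs_mul, mul_assoc]
        exact mul_le_mul_of_nonneg_left (abs_real_inner_le_norm p z.1) (abs_nonneg _)
      have h5 : 0 ≤ (|a * τ| * ‖p‖ - ε / 2 * ‖z.1‖) ^ 2 / ε := by positivity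
      have h6 : (|a * τ| * ‖p‖ - ε / 2 * ‖z.1‖) ^ 2 / ε = a ^ 2 * ‖p‖ ^ 2 / ε * τ ^ 2 + ε / 4 * n
          - |a * τ| * ‖p‖ * ‖z.1‖ := by
        rw [hn]
        have : |a * τ| ^ 2 = a ^ 2 * τ ^ 2 := by rw [sq_abs]; ring
        field_simp
        linear_combination (16 * ‖p‖ ^ 2) * this
      linarith
    have e : s ^ 2 / 2 - l ^ 2 / 2 = a * τ * l + (a * τ) ^ 2 / 2 + e2 * (s + l + a * τ) / 2 := by
      rw [se]; ring
    have h7 : (a * τ) ^ 2 = a ^ 2 * τ ^ 2 := by ring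
    have h8 := sq_nonneg (a * τ)
    have h9 : 0 ≤ η * (n + τ ^ 2) := by positivity
    rw [abs_le] at h1 h3 ⊢
    constructor <;> linarith
  have e : Real.exp s - (1 + a * τ + l + 1 / 2 * qf X z.1 + 1 / 2 * l ^ 2) =
      (Real.exp s - (1 + s + s ^ 2 / 2)) + (s ^ 2 / 2 - l ^ 2 / 2) + c * τ ^ 2 := by
    rw [se, he2]; ring
  have hc := abs_le.1 (le_refl |c|)
  have t0 := sq_nonneg τ
  have := mul_le_mul_of_nonneg_right hc.1 t0
  have := mul_le_mul_of_nonneg_right hc.2 t0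
  have := mul_nonneg hε.le hn0
  have := mul_nonneg hε.le t0
  rw [abs_le] at x3 x4
  rw [e, abs_le]
  constructor <;> linarith

/-- rank one matrix -/
def rk (p : E N) : Matrix (Fin N) (Fin N) ℝ := Matrix.of fun i j => p i * p j

lemma qf_rk (p h : E N) : qf (rk p) h = ⟪p, h⟫ ^ 2 := by
  simp only [qf, rk, Matrix.of_apply, PiLp.inner_apply, RCLike.inner_apply, conj_trivial, sq,
    Finset.sum_mul_sum]
  exact Finset.sum_congr rfl fun i _ => Finset.sum_congr rfl fun j _ => by ring

lemma trace_rk (S : Matrix (Fin N) (Fin N) ℝ) (p : E N) :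
    Matrix.trace (S * Sᵀ * rk p) = qs S p := by
  rw [trace_qf]
  simp only [qf_rk, qs, colv, PiLp.inner_apply, RCLike.inner_apply, conj_trivial]

lemma qf_smul (a : ℝ) (X : Matrix (Fin N) (Fin N) ℝ) (h : E N) : qf (a • X) h = a * qf X h := by
  simp only [qf, Matrix.smul_apply, smul_eq_mul, Finset.mul_sum]
  exact Finset.sum_congr rfl fun i _ => Finset.sum_congr rfl fun j _ => by ring

lemma rk_symm {X : Matrix (Fin N) (Fin N) ℝ} (hX : X.IsSymm) (p : E N) (z d : ℝ) :
    (z • (X + rk p) + d • 1).IsSymm := by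
  refine symm_add ?_ d
  unfold Matrix.IsSymm at hX ⊢
  rw [Matrix.transpose_smul, Matrix.transpose_add, hX]
  congr 2
  ext i j; simp [rk, mul_comm]

section logs
variable {σ : Θ → E N → Matrix (Fin N) (Fin N) ℝ} {G : Θ → E N → E N → ℝ} {C lam c' m : ℝ}
  {u v : E N → ℝ → ℝ}

lemma exp_jet (hv : ∀ x t, 0 < t → Real.exp (v x t) = u x t + c' * t - m) {x : E N} {t : ℝ}
    (ht : 0 < t) (a : ℝ) (p : E N) (X : Matrix (Fin N) (Fin N) ℝ) (c : ℝ) {ε : ℝ} (hε : 0 < ε) :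
    ∃ c₂, (UJ v x t a p X c → UJ u x t (Real.exp (v x t) * a - c') (Real.exp (v x t) • p)
      (Real.exp (v x t) • (X + rk p) + (Real.exp (v x t) * ε) • 1) c₂) ∧
      (UJ (fun x t => -v x t) x t (-a) (-p) (-X) (-c) → UJ (fun x t => -u x t) x t
        (-(Real.exp (v x t) * a - c')) (-(Real.exp (v x t) • p))
      (-(Real.exp (v x t) • (X + rk p) + (-(Real.exp (v x t) * ε)) • 1)) (- -c₂)) := by
  obtain ⟨d, hd⟩ := EXPJ a p X c (half_pos hε)
  have tt : Tendsto (fun q : E N × ℝ => (q.1 - x, q.2 - t)) (𝓝 (x, t)) (𝓝 (0, 0)) :=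
    Continuous.tendsto' (by fun_prop) _ _ (by simp)
  have tp : ∀ᶠ q : E N × ℝ in 𝓝 (x, t), 0 < q.2 :=
    continuous_snd.continuousAt.eventually (lt_mem_nhds ht)
  set z := Real.exp (v x t) with hz
  have hz0 : 0 < z := Real.exp_pos _
  have hzu := hv x t ht
  have e : ∀ (ε d : ℝ) h τ, QP (z * a - c') (z • p) (z • (X + rk p) + (z * ε) • 1) (z * d) h τ =
      z * (a * τ + ⟪p, h⟫ + 1 / 2 * qf X h + 1 / 2 * ⟪p, h⟫ ^ 2 + (ε / 2 * ‖h‖ ^ 2 + d * τ ^ 2))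
        - c' * τ := by
    intro ε d h τ
    unfold QP
    rw [qf_add, qf_smul, qf_smul_one, qf_add, qf_rk, real_inner_smul_left]; ring
  refine ⟨z * d, fun hJ => ?_, fun hJ => ?_⟩
  · rw [UJ_iff] at hJ ⊢
    filter_upwards [hJ, tt.eventually hd, tp] with q h1 h2 h3
    rw [e]
    have h4 := Real.exp_le_exp.2 h1
    rw [Real.exp_add, hv _ _ h3, ← hz] at h4
    have h5 := mul_le_mul_of_nonneg_left (abs_le.1 h2).2 hz0.le
    linarith
  · rw [UJ_iff] at hJ ⊢
    filter_upwards [hJ, tt.eventually hd, tp] with q h1 h2 h3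
    rw [QP_neg] at h1 ⊢
    have := e (-ε) (-d) (q.1 - x) (q.2 - t)
    rw [mul_neg, mul_neg] at this
    rw [this]
    have h4 := Real.exp_le_exp.2 (show v x t + QP a p X c (q.1 - x) (q.2 - t) ≤ v q.1 q.2 by linarith)
    rw [Real.exp_add, hv _ _ h3, ← hz] at h4
    have h5 := mul_le_mul_of_nonneg_left (abs_le.1 h2).1 hz0.le
    linarith

lemma log_alg {S X : Matrix (Fin N) (Fin N) ℝ} (p : E N) (hl : lam * c' = 0) (a ε g : ℝ)
    {r w t : ℝ} (hw : Real.exp r = w + c' * t - m) :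
    (Real.exp r * a - c') - Matrix.trace (S * Sᵀ * (Real.exp r • (X + rk p) + (Real.exp r * ε) • 1))
      + (lam * w + g) = Real.exp r * (a - Matrix.trace (S * Sᵀ * X) - Matrix.trace (S * Sᵀ * (ε • 1))
      + (lam + (Real.exp (-r) * (g + (lam * m - c')) - qs S p))) := by
  have h1 : Real.exp r * Real.exp (-r) = 1 := by rw [← Real.exp_add]; simp
  rw [mul_smul, ← smul_add, Matrix.mul_smul, Matrix.trace_smul, Matrix.mul_add, Matrix.mul_add,
    Matrix.trace_add, Matrix.trace_add, trace_rk, smul_eq_mul]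
  linear_combination (-(g + (lam * m - c'))) * h1 - lam * hw - t * hl

lemma log_sub (hσb : ∀ θ x i j, |σ θ x i j| ≤ C) (hl : lam * c' = 0)
    (hv : ∀ x t, 0 < t → Real.exp (v x t) = u x t + c' * t - m) (h : SubF σ (Fl lam G) u) :
    SubF σ (fun θ x r p => lam + FL (σ θ) (G θ) (lam * m - c') x r p) v := by
  intro θ x t a p X c ht hX hJ
  refine le_of_forall_pos_le_add fun κ hκ => ?_
  set D := (N:ℝ) ^ 2 * C ^ 2
  have hD : 0 ≤ D := by positivity
  obtain ⟨c₂, h1, -⟩ := exp_jet hv ht a p X c (ε := κ / (D + 1)) (by positivity)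
  have := h θ x t _ _ _ _ ht (rk_symm hX _ _ _) (h1 hJ)
  simp only [Fl] at this
  rw [log_alg p hl a _ _ (hv x t ht)] at this
  have h3 := nonpos_of_mul_nonpos_right this (Real.exp_pos _)
  have h4 := (trace_one_bd (hσb θ x) (ε := κ / (D + 1)) (by positivity)).2
  have h5 : κ / (D + 1) * D ≤ κ := by
    rw [div_mul_eq_mul_div, div_le_iff₀ (by linarith)]; nlinarith
  simp only [FL]; linarith

lemma log_sup (hσb : ∀ θ x i j, |σ θ x i j| ≤ C) (hl : lam * c' = 0)
    (hv : ∀ x t, 0 < t → Real.exp (v x t) = u x t + c' * t - m) (h : SupF σ (Fl lam G) u) :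
    SupF σ (fun θ x r p => lam + FL (σ θ) (G θ) (lam * m - c') x r p) v := by
  intro x t a p X c ht hX hJ κ hκ
  set D := (N:ℝ) ^ 2 * C ^ 2
  have hD : 0 ≤ D := by positivity
  obtain ⟨c₂, -, h1⟩ := exp_jet hv ht a p X c (ε := κ / 2 / (D + 1)) (by positivity)
  obtain ⟨θ, this⟩ := h x t _ _ _ _ ht (rk_symm hX _ _ _) (h1 hJ) (Real.exp (v x t) * (κ / 2))
    (by positivity)
  refine ⟨θ, ?_⟩
  simp only [Fl] at this
  rw [← mul_neg, ← mul_neg, log_alg p hl a _ _ (hv x t ht), neg_smul, Matrix.mul_neg,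
    Matrix.trace_neg] at this
  have h3 := le_of_mul_le_mul_left this (Real.exp_pos _)
  have h4 := (trace_one_bd (hσb θ x) (ε := κ / 2 / (D + 1)) (by positivity)).2
  have h5 : κ / 2 / (D + 1) * D ≤ κ / 2 := by
    rw [div_mul_eq_mul_div, div_le_iff₀ (by linarith)]; nlinarith
  simp only [FL]; linarith
end logs

section solve
variable {σ : Θ → E N → Matrix (Fin N) (Fin N) ℝ} {F : Θ → E N → ℝ → E N → ℝ} {C : ℝ}
  {O : Set ℝ} {f g : E N → ℝ → ℝ}

lemma SOLVE (hC : 0 ≤ C) (hσb : ∀ θ x i j, |σ θ x i j| ≤ C)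
    (hσl : ∀ θ x y i j, |σ θ x i j - σ θ y i j| ≤ C * ‖x - y‖) (hσp : ∀ θ, ZPeriodic (σ θ))
    (hF : EquiC F) (hFp : ∀ θ r p, ZPeriodic fun x => F θ x r p) (hO : IsOpen O)
    (hO' : ∀ t > 0, t ∈ O) (hf : CC f) (hg : CC g) (hgs : SubO O σ F g) (hfs : SupO O σ F f)
    (hgf : ∀ x t, g x t ≤ f x t) (hfp : ∀ t, ZPeriodic fun x => f x t)
    (hgp : ∀ t, ZPeriodic fun x => g x t) :
    ∃ u U : E N → ℝ → ℝ, USC u ∧ (LowerSemicontinuous fun q : E N × ℝ => U q.1 q.2) ∧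
      (∀ t, ZPeriodic fun x => u x t) ∧ (∀ t, ZPeriodic fun x => U x t) ∧ SubF σ F u ∧
      SupF σ F U ∧ (∀ x t, g x t ≤ U x t ∧ U x t ≤ u x t ∧ u x t ≤ f x t) ∧
      ∀ s, (∀ x t, f x (t + s) = f x t) → (∀ x t, g x (t + s) = g x t) →
        (∀ t, t ∈ O ↔ t + s ∈ O) → ∀ x t, u x (t + s) = u x t ∧ U x (t + s) = U x t := by
  obtain ⟨u, hu, hmax⟩ := perron_max hC hσb hσl hF hO hf hg hgs hgf
  have hsup := perron_sup hC hσb hσl hF hf hg hfs hu hmax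
  have hng : CC fun x t => -g x t := hg.neg
  have hnu : ∀ x t, -u x t ≤ -g x t := fun x t => neg_le_neg (hu.2.2 x t).1
  have hp : ∀ t, ZPeriodic fun x => u x t := by
    intro t x k
    have := perron_shift_eq hu hmax (iv k) 0 (fun x t => by rw [add_zero]; exact hfp t x k)
      (fun x t => by rw [add_zero]; exact hgp t x k) (fun θ x => hσp θ x k)
      (fun θ x r p => hFp θ r p x k) (fun t => by rw [add_zero]) x t
    rw [add_zero] at this
    exact this
  refine ⟨u, fun x t => -env (fun x t => -u x t) x t, hu.1, lsc_neg (env_usc hng hnu), hp, ?_,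
    fun θ x t a p X c ht => hu.2.1 θ x t a p X c (hO' t ht),
    fun x t a p X c ht => hsup x t a p X c (hO' t ht), fun x t => ⟨?_, ?_, (hu.2.2 x t).2⟩, ?_⟩
  · intro t x k
    have := env_shift (fun x t => -u x t) (iv k) 0 x t
    rw [add_zero] at this
    simp only [add_zero] at this
    have h2 : (fun x t => -u (x + iv k) t) = fun x t => -u x t := by
      funext x t; exact congrArg Neg.neg (hp t x k)
    rw [h2] at this
    exact congrArg Neg.neg this.symm
  · have := env_le_of hng hnu x t
    linarith
  · have := le_env hng hnu x t
    linarith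
  · intro s h1 h2 h3 x t
    have h4 : ∀ x t, u x (t + s) = u x t := fun x t => by
      have := perron_shift_eq hu hmax 0 s (fun x t => by rw [add_zero]; exact h1 x t)
        (fun x t => by rw [add_zero]; exact h2 x t) (fun θ x => by rw [add_zero])
        (fun θ x r p => by rw [add_zero]) h3 x t
      rwa [add_zero] at this
    refine ⟨h4 x t, ?_⟩
    have := env_shift (fun x t => -u x t) 0 s x t
    simp only [add_zero, h4] at this
    exact congrArg Neg.neg this.symm

lemma CC_of {u U : E N → ℝ → ℝ} (hu : USC u) (hU : LowerSemicontinuous fun q : E N × ℝ => U q.1 q.2)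
    (h : ∀ x t, u x t = U x t) : CC u := by
  have : U = u := by funext x t; exact (h x t).symm
  rw [this] at hU
  exact continuous_iff_lower_upperSemicontinuous.2 ⟨hU, hu⟩

lemma UJ_const {b : ℝ} {x t a p X c} (hJ : UJ (N := N) (fun _ _ => b) x t a p X c) :
    a = 0 ∧ p = 0 ∧ ∀ k, 0 ≤ qf X k := by
  rw [UJ_iff] at hJ
  have ht : Tendsto (fun z : E N × ℝ => (x + z.1, t + z.2)) (𝓝 (0, 0)) (𝓝 (x, t)) :=
    Continuous.tendsto' (by fun_prop) _ _ (by simp)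
  obtain ⟨h1, h2, h3⟩ := jet_cmp (a₁ := 0) (p₁ := 0) (X₁ := 0) (c₁ := 0) (a₂ := a) (p₂ := p)
    (X₂ := X) (c₂ := c) (by
      filter_upwards [ht.eventually hJ] with z hz
      simp only [add_sub_cancel_left] at hz
      have : QP 0 (0 : E N) 0 0 z.1 z.2 = 0 := by simp [QP, qf]
      linarith)
  exact ⟨h1.symm, h2.symm, fun k => by simpa [qf] using h3 k⟩

/-- joint equicontinuity of Hamiltonians -/
def EQ (G : Θ → E N → E N → ℝ) : Prop := ∀ p, ∀ ε > (0:ℝ), ∃ δ > (0:ℝ), ∀ θ x x' p',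
  ‖x' - x‖ ≤ δ → ‖p' - p‖ ≤ δ → |G θ x' p' - G θ x p| ≤ ε

lemma EQ.fl {G : Θ → E N → E N → ℝ} (h : EQ G) (lam : ℝ) : EquiC (Fl lam G) := by
  intro x r p ε hε
  obtain ⟨δ, hδ, H⟩ := h p (ε / 2) (by linarith)
  refine ⟨min δ (ε / (2 * (|lam| + 1))), by positivity, fun θ x' r' p' h1 h2 h3 => ?_⟩
  have h4 := H θ x x' p' (h1.trans (min_le_left _ _)) (h3.trans (min_le_left _ _))
  have h5 : |lam * (r' - r)| ≤ ε / 2 := by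
    rw [abs_mul]
    have h6 := (le_div_iff₀ (by positivity)).1 (h2.trans (min_le_right _ _))
    have := abs_nonneg (r' - r)
    linarith
  have e : Fl lam G θ x' r' p' - Fl lam G θ x r p = lam * (r' - r) + (G θ x' p' - G θ x p) := by
    simp only [Fl]; ring
  rw [e]; exact (abs_add_le _ _).trans (by linarith)

lemma EQ.log {G : Θ → E N → E N → ℝ} (h : EQ G) (hb : HB G) (hC : 0 ≤ C)
    (hσb : ∀ θ x i j, |σ θ x i j| ≤ C)
    (hσl : ∀ θ x y i j, |σ θ x i j - σ θ y i j| ≤ C * ‖x - y‖) (lam k : ℝ) :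
    EquiC fun θ x r p => lam + FL (σ θ) (G θ) k x r p := by
  intro x r p ε hε
  obtain ⟨b, hb⟩ := hb (Real.exp r • p)
  let Φ : ℝ × E N × ℝ × (Fin N → Fin N → ℝ) → ℝ := fun w =>
    Real.exp (-w.1) * (w.2.2.1 + k) - qs (Matrix.of w.2.2.2) w.2.1
  have hΦ : Continuous Φ := by
    simp only [Φ, qs, Matrix.of_apply]; fun_prop
  set M := |r| + 1 + (‖p‖ + 1) + (|b| + 1) + C
  have hK : IsCompact (Metric.closedBall (0 : ℝ × E N × ℝ × (Fin N → Fin N → ℝ)) M) :=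
    isCompact_closedBall _ _
  obtain ⟨δ, hδ, huc⟩ := Metric.uniformContinuousOn_iff.1
    (hK.uniformContinuousOn_of_continuous hΦ.continuousOn) ε hε
  obtain ⟨δ₁, hδ₁, H1⟩ := h (Real.exp r • p) (min (δ / 2) 1) (by positivity)
  have hc : ∀ᶠ z : ℝ × E N in 𝓝 (r, p), ‖Real.exp z.1 • z.2 - Real.exp r • p‖ < δ₁ :=
    (show Continuous fun z : ℝ × E N => ‖Real.exp z.1 • z.2 - Real.exp r • p‖ by
      fun_prop).continuousAt.eventually (gt_mem_nhds (by simpa using hδ₁))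
  obtain ⟨δ₂, hδ₂, H2⟩ := Metric.eventually_nhds_iff.1 hc
  refine ⟨min (min (min δ₁ (δ₂ / 2)) (δ / 2)) (min 1 (δ / 2 / (C + 1))), by positivity,
    fun θ x' r' p' h1 h2 h3 => ?_⟩
  simp only [le_min_iff] at h1 h2 h3
  have g1 := H1 θ x x' (Real.exp r' • p') h1.1.1.1 (H2 (y := (r', p')) (by
    rw [Prod.dist_eq, Real.dist_eq, dist_eq_norm]
    exact max_lt (by simpa using h2.1.1.2.trans_lt (by linarith))
      (by simpa using h3.1.1.2.trans_lt (by linarith)))).le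
  rw [le_min_iff] at g1
  have s1 : ∀ i j, |σ θ x' i j - σ θ x i j| ≤ δ / 2 := fun i j => by
    refine (hσl θ x' x i j).trans ?_
    have := (le_div_iff₀ (by positivity)).1 h1.2.2
    linarith [norm_nonneg (x' - x)]
  have b0 := (hb θ x).trans (le_abs_self b)
  have a1 := abs_nonneg r
  have a2 := norm_nonneg p
  have a3 := abs_nonneg b
  have mem : ∀ (r' : ℝ) (p' : E N) (g' : ℝ) (S : Fin N → Fin N → ℝ), |r'| ≤ |r| + 1 →
      ‖p'‖ ≤ ‖p‖ + 1 → |g'| ≤ |b| + 1 → (∀ i j, |S i j| ≤ C) →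
      (r', p', g', S) ∈ Metric.closedBall (0 : ℝ × E N × ℝ × (Fin N → Fin N → ℝ)) M := by
    intro r' p' g' S i1 i2 i3 i4
    rw [mem_closedBall_zero_iff]
    refine max_le (i1.trans ?_) (max_le (i2.trans ?_) (max_le (i3.trans ?_) ?_))
    · simp only [M]; linarith
    · simp only [M]; linarith
    · simp only [M]; linarith
    · refine (pi_norm_le_iff_of_nonneg hC).2 (fun i => (pi_norm_le_iff_of_nonneg hC).2 fun j => i4 i j) |>.trans ?_
      simp only [M]; linarith
  have key := huc (r', p', G θ x' (Real.exp r' • p'), σ θ x') (mem _ _ _ _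
      (by have := abs_sub_abs_le_abs_sub r' r; linarith [h2.2.1])
      (by have := norm_sub_norm_le p' p; linarith [h3.2.1])
      (by have := abs_sub_abs_le_abs_sub (G θ x' (Real.exp r' • p')) (G θ x (Real.exp r • p))
          linarith [g1.2]) (hσb θ x'))
    (r, p, G θ x (Real.exp r • p), σ θ x) (mem _ _ _ _ (by linarith) (by linarith) (by linarith)
      (hσb θ x)) (by
      have e : ∀ {y : ℝ}, y ≤ δ / 2 → y < δ := fun hy => by linarith
      rw [Prod.dist_eq, Prod.dist_eq, Prod.dist_eq]
      refine max_lt (e h2.1.2) (max_lt ?_ (max_lt (e g1.1) (e ?_)))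
      · rw [dist_eq_norm]; exact e h3.1.2
      · exact (dist_pi_le_iff (by linarith)).2 fun i => (dist_pi_le_iff (by linarith)).2 fun j => s1 i j)
  rw [Real.dist_eq] at key
  have e : (lam + FL (σ θ) (G θ) k x' r' p') - (lam + FL (σ θ) (G θ) k x r p) =
    Φ (r', p', G θ x' (Real.exp r' • p'), σ θ x') - Φ (r, p, G θ x (Real.exp r • p), σ θ x) := by
    simp only [Φ, FL]
    rw [show (Matrix.of (σ θ x') : Matrix _ _ ℝ) = σ θ x' from rfl,
      show (Matrix.of (σ θ x) : Matrix _ _ ℝ) = σ θ x from rfl]; ring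
  simp only [e]
  exact key.le
end solve

section trunc
variable [Nonempty Θ] {σ : Θ → E N → Matrix (Fin N) (Fin N) ℝ} {G : Θ → E N → E N → ℝ}
  {C K lam : ℝ}

lemma exp_lim {lam M b : ℝ} (hlam : 0 < lam) (h : ∀ t, 0 ≤ t → b ≤ Real.exp (-lam * t) * M) :
    b ≤ 0 := by
  have h1 : Tendsto (fun t : ℝ => Real.exp (-lam * t) * M) atTop (𝓝 (0 * M)) :=
    (Real.tendsto_exp_atBot.comp (tendsto_id.const_mul_atTop_of_neg (by linarith))).mul_const M
  rw [zero_mul] at h1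
  exact ge_of_tendsto h1 (eventually_atTop.2 ⟨0, h⟩)

lemma DISC (hC : 0 ≤ C) (hσb : ∀ θ x i j, |σ θ x i j| ≤ C)
    (hσl : ∀ θ x y i j, |σ θ x i j - σ θ y i j| ≤ C * ‖x - y‖) (hσp : ∀ θ, ZPeriodic (σ θ))
    (hE : EQ G) (hGp : ∀ θ p, ZPeriodic fun x => G θ x p) (hG0 : ∀ θ x, |G θ x 0| ≤ C)
    (hK : 0 ≤ K) (hGl : ∀ θ x y p, |G θ x p - G θ y p| ≤ K * ‖x - y‖) (hlam : 0 < lam) :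
    ∃ w : E N → ℝ, ZPeriodic w ∧ Continuous w ∧ SubF σ (Fl lam G) (fun x _ => w x) ∧
      SupF σ (Fl lam G) (fun x _ => w x) ∧ ∀ x, |w x| ≤ C / lam := by
  have e0 : lam * (C / lam) = C := by field_simp
  obtain ⟨u, U, h1, h2, h3, h4, h5, h6, h7, h8⟩ := SOLVE (O := Set.univ) (F := Fl lam G)
    (f := fun _ _ => C / lam) (g := fun _ _ => -(C / lam)) hC hσb hσl hσp (hE.fl lam)
    (fun θ r p x k => congrArg (lam * r + ·) (hGp θ p x k)) isOpen_univ (fun _ _ => trivial)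
    continuous_const continuous_const
    (by
      intro θ x t a p X c _ _ hJ
      obtain ⟨rfl, rfl, h⟩ := UJ_const hJ
      have h1 := trace_mono (X₁ := 0) (X₂ := X) (fun k => by simpa [qf] using h k) (σ θ x)
      have h2 := (abs_le.1 (hG0 θ x)).2
      simp only [Matrix.mul_zero, Matrix.trace_zero] at h1
      simp only [Fl]; linarith)
    (by
      intro x t a p X c _ _ hJ κ hκ
      obtain ⟨ha, hp, h⟩ := UJ_const hJ
      let θ := Classical.arbitrary Θ
      have h1 := trace_mono (X₁ := 0) (X₂ := -X) (fun k => by simpa [qf] using h k) (σ θ x)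
      have h2 := (abs_le.1 (hG0 θ x)).1
      rw [neg_eq_zero] at hp
      simp only [Matrix.mul_zero, Matrix.trace_zero, Matrix.mul_neg, Matrix.trace_neg] at h1
      refine ⟨θ, ?_⟩
      simp only [Fl, hp]; linarith)
    (fun _ _ => by have : 0 ≤ C / lam := by positivity
                   linarith) (fun _ _ _ => rfl) (fun _ _ _ => rfl)
  have hs : ∀ x t, u x t = u x 0 ∧ U x t = U x 0 := fun x t => by
    have := h8 t (fun _ _ => rfl) (fun _ _ => rfl) (fun _ => by simp) x 0
    rwa [zero_add] at this
  have hle : ∀ x, u x 0 - U x 0 ≤ 0 := fun x => exp_lim hlam fun t ht => by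
    have := CMP hC hlam.le hσb hσl (hE.fl lam) h1 h2 h3 h4 h5 h6 hK (Or.inl hGl)
      (M := 2 * (C / lam)) (by positivity)
      (fun x => by linarith [(h7 x 0).1, (h7 x 0).2.2]) x t ht
    rwa [(hs x t).1, (hs x t).2] at this
  have heq : ∀ x t, u x t = U x t := fun x t => by
    rw [(hs x t).1, (hs x t).2]; linarith [hle x, (h7 x 0).2.1]
  have hc : CC u := CC_of h1 h2 heq
  have e1 : u = fun x _ => u x 0 := by funext x t; exact (hs x t).1
  have e2 : U = fun x _ => u x 0 := by funext x t; rw [← heq, (hs x t).1]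
  rw [e1] at h5
  rw [e2] at h6
  exact ⟨fun x => u x 0, h3 0, hc.comp (f := fun x : E N => (x, (0:ℝ))) (by fun_prop), h5, h6,
    fun x => abs_le.2 ⟨(h7 x 0).1.trans (h7 x 0).2.1, (h7 x 0).2.2⟩⟩

lemma CPSOL (hC : 0 ≤ C) (hσb : ∀ θ x i j, |σ θ x i j| ≤ C)
    (hσl : ∀ θ x y i j, |σ θ x i j - σ θ y i j| ≤ C * ‖x - y‖) (hσp : ∀ θ, ZPeriodic (σ θ))
    (hE : EQ G) (hGp : ∀ θ p, ZPeriodic fun x => G θ x p) (hG0 : ∀ θ x p, |G θ x p| ≤ K)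
    (hGl : ∀ θ x y p, |G θ x p - G θ y p| ≤ K * ‖x - y‖) {u₀ : E N → ℝ} {L : ℝ} (hL : 0 ≤ L)
    (hu : ∀ x y, u₀ x - u₀ y ≤ L * ‖x - y‖) (hup : ZPeriodic u₀) :
    ∃ u : E N → ℝ → ℝ, CC u ∧ (∀ t, ZPeriodic fun x => u x t) ∧ (∀ x, u x 0 = u₀ x) ∧
      SubF σ (Fl 0 G) u ∧ SupF σ (Fl 0 G) u := by
  have hK : 0 ≤ K := (abs_nonneg _).trans (hG0 (Classical.arbitrary Θ) 0 0)
  set B := 2 * ((N:ℝ) ^ 2 * C ^ 2) with hB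
  have hB0 : 0 ≤ B := by positivity
  have hu' : ∀ x y, (fun x => -u₀ x) x - (fun x => -u₀ x) y ≤ L * ‖x - y‖ := fun x y => by
    rw [norm_sub_rev]; linarith [hu y x]
  have hup' : ZPeriodic fun x => -u₀ x := fun x k => congrArg Neg.neg (hup x k)
  obtain ⟨u, U, h1, h2, h3, h4, h5, h6, h7, -⟩ := SOLVE (O := Set.Ioi 0) (F := Fl 0 G)
    (f := bar u₀ L B K) (g := fun x t => -bar (fun x => -u₀ x) L B K x t) hC hσb hσl hσp (hE.fl 0)
    (fun θ r p x k => congrArg (0 * r + ·) (hGp θ p x k)) isOpen_Ioi (fun _ h => h)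
    (bar_cont hL hB0 hK hu) (bar_cont hL hB0 hK hu').neg
    (by
      intro θ x t a p X c ht hX hJ
      have := BARR hL hK hu' hB ht hX hJ (hσb θ x)
      have h2 := (abs_le.1 (hG0 θ x p)).2
      simp only [Fl]; linarith)
    (by
      intro x t a p X c ht hX hJ κ hκ
      let θ := Classical.arbitrary Θ
      have := BARR hL hK hu hB ht hX.neg hJ (hσb θ x)
      have h2 := (abs_le.1 (hG0 θ x p)).1
      rw [Matrix.mul_neg, Matrix.trace_neg] at this
      refine ⟨θ, ?_⟩
      simp only [Fl]; linarith)
    (fun x t => by linarith [bar_ge hL hB0 hK hu x t, bar_ge hL hB0 hK hu' x t])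
    (fun t => bar_per hup t) (fun t x k => congrArg Neg.neg (bar_per hup' t x k))
  have h0 : ∀ x t, t ≤ 0 → u x t = u₀ x ∧ U x t = u₀ x := fun x t ht => by
    obtain ⟨i1, i2, i3⟩ := h7 x t
    rw [bar_zero hL hB0 hK hu' x ht] at i1
    rw [bar_zero hL hB0 hK hu x ht] at i3
    constructor <;> linarith
  have heq : ∀ x t, u x t = U x t := fun x t => by
    rcases le_total t 0 with ht | ht
    · rw [(h0 x t ht).1, (h0 x t ht).2]
    · have := CMP hC le_rfl hσb hσl (hE.fl 0) h1 h2 h3 h4 h5 h6 hK (Or.inl hGl) (M := 0) le_rfl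
        (fun x => by rw [(h0 x 0 le_rfl).1, (h0 x 0 le_rfl).2, sub_self]) x t ht
      rw [mul_zero] at this
      linarith [(h7 x t).2.1]
  have e2 : U = u := by funext x t; exact (heq x t).symm
  rw [e2] at h6
  exact ⟨u, CC_of h1 h2 heq, h3, fun x => (h0 x 0 le_rfl).1, h5, h6⟩
end trunc

/-- the standing assumptions -/
structure Std (C : ℝ) (σ : Θ → E N → Matrix (Fin N) (Fin N) ℝ) (H : Θ → E N → E N → ℝ)
    (L₁ : ℝ) : Prop where
  hC : 0 ≤ C
  hσp : ∀ θ, ZPeriodic (σ θ)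
  hσb : ∀ θ x i j, |σ θ x i j| ≤ C
  hσL : ∀ θ i j, LipschitzWith C.toNNReal fun x : E N => σ θ x i j
  hHp : ∀ θ p, ZPeriodic fun x => H θ x p
  hH0 : ∀ θ x, |H θ x 0| ≤ C
  hHl : ∀ R > (0:ℝ), ∃ CR > (0:ℝ), ∀ (θ : Θ) (x y p q : E N),
      ‖p‖ ≤ R → ‖q‖ ≤ R → |H θ x p - H θ y q| ≤ CR * (‖x - y‖ + ‖p - q‖)
  hL₁ : 1 ≤ L₁
  path : ∀ θ {k k0 r r' : ℝ}, 0 ≤ r → 0 ≤ k0 → k + k0 ≤ (⨆ y : E N, |H θ y 0|) → ∀ {x y p : E N},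
    L₁ ≤ ‖p‖ → ‖p‖ * ‖x - y‖ ≤ r' - r → x ≠ y →
    ‖p‖ / ‖x - y‖ * mnorm (σ θ x - σ θ y) ^ 2 + k0 * Real.exp (-r') * (r' - r)
        ≤ FL (σ θ) (H θ) k x r' p - FL (σ θ) (H θ) k y r p

/-- projection on a ball -/
def prj (R : ℝ) (p : E N) : E N := (R / max R ‖p‖) • p

lemma prj_norm {R : ℝ} (hR : 0 < R) (p : E N) : ‖prj R p‖ ≤ R := by
  have h : 0 < max R ‖p‖ := lt_max_of_lt_left hR
  rw [prj, norm_smul, Real.norm_of_nonneg (by positivity), div_mul_eq_mul_div, div_le_iff₀ h]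
  exact mul_le_mul_of_nonneg_left (le_max_right _ _) hR.le

lemma prj_eq {R : ℝ} (hR : 0 < R) {p : E N} (hp : ‖p‖ ≤ R) : prj R p = p := by
  rw [prj, max_eq_left hp, div_self hR.ne', one_smul]

lemma prj_cont {R : ℝ} (hR : 0 < R) : Continuous (prj R : E N → E N) :=
  (continuous_const.div (continuous_const.max continuous_norm) fun _ =>
    (lt_max_of_lt_left hR).ne').smul continuous_id

/-- truncated Hamiltonian -/
def tr (R : ℝ) (H : Θ → E N → E N → ℝ) (θ : Θ) (x p : E N) : ℝ := H θ x (prj R p)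

section std
variable {σ : Θ → E N → Matrix (Fin N) (Fin N) ℝ} {H G G' : Θ → E N → E N → ℝ} {C L₁ R lam : ℝ}

lemma Std.hσl (S : Std C σ H L₁) (θ x y i j) : |σ θ x i j - σ θ y i j| ≤ C * ‖x - y‖ := by
  have := (S.hσL θ i j).dist_le_mul x y
  rwa [Real.dist_eq, dist_eq_norm, Real.coe_toNNReal _ S.hC] at this

lemma Std.eq (S : Std C σ H L₁) : EQ H := by
  intro p ε hε
  obtain ⟨K, hK, h⟩ := S.hHl (‖p‖ + 1) (by positivity)
  refine ⟨min 1 (ε / (2 * K)), by positivity, fun θ x x' p' h1 h2 => ?_⟩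
  rw [le_min_iff, le_div_iff₀ (by positivity)] at h1 h2
  have := norm_sub_norm_le p' p
  refine (h θ x' x p' p (by linarith) (by linarith)).trans ?_
  linarith

lemma Std.hb (S : Std C σ H L₁) : HB H := by
  intro p
  obtain ⟨K, hK, h⟩ := S.hHl (‖p‖ + 1) (by positivity)
  refine ⟨C + K * ‖p‖, fun θ x => ?_⟩
  have h1 := h θ x x p 0 (by linarith) (by simp; positivity)
  rw [sub_self, norm_zero, zero_add, sub_zero] at h1
  have := abs_sub_abs_le_abs_sub (H θ x p) (H θ x 0)
  linarith [S.hH0 θ x]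

lemma Std.tr_eq (S : Std C σ H L₁) (hR : 0 < R) : EQ (tr R H) := by
  intro p ε hε
  obtain ⟨δ, hδ, h⟩ := S.eq (prj R p) ε hε
  obtain ⟨δ', hδ', h'⟩ := Metric.continuousAt_iff.1 ((prj_cont hR).continuousAt (x := p)) δ hδ
  refine ⟨min δ (δ' / 2), by positivity, fun θ x x' p' h1 h2 => ?_⟩
  rw [le_min_iff] at h1 h2
  refine h θ x x' _ h1.1 ?_
  have := h' (x := p') (by rw [dist_eq_norm]; linarith)
  rw [dist_eq_norm] at this
  exact this.le

lemma Std.tr_bd (S : Std C σ H L₁) (hR : 0 < R) : ∃ K, (∀ θ x p, |tr R H θ x p| ≤ K) ∧ 0 ≤ K ∧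
    ∀ θ x y p, |tr R H θ x p - tr R H θ y p| ≤ K * ‖x - y‖ := by
  obtain ⟨K, hK, h⟩ := S.hHl R hR
  have hC := S.hC
  refine ⟨C + K * R + K, fun θ x p => ?_, by positivity, fun θ x y p => ?_⟩
  · have h1 := h θ x x (prj R p) 0 (prj_norm hR p) (by simpa using hR.le)
    rw [sub_self, norm_zero, zero_add, sub_zero] at h1
    have := abs_sub_abs_le_abs_sub (H θ x (prj R p)) (H θ x 0)
    have := mul_le_mul_of_nonneg_left (prj_norm hR p) hK.le
    rw [tr]
    linarith [S.hH0 θ x]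
  · have h1 := h θ x y (prj R p) (prj R p) (prj_norm hR p) (prj_norm hR p)
    rw [sub_self, norm_zero, add_zero] at h1
    have : 0 ≤ (C + K * R) * ‖x - y‖ := by positivity
    rw [tr, tr]; linarith

lemma tr_zero (hR : 0 < R) (θ : Θ) (x : E N) : tr R H θ x 0 = H θ x 0 := by
  rw [tr, prj_eq hR (by simpa using hR.le)]

lemma sub_congr {Λ : ℝ} (hΛ : 0 ≤ Λ) (h : ∀ θ x p, ‖p‖ ≤ Λ → G θ x p = G' θ x p) {u : E N → ℝ → ℝ}
    (hu : ∀ x y t, 0 ≤ t → u x t - u y t ≤ Λ * ‖x - y‖) (h1 : SubF σ (Fl lam G) u) :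
    SubF σ (Fl lam G') u := by
  intro θ x t a p X c ht hX hJ
  have := h1 θ x t a p X c ht hX hJ
  simp only [Fl] at this ⊢
  rwa [← h θ x p (JETLIP (fun y => hu x y t ht.le) hΛ hJ)]

lemma sup_congr {Λ : ℝ} (hΛ : 0 ≤ Λ) (h : ∀ θ x p, ‖p‖ ≤ Λ → G θ x p = G' θ x p) {u : E N → ℝ → ℝ}
    (hu : ∀ x y t, 0 ≤ t → u x t - u y t ≤ Λ * ‖x - y‖) (h1 : SupF σ (Fl lam G) u) :
    SupF σ (Fl lam G') u := by
  intro x t a p X c ht hX hJ κ hκ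
  obtain ⟨θ, this⟩ := h1 x t a p X c ht hX hJ κ hκ
  refine ⟨θ, ?_⟩
  have hp := JETLIP (L := Λ) (fun y => by rw [norm_sub_rev]; linarith [hu y x t ht.le]) hΛ hJ
  rw [norm_neg] at hp
  simp only [Fl] at this ⊢
  rwa [← h θ x p hp]

lemma tr_congr (hR : 0 < R) {Λ : ℝ} (h : Λ ≤ R) (θ : Θ) (x p : E N) (hp : ‖p‖ ≤ Λ) :
    tr R H θ x p = H θ x p := by rw [tr, prj_eq hR (hp.trans h)]

lemma Std.lipu (S : Std C σ H L₁) (hR : 0 < R) {L W k0 c' m M : ℝ} (hL : L₁ ≤ L) (hW : 1 ≤ W)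
    (hLW : L * W ≤ R) {u : E N → ℝ → ℝ} (hu : CC u) (hp : ∀ t, ZPeriodic fun x => u x t)
    (h1 : SubF σ (Fl lam (tr R H)) u) (h2 : SupF σ (Fl lam (tr R H)) u) (hl : lam * c' = 0)
    (hb : ∀ x t, 0 ≤ t → 1 ≤ u x t + c' * t - m ∧ u x t + c' * t - m ≤ W) (hk0 : 0 ≤ k0)
    (hk : ∀ θ, lam * m - c' + k0 ≤ ⨆ y : E N, |H θ y 0|) (hM : 0 ≤ M)
    (h0 : ∀ x y, Real.log (u x 0 - m) - Real.log (u y 0 - m) ≤ L * ‖x - y‖ + M)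
    (x y : E N) {t : ℝ} (ht : 0 ≤ t) : Real.log (u x t + c' * t - m) -
      Real.log (u y t + c' * t - m) ≤ L * ‖x - y‖ + Real.exp (-(k0 / W) * t) * M := by
  have hW0 : 0 < W := by linarith
  have hE := S.tr_eq hR
  obtain ⟨K, hK, -, -⟩ := S.tr_bd hR
  have hHB : HB (tr R H) := fun p => ⟨K, fun θ x => hK θ x p⟩
  set v : E N → ℝ → ℝ := fun x t => Real.log (u x (max t 0) + c' * max t 0 - m) with hvd
  have hb' : ∀ x t, 1 ≤ u x (max t 0) + c' * max t 0 - m ∧ u x (max t 0) + c' * max t 0 - m ≤ W :=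
    fun x t => hb x _ (le_max_right _ _)
  have hv : ∀ x t, 0 < t → Real.exp (v x t) = u x t + c' * t - m := fun x t ht => by
    rw [hvd]; simp only
    rw [Real.exp_log (by linarith [(hb' x t).1]), max_eq_left ht.le]
  have hexp : ∀ r, r ≤ Real.log W → Real.exp r ≤ W := fun r hr =>
    (Real.exp_le_exp.2 hr).trans_eq (Real.exp_log hW0)
  have key := LIP S.hC (ν := k0 / W) (by positivity) (S.hL₁.trans hL) S.hσb S.hσl
    (hE.log hHB S.hC S.hσb S.hσl lam (lam * m - c')) (v := v) (B := Real.log W)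
    (by
      refine Continuous.log ?_ fun q => (by linarith [(hb' q.1 q.2).1] : _ < _).ne'
      have : Continuous fun q : E N × ℝ => u q.1 (max q.2 0) :=
        hu.comp (f := fun q : E N × ℝ => (q.1, max q.2 0)) (by fun_prop)
      fun_prop)
    (fun t x k => by
      have := hp (max t 0) x k
      simp only [hvd] at this ⊢; rw [this])
    (log_sub S.hσb hl hv h1) (log_sup S.hσb hl hv h2)
    (fun x t _ => ⟨Real.log_nonneg (hb' x t).1, Real.log_le_log (by linarith [(hb' x t).1])
      (hb' x t).2⟩)
    (by
      intro θ x y p r₁ r₂ hp hxy hr2 hr1 hd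
      have hL0 : 0 ≤ L := by rw [← hp]; exact norm_nonneg p
      have hr21 : r₂ ≤ r₁ := by have : 0 ≤ L * ‖x - y‖ := by positivity
                                linarith
      have ag : ∀ r, r ≤ Real.log W → ∀ x, FL (σ θ) (tr R H θ) (lam * m - c') x r p =
          FL (σ θ) (H θ) (lam * m - c') x r p := fun r hr x => by
        rw [FL, FL, tr, prj_eq hR]
        rw [norm_smul, Real.norm_of_nonneg (Real.exp_pos _).le, hp, mul_comm]
        exact (mul_le_mul_of_nonneg_left (hexp r hr) hL0).trans hLW
      have := S.path θ hr2 hk0 (hk θ) (x := x) (y := y) (p := p) (r' := r₁) (by rwa [hp])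
        (by rwa [hp]) hxy
      rw [hp] at this
      rw [ag r₁ hr1, ag r₂ (hr21.trans hr1)]
      have h3 : k0 / W * (r₁ - r₂) ≤ k0 * Real.exp (-r₁) * (r₁ - r₂) := by
        refine mul_le_mul_of_nonneg_right ?_ (by linarith)
        rw [div_eq_mul_inv, Real.exp_neg]
        exact mul_le_mul_of_nonneg_left (inv_anti₀ (Real.exp_pos _) (hexp r₁ hr1)) hk0
      linarith)
    hM (fun x y => by simpa [hvd] using h0 x y) x y t ht
  simpa only [hvd, max_eq_left ht] using key

lemma log_lip {a b Z d : ℝ} (ha : 0 < a) (hb : 0 < b) (hbZ : b ≤ Z) (hd : 0 ≤ d)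
    (h : Real.log b - Real.log a ≤ d) : b - a ≤ Z * d := by
  have h1 := Real.log_le_sub_one_of_pos (div_pos ha hb)
  rw [Real.log_div ha.ne' hb.ne'] at h1
  have h2 : b * (1 - d) ≤ b * (a / b) := mul_le_mul_of_nonneg_left (by linarith) hb.le
  rw [mul_div_cancel₀ _ hb.ne'] at h2
  have := mul_le_mul_of_nonneg_right hbZ hd
  linarith

lemma per_min {w : E N → ℝ} (hw : Continuous w) (hp : ZPeriodic w) : ∃ x₀, ∀ x, w x₀ ≤ w x := by
  obtain ⟨x₀, -, h⟩ := (isCompact_closedBall (0 : E N) (Real.sqrt N)).exists_isMinOn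
    ⟨0, by simp⟩ hw.continuousOn
  refine ⟨x₀, fun x => ?_⟩
  obtain ⟨k, hk⟩ := per_red x
  rw [← hp x k]
  exact h (mem_closedBall_zero_iff.2 hk)

/-- the uniform Lipschitz constant -/
def Lam (N : ℕ) (L₁ : ℝ) : ℝ := Real.exp (L₁ * Real.sqrt N) * L₁

lemma Std.stat [Nonempty Θ] (S : Std C σ H L₁) (hlam : 0 < lam) : ∃ w : E N → ℝ, ZPeriodic w ∧
    (∀ x y, w x - w y ≤ Lam N L₁ * ‖x - y‖) ∧ SubF σ (Fl lam H) (fun x _ => w x) ∧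
    SupF σ (Fl lam H) (fun x _ => w x) ∧ (∀ x, |w x| ≤ C / lam) ∧
    ∀ θ x, lam * w x ≤ ⨆ y : E N, |H θ y 0| := by
  have hC := S.hC
  have hL₁ := S.hL₁
  set W := 2 * (C / lam) + 1
  have hW : 1 ≤ W := by have : 0 ≤ C / lam := by positivity
                        simp only [W]; linarith
  have hΛ : 0 ≤ Lam N L₁ := mul_nonneg (Real.exp_pos _).le (by linarith)
  set R := L₁ * W + Lam N L₁
  have hLW : 0 < L₁ * W := mul_pos (by linarith) (by linarith)
  have hR : 0 < R := by simp only [R]; linarith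
  obtain ⟨K, -, hK, hKl⟩ := S.tr_bd hR
  obtain ⟨w, hwp, hwc, hs1, hs2, hwb⟩ := DISC hC S.hσb S.hσl S.hσp (S.tr_eq hR)
    (fun θ p x k => S.hHp θ _ x k) (fun θ x => by rw [tr_zero hR]; exact S.hH0 θ x) hK hKl hlam
  obtain ⟨x₁, hx₁'⟩ := per_min (w := fun x => -w x) hwc.neg (fun x k => congrArg Neg.neg (hwp x k))
  have hx₁ : ∀ x, w x ≤ w x₁ := fun x => neg_le_neg_iff.1 (hx₁' x)
  obtain ⟨x₀, hx₀⟩ := per_min hwc hwp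
  have hsup : ∀ θ x, lam * w x ≤ ⨆ y : E N, |H θ y 0| := by
    intro θ x
    have h1 := hs1 θ x₁ 1 0 0 0 0 one_pos Matrix.isSymm_zero (by
      rw [UJ_iff]
      refine Eventually.of_forall fun q => ?_
      have : QP 0 (0 : E N) 0 0 (q.1 - x₁) (q.2 - 1) = 0 := by simp [QP, qf]
      linarith [hx₁ q.1])
    simp only [Fl, tr_zero hR, Matrix.mul_zero, Matrix.trace_zero] at h1
    have h2 := le_ciSup (f := fun y : E N => |H θ y 0|) ⟨C, by rintro _ ⟨y, rfl⟩; exact S.hH0 θ y⟩ x₁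
    have h3 := mul_le_mul_of_nonneg_left (hx₁ x) hlam.le
    linarith [neg_abs_le (H θ x₁ 0)]
  have hz : ∀ x, 1 ≤ w x + 0 * 0 - (w x₀ - 1) ∧ w x - (w x₀ - 1) ≤ W := fun x => by
    have := abs_le.1 (hwb x)
    have := abs_le.1 (hwb x₀)
    simp only [W]
    constructor <;> linarith [hx₀ x]
  have hlog : ∀ x y, Real.log (w x - (w x₀ - 1)) - Real.log (w y - (w x₀ - 1)) ≤ L₁ * ‖x - y‖ := by
    intro x y
    rw [← sub_nonpos]
    refine exp_lim (lam := lam / W) (M := Real.log W) (by positivity) fun t ht => ?_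
    have := S.lipu hR (L := L₁) (W := W) (k0 := lam) (c' := 0) (m := w x₀ - 1) (M := Real.log W)
      le_rfl hW (by simp only [R]; linarith) (hwc.comp continuous_fst) (fun _ => hwp) hs1 hs2
      (mul_zero _) (fun x t _ => by rw [zero_mul, add_zero]; simpa using hz x) hlam.le
      (fun θ => by linarith [hsup θ x₀]) (Real.log_nonneg hW)
      (fun x y => by
        have h1 := Real.log_le_log (by linarith [(hz x).1]) (hz x).2
        have h2 := Real.log_nonneg (x := w y - (w x₀ - 1)) (by linarith [(hz y).1])
        have : 0 ≤ L₁ * ‖x - y‖ := mul_nonneg (by linarith) (norm_nonneg _)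
        linarith) x y ht
    simp only [zero_mul, add_zero] at this
    linarith
  have hZ : ∀ x, w x - (w x₀ - 1) ≤ Real.exp (L₁ * Real.sqrt N) := by
    intro x
    obtain ⟨k, hk⟩ := per_red (x - x₀)
    have h1 := hlog (x + iv k) x₀
    rw [show w x₀ - (w x₀ - 1) = 1 by ring, Real.log_one, sub_zero,
      show w (x + iv k) = w x from hwp x k, show x + iv k - x₀ = x - x₀ + iv k by abel] at h1
    rw [← Real.log_le_iff_le_exp (by linarith [(hz x).1])]
    exact h1.trans (mul_le_mul_of_nonneg_left hk (by linarith))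
  have hlip : ∀ x y, w x - w y ≤ Lam N L₁ * ‖x - y‖ := fun x y => by
    have := log_lip (a := w y - (w x₀ - 1)) (by linarith [(hz y).1]) (by linarith [(hz x).1]) (hZ x)
      (mul_nonneg (by linarith) (norm_nonneg _)) (hlog x y)
    rw [Lam, mul_assoc]; linarith
  have hcg := fun θ x p => tr_congr (H := H) (N := N) hR (Λ := Lam N L₁) (by simp only [R]; linarith) θ x p
  exact ⟨w, hwp, hlip, sub_congr hΛ hcg (fun x y _ _ => hlip x y) hs1,
    sup_congr hΛ hcg (fun x y _ _ => hlip x y) hs2, hwb, hsup⟩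
end std

lemma UJ_sh {u u' : E N → ℝ → ℝ} {b κ x t a p X c} (h : ∀ x t, u' x t = u x t + b * t + κ)
    (hJ : UJ u' x t a p X c) : UJ u x t (a - b) p X c := by
  filter_upwards [hJ] with q hq
  rw [h, h] at hq
  linarith

lemma ulim {g : ℕ → ℝ} {B : ℝ} (h : ∀ n, |g n| ≤ B) : ∃ b, Tendsto g (hyperfilter ℕ) (𝓝 b) := by
  obtain ⟨b, -, hb⟩ := (isCompact_Icc (a := -B) (b := B)).ultrafilter_le_nhds' ((hyperfilter ℕ).map g)
    (Ultrafilter.mem_map.2 (Eventually.of_forall (p := fun n => g n ∈ Set.Icc (-B) B)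
      fun n => abs_le.1 (h n)))
  exact ⟨b, hb⟩

lemma unif_lim {l : Filter ℕ} {f : ℕ → E N → ℝ} {v : E N → ℝ} {Λ : ℝ} (hΛ : 0 ≤ Λ)
    (hf : ∀ n x y, |f n x - f n y| ≤ Λ * ‖x - y‖) (hv : ∀ x y, |v x - v y| ≤ Λ * ‖x - y‖)
    (h : ∀ x, Tendsto (fun n => f n x) l (𝓝 (v x))) (x : E N) (ρ : ℝ) {δ : ℝ} (hδ : 0 < δ) :
    ∀ᶠ n in l, ∀ y, dist y x ≤ ρ → |f n y - v y| ≤ δ := by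
  obtain ⟨s, hs, hc⟩ := Metric.totallyBounded_iff.1 (isCompact_closedBall x ρ).totallyBounded
    (δ / (3 * (Λ + 1))) (by positivity)
  have := (eventually_all_finite hs).2 fun y _ =>
    (Metric.tendsto_nhds.1 (h y) (δ / 3) (by positivity))
  filter_upwards [this] with n hn y hy
  obtain ⟨z, hz, hyz⟩ := Set.mem_iUnion₂.1 (hc (Metric.mem_closedBall.2 hy))
  have h1 := hn z hz
  rw [Metric.mem_ball, dist_eq_norm, lt_div_iff₀ (by positivity)] at hyz
  rw [Real.dist_eq] at h1
  have h2 := hf n y z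
  have h3 := hv y z
  have h4 := norm_nonneg (y - z)
  rw [abs_le] at h2 h3 ⊢
  rw [abs_lt] at h1
  constructor <;> linarith [h1.1, h1.2, h2.1, h2.2, h3.1, h3.2]

section std
variable {σ : Θ → E N → Matrix (Fin N) (Fin N) ℝ} {H G G' : Θ → E N → E N → ℝ} {C L₁ R lam : ℝ}

lemma abs_lip {w : E N → ℝ} {Λ : ℝ} (h : ∀ x y, w x - w y ≤ Λ * ‖x - y‖) (x y : E N) :
    |w x - w y| ≤ Λ * ‖x - y‖ := by
  have := h y x
  rw [norm_sub_rev] at this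
  exact abs_le.2 ⟨by linarith, h x y⟩

lemma Std.erg [Nonempty Θ] (S : Std C σ H L₁) : ∃ (c : ℝ) (v : E N → ℝ), ZPeriodic v ∧
    (∀ x y, v x - v y ≤ Lam N L₁ * ‖x - y‖) ∧
    SubF σ (Fl 0 fun θ x p => H θ x p - c) (fun x _ => v x) ∧
    SupF σ (Fl 0 fun θ x p => H θ x p - c) (fun x _ => v x) ∧
    ∀ θ, -c ≤ ⨆ y : E N, |H θ y 0| := by
  have hΛ : 0 ≤ Lam N L₁ := mul_nonneg (Real.exp_pos _).le (by linarith [S.hL₁])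
  have hn : ∀ n : ℕ, (0:ℝ) < 1 / ((n:ℝ) + 1) := fun n => by positivity
  choose w hwp hwl hs1 hs2 hwb hws using fun n : ℕ => S.stat (hn n)
  have hB : ∀ n x, |w n x - w n 0| ≤ Lam N L₁ * Real.sqrt N := fun n x => by
    obtain ⟨k, hk⟩ := per_red x
    rw [← show w n (x + iv k) = w n x from hwp n x k]
    refine (abs_lip (hwl n) _ _).trans (mul_le_mul_of_nonneg_left ?_ hΛ)
    rwa [sub_zero]
  choose v hv using fun x => ulim fun n => hB n x
  obtain ⟨e, he⟩ := ulim (g := fun n : ℕ => 1 / ((n:ℝ) + 1) * w n 0) (B := C) fun n => by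
    rw [abs_mul, abs_of_pos (hn n), mul_comm]
    exact (le_div_iff₀ (hn n)).1 (hwb n 0)
  have hvl : ∀ x y, v x - v y ≤ Lam N L₁ * ‖x - y‖ := fun x y =>
    le_of_tendsto ((hv x).sub (hv y)) (Eventually.of_forall fun n => by linarith [hwl n x y])
  have hf : ∀ n x y, |w n x - w n 0 - (w n y - w n 0)| ≤ Lam N L₁ * ‖x - y‖ := fun n x y => by
    rw [sub_sub_sub_cancel_right]; exact abs_lip (hwl n) x y
  have hu := fun x {δ : ℝ} (hδ : 0 < δ) =>
    unif_lim (l := hyperfilter ℕ) hΛ hf (abs_lip hvl) hv x 1 hδ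
  have hl0 : Tendsto (fun n : ℕ => 1 / ((n:ℝ) + 1)) (hyperfilter ℕ) (𝓝 0) :=
    tendsto_one_div_add_atTop_nhds_zero_nat.mono_left Nat.hyperfilter_le_atTop
  have hlw : ∀ κ > (0:ℝ), ∀ᶠ n : ℕ in hyperfilter ℕ, ∀ x, |1 / ((n:ℝ) + 1) * w n x - e| ≤ κ := by
    intro κ hκ
    have h1 : Tendsto (fun n : ℕ => 1 / ((n:ℝ) + 1) * (Lam N L₁ * Real.sqrt N)
      + |1 / ((n:ℝ) + 1) * w n 0 - e|) (hyperfilter ℕ) (𝓝 0) := by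
      have := (hl0.mul_const (Lam N L₁ * Real.sqrt N)).add (he.sub_const e).abs
      simpa using this
    filter_upwards [h1.eventually (gt_mem_nhds hκ)] with n h x
    refine le_trans ?_ h.le
    rw [show 1 / ((n:ℝ) + 1) * w n x - e = 1 / ((n:ℝ) + 1) * (w n x - w n 0)
      + (1 / ((n:ℝ) + 1) * w n 0 - e) by ring]
    refine (abs_add_le _ _).trans (add_le_add_left ?_ _)
    rw [abs_mul, abs_of_pos (hn n)]
    exact mul_le_mul_of_nonneg_left (hB n x) (hn n).le
  have hcw : ∀ n, Continuous (w n) := fun n =>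
    (LipschitzWith.of_dist_le_mul (K := (Lam N L₁).toNNReal) fun x y => by
      rw [Real.coe_toNNReal _ hΛ, Real.dist_eq, dist_eq_norm]; exact abs_lip (hwl n) x y).continuous
  refine ⟨-e, v, fun x k => tendsto_nhds_unique (hv _) ?_, hvl, ?_, ?_, fun θ => ?_⟩
  · exact (hv x).congr fun n => by rw [hwp n x k]
  · intro θ x t a p X c ht hX hJ
    refine le_of_forall_pos_le_add fun κ hκ => ?_
    obtain ⟨δ₀, hδ₀, hop⟩ := opclose S.hC S.hσb S.hσl (S.eq.fl 0) x (v x) p a X (half_pos hκ)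
    obtain ⟨_, ⟨n, rfl, hnl⟩, x', t', a', p', c', i1, i2, i3, i4, i5, hJ'⟩ := STAB hX hJ
      (fun f => ∃ n : ℕ, f = (fun x _ => w n x - w n 0) ∧
        ∀ x, |1 / ((n:ℝ) + 1) * w n x - e| ≤ κ / 2) one_pos (by
        intro δ hδ
        obtain ⟨n, h1, h2⟩ := ((hlw (κ / 2) (half_pos hκ)).and (hu x hδ)).exists
        refine ⟨_, ⟨n, rfl, h1⟩, ?_, fun q hq => ?_, (x, t), by simpa using hδ, ?_⟩
        · exact (((hcw n).comp continuous_fst).sub continuous_const).upperSemicontinuous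
        · have := h2 q.1 ((le_max_left _ _).trans hq)
          linarith [(abs_le.1 this).2]
        · linarith [(abs_le.1 (h2 x (by simp))).1]) (lt_min hδ₀ ht)
    have hd := min_le_left δ₀ t
    have h1 := hs1 n θ x' t' _ p' _ c' (by linarith [(abs_lt.1 i2).1, min_le_right δ₀ t])
      (symm_add hX _) (UJ_sh (u := fun x _ => w n x) (b := 0) (κ := -w n 0)
        (fun x t => by ring) hJ')
    have h2 := (abs_le.1 (hop θ x' _ p' a' (min δ₀ t) (i1.le.trans hd) (i5.le.trans hd)
      (i4.le.trans hd) (i3.le.trans hd) (by rw [abs_of_pos (lt_min hδ₀ ht)]; exact hd))).1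
    have h3 := (abs_le.1 (hnl x')).1
    simp only [Fl] at h1 h2 ⊢
    linarith
  · intro x t a p X c ht hX hJ κ hκ
    obtain ⟨δ₀, hδ₀, hop⟩ := opclose S.hC S.hσb S.hσl (S.eq.fl 0) x (v x) p a X
      (by linarith : 0 < κ / 3)
    obtain ⟨_, ⟨n, rfl, hnl⟩, x', t', a', p', c', i1, i2, i3, i4, i5, hJ'⟩ := STAB hX.neg hJ
      (fun f => ∃ n : ℕ, f = (fun x _ => -(w n x - w n 0)) ∧
        ∀ x, |1 / ((n:ℝ) + 1) * w n x - e| ≤ κ / 3) one_pos (by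
        intro δ hδ
        obtain ⟨n, h1, h2⟩ := ((hlw (κ / 3) (by linarith)).and (hu x hδ)).exists
        refine ⟨_, ⟨n, rfl, h1⟩, ?_, fun q hq => ?_, (x, t), by simpa using hδ, ?_⟩
        · exact (((hcw n).comp continuous_fst).sub continuous_const).neg.upperSemicontinuous
        · have := h2 q.1 ((le_max_left _ _).trans hq)
          linarith [(abs_le.1 this).1]
        · linarith [(abs_le.1 (h2 x (by simp))).2]) (lt_min hδ₀ ht)
    have hd := min_le_left δ₀ t
    set d := min δ₀ t
    have hd0 : 0 < d := lt_min hδ₀ ht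
    have eX : -(-X + d • (1 : Matrix (Fin N) (Fin N) ℝ)) = X + (-d) • 1 := by
      rw [neg_add, neg_neg, neg_smul]
    obtain ⟨θ, h1⟩ := hs2 n x' t' (-a') (-p') (X + (-d) • 1) (-c')
      (by linarith [(abs_lt.1 i2).1, min_le_right δ₀ t]) (symm_add hX _) (by
        have := UJ_sh (u := fun x _ => -w n x) (b := 0) (κ := w n 0) (fun x t => by ring) hJ'
        rw [← eX]
        simpa only [neg_neg, sub_zero] using this) (κ / 3) (by linarith)
    have h2 := (abs_le.1 (hop θ x' (v x) (-p') (-a') (-d) (i1.le.trans hd) (by simpa using hδ₀.le)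
      (by rw [← norm_neg, neg_sub, sub_neg_eq_add, add_comm, ← sub_neg_eq_add]
          exact i4.le.trans hd)
      (by rw [← abs_neg, neg_sub, sub_neg_eq_add, add_comm, ← sub_neg_eq_add]
          exact i3.le.trans hd) (by rw [abs_neg, abs_of_pos hd0]; exact hd))).2
    have h3 := (abs_le.1 (hnl x')).2
    refine ⟨θ, ?_⟩
    simp only [Fl] at h1 h2 ⊢
    linarith
  · rw [neg_neg]
    exact le_of_tendsto he (Eventually.of_forall fun n => hws n θ 0)
end std

section std
variable {σ : Θ → E N → Matrix (Fin N) (Fin N) ℝ} {H : Θ → E N → E N → ℝ} {C L₁ : ℝ}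

lemma shift_sub {v : E N → ℝ} {c : ℝ}
    (h : SubF σ (Fl 0 fun θ x p => H θ x p - c) (fun x _ => v x)) (κ : ℝ) :
    SubF σ (Fl 0 H) (fun x t => v x + -c * t + κ) := by
  intro θ x t a p X c' ht hX hJ
  have := h θ x t _ p X c' ht hX (UJ_sh (fun _ _ => rfl) hJ)
  simp only [Fl] at this ⊢
  linarith

lemma shift_sup {v : E N → ℝ} {c : ℝ}
    (h : SupF σ (Fl 0 fun θ x p => H θ x p - c) (fun x _ => v x)) (κ : ℝ) :
    SupF σ (Fl 0 H) (fun x t => v x + -c * t + κ) := by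
  intro x t a p X c' ht hX hJ κ' hκ'
  have hJ' := UJ_sh (u := fun x _ => -v x) (b := c) (κ := -κ) (fun _ _ => by ring) hJ
  rw [show -a - c = -(a + c) by ring] at hJ'
  obtain ⟨θ, this⟩ := h x t _ p X c' ht hX hJ' κ' hκ'
  refine ⟨θ, ?_⟩
  simp only [Fl] at this ⊢
  linarith

lemma per_bd {w : E N → ℝ} {Λ : ℝ} (hΛ : 0 ≤ Λ) (hp : ZPeriodic w)
    (h : ∀ x y, w x - w y ≤ Λ * ‖x - y‖) (x : E N) : |w x - w 0| ≤ Λ * Real.sqrt N := by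
  obtain ⟨k, hk⟩ := per_red x
  rw [← show w (x + iv k) = w x from hp x k]
  refine (abs_lip h _ _).trans (mul_le_mul_of_nonneg_left ?_ hΛ)
  rwa [sub_zero]

lemma log_dif {a b d : ℝ} (ha : 1 ≤ a) (hb : 0 < b) (hd : 0 ≤ d) (h : b - a ≤ d) :
    Real.log b - Real.log a ≤ d := by
  have ha0 : 0 < a := by linarith
  rw [← Real.log_div hb.ne' ha0.ne']
  refine (Real.log_le_sub_one_of_pos (div_pos hb ha0)).trans ?_
  rw [sub_le_iff_le_add, div_le_iff₀ ha0]
  have := mul_le_mul_of_nonneg_left ha hd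
  linarith

lemma Std.cp [Nonempty Θ] (S : Std C σ H L₁) {u₀ : E N → ℝ} {L0 : ℝ} (hL0 : 0 ≤ L0)
    (hu₀ : ∀ x y, u₀ x - u₀ y ≤ L0 * ‖x - y‖) (hup : ZPeriodic u₀) :
    ∃ u : E N → ℝ → ℝ, CC u ∧ (∀ t, ZPeriodic fun x => u x t) ∧ (∀ x, u x 0 = u₀ x) ∧
      SubF σ (Fl 0 H) u ∧ SupF σ (Fl 0 H) u ∧
      ∃ Λ, 0 ≤ Λ ∧ ∀ x y t, 0 ≤ t → u x t - u y t ≤ Λ * ‖x - y‖ := by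
  obtain ⟨c, v, hvp, hvl, hv1, hv2, hc⟩ := S.erg
  have hL₁ := S.hL₁
  have hΛ : 0 ≤ Lam N L₁ := mul_nonneg (Real.exp_pos _).le (by linarith)
  set B := Lam N L₁ * Real.sqrt N
  set M0 := |u₀ 0 - v 0| + L0 * Real.sqrt N + B
  set M1 := M0 + |v 0| + B
  have hB : 0 ≤ B := by positivity
  have hM0 : 0 ≤ M0 := by positivity
  have hM1 : 0 ≤ M1 := by positivity
  have h0 : ∀ x, |u₀ x - v x| ≤ M0 := fun x => by
    have h1 := abs_le.1 (per_bd hL0 hup hu₀ x)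
    have h2 := abs_le.1 (per_bd hΛ hvp hvl x)
    have h3 := abs_le.1 (le_refl |u₀ 0 - v 0|)
    simp only [M0]
    exact abs_le.2 ⟨by linarith [h1.1, h2.2, h3.1], by linarith [h1.2, h2.1, h3.2]⟩
  have hvb : ∀ x, |v x| ≤ |v 0| + B := fun x => by
    have h2 := per_bd hΛ hvp hvl x
    have := abs_sub_abs_le_abs_sub (v x) (v 0)
    linarith
  set W := 2 * M1 + 1
  set L := max L₁ L0
  have hL : 0 ≤ L := hL0.trans (le_max_right _ _)
  set R := L * W + Lam N L₁ + 1
  have hLW : 0 ≤ L * W := mul_nonneg hL (by simp only [W]; linarith)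
  have hR : 0 < R := by simp only [R]; linarith
  obtain ⟨K, hKb, hK, hKl⟩ := S.tr_bd hR
  obtain ⟨u, hu, hp, hu0, h1, h2⟩ := CPSOL S.hC S.hσb S.hσl S.hσp (S.tr_eq hR)
    (fun θ p x k => S.hHp θ _ x k) hKb hKl hL0 hu₀ hup
  have hcg := fun Λ (h : Λ ≤ R) θ x p => tr_congr (H := H) (N := N) hR (Λ := Λ) h θ x p
  have hsh : ∀ κ : ℝ, (∀ x y t, 0 ≤ t → (fun x t => v x + -c * t + κ) x t -
      (fun x t => v x + -c * t + κ) y t ≤ Lam N L₁ * ‖x - y‖) := fun κ x y t _ => by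
    linarith [hvl x y]
  have hcv : Continuous v :=
    (LipschitzWith.of_dist_le_mul (K := (Lam N L₁).toNNReal) fun x y => by
      rw [Real.coe_toNNReal _ hΛ, Real.dist_eq, dist_eq_norm]; exact abs_lip hvl x y).continuous
  have hcV : ∀ κ : ℝ, Continuous fun q : E N × ℝ => v q.1 + -c * q.2 + κ := fun κ => by fun_prop
  have hΛR : Lam N L₁ ≤ R := by simp only [R]; linarith
  have hVp : ∀ κ t : ℝ, ZPeriodic fun x : E N => v x + -c * t + κ := fun κ t x k =>
    congrArg (fun z => z + -c * t + κ) (hvp x k)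
  have k1 : ∀ x t, 0 ≤ t → u x t - (v x + -c * t + M0) ≤ 0 := fun x t ht => by
    have := CMP S.hC le_rfl S.hσb S.hσl ((S.tr_eq hR).fl 0) hu.upperSemicontinuous
      (hcV M0).lowerSemicontinuous hp (hVp M0) h1
      (sup_congr hΛ (fun θ x p h => (hcg _ hΛR θ x p h).symm) (hsh M0) (shift_sup hv2 M0)) hK
      (Or.inl hKl) (M := 0) le_rfl
      (fun x => by rw [hu0]; linarith [(abs_le.1 (h0 x)).2]) x t ht
    linarith
  have k2 : ∀ x t, 0 ≤ t → v x + -c * t + -M0 - u x t ≤ 0 := fun x t ht => by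
    have := CMP S.hC le_rfl S.hσb S.hσl ((S.tr_eq hR).fl 0) (hcV (-M0)).upperSemicontinuous
      hu.lowerSemicontinuous (hVp (-M0)) hp
      (sub_congr hΛ (fun θ x p h => (hcg _ hΛR θ x p h).symm) (hsh (-M0)) (shift_sub hv1 (-M0))) h2 hK
      (Or.inl hKl) (M := 0) le_rfl
      (fun x => by rw [hu0]; linarith [(abs_le.1 (h0 x)).1]) x t ht
    linarith
  have hb : ∀ x t, 0 ≤ t → 1 ≤ u x t + c * t - (-M1 - 1) ∧ u x t + c * t - (-M1 - 1) ≤ W :=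
    fun x t ht => by
    have i1 := k1 x t ht
    have i2 := k2 x t ht
    have i3 := abs_le.1 (hvb x)
    simp only [W, M1]
    constructor <;> linarith [i3.1, i3.2]
  have hW : 1 ≤ W := by simp only [W]; linarith
  have hlip : ∀ x y t, 0 ≤ t → u x t - u y t ≤ L * W * ‖x - y‖ := fun x y t ht => by
    have hLn : 0 ≤ L * ‖x - y‖ := by positivity
    have := S.lipu hR (le_max_left _ _) hW (by simp only [R, L]; linarith) hu hp h1 h2 (c' := c)
      (zero_mul _) hb le_rfl (fun θ => by linarith [hc θ]) le_rfl (fun x y => by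
        have e1 := hb x 0 le_rfl
        have e2 := hb y 0 le_rfl
        rw [mul_zero, add_zero] at e1 e2
        rw [add_zero]
        refine log_dif e2.1 (by linarith [e1.1]) (by positivity) ?_
        rw [hu0, hu0]
        have := mul_le_mul_of_nonneg_right (le_max_right L₁ L0) (norm_nonneg (x - y))
        linarith [hu₀ x y]) x y ht
    rw [mul_zero, add_zero] at this
    have := log_lip (by linarith [(hb y t ht).1]) (by linarith [(hb x t ht).1]) (hb x t ht).2 hLn this
    linarith
  have hg := hcg (L * W) (by simp only [R]; linarith)
  exact ⟨u, hu, hp, hu0, sub_congr hLW hg hlip h1, sup_congr hLW hg hlip h2, _, hLW, hlip⟩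

lemma Std.cmp (S : Std C σ H L₁) {lam : ℝ} (hlam : 0 ≤ lam) {U₁ U₂ : E N → ℝ → ℝ}
    (hu : UpperSemicontinuous fun q : E N × ℝ => U₁ q.1 q.2)
    (hl : LowerSemicontinuous fun q : E N × ℝ => U₂ q.1 q.2)
    (hp₁ : ∀ t : ℝ, ZPeriodic fun x => U₁ x t) (hp₂ : ∀ t : ℝ, ZPeriodic fun x => U₂ x t)
    (h1 : SubF σ (Fl lam H) U₁) (h2 : SupF σ (Fl lam H) U₂)
    (hreg : (∃ L : NNReal, ∀ t : ℝ, 0 ≤ t → LipschitzWith L fun x => U₁ x t) ∨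
        (∃ L : NNReal, ∀ t : ℝ, 0 ≤ t → LipschitzWith L fun x => U₂ x t)) {M : ℝ}
    (hM : 0 ≤ M) (h0 : ∀ x, U₁ x 0 - U₂ x 0 ≤ M) (x : E N) {t : ℝ} (ht : 0 ≤ t) :
    U₁ x t - U₂ x t ≤ Real.exp (-lam * t) * M := by
  obtain ⟨L, hL⟩ : ∃ L : NNReal, ((∀ x y t, 0 ≤ t → U₁ x t - U₁ y t ≤ L * ‖x - y‖) ∨
      (∀ x y t, 0 ≤ t → U₂ x t - U₂ y t ≤ L * ‖x - y‖)) := by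
    rcases hreg with ⟨L, h⟩ | ⟨L, h⟩
    · exact ⟨L, Or.inl fun x y t ht => (le_abs_self _).trans (by
        simpa [Real.dist_eq, dist_eq_norm] using (h t ht).dist_le_mul x y)⟩
    · exact ⟨L, Or.inr fun x y t ht => (le_abs_self _).trans (by
        simpa [Real.dist_eq, dist_eq_norm] using (h t ht).dist_le_mul x y)⟩
  obtain ⟨K, hK, hl'⟩ := S.hHl (2 * L + 1) (by positivity)
  refine CMP S.hC hlam S.hσb S.hσl (S.eq.fl lam) hu hl hp₁ hp₂ h1 h2 hK.le
    (Or.inr ⟨L, L.2, fun θ x y p hp => ?_, hL⟩) hM h0 x t ht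
  have := hl' θ x y p p (by linarith) (by linarith)
  rwa [sub_self, norm_zero, add_zero] at this
end std

theorem statement18
    {N : ℕ} {Θ : Type*} [MetricSpace Θ] [Nonempty Θ]
    (C : ℝ) (hC : 0 < C)
    (σm : Θ → E N → Matrix (Fin N) (Fin N) ℝ)
    (A : Θ → E N → Matrix (Fin N) (Fin N) ℝ)
    -- (H1)
    (hA : ∀ (θ : Θ) (x : E N), A θ x = σm θ x * (σm θ x)ᵀ)
    (hσper : ∀ θ : Θ, ZPeriodic (σm θ))
    (hσbd : ∀ (θ : Θ) (x : E N) (i j : Fin N), |σm θ x i j| ≤ C)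
    (hσlip : ∀ (θ : Θ) (i j : Fin N), LipschitzWith C.toNNReal fun x : E N => σm θ x i j)
    (H : Θ → E N → E N → ℝ)
    -- (H2)
    (hHper : ∀ (θ : Θ) (p : E N), ZPeriodic fun x => H θ x p)
    (hH0 : ∀ (θ : Θ) (x : E N), |H θ x 0| ≤ C)
    (hHlip : ∀ R > (0:ℝ), ∃ CR > (0:ℝ), ∀ (θ : Θ) (x y p q : E N),
      ‖p‖ ≤ R → ‖q‖ ≤ R → |H θ x p - H θ y q| ≤ CR * (‖x - y‖ + ‖p - q‖))
    -- (BS): superlinearity condition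
    (L₁ : ℝ) (hL₁ : 1 ≤ L₁)
    (hBS : ∀ θ : Θ, ∀ᵐ z : E N × E N ∂MeasureTheory.volume, L₁ ≤ ‖z.2‖ →
      0 ≤ L₁ * ((fderiv ℝ (fun p => H θ z.1 p) z.2) z.2 - H θ z.1 z.2
            - (⨆ w : Metric.closedBall (0 : E N) 1,
                mnorm ((2:ℝ) • (σm θ z.1 * Matrix.of fun i j =>
                  fderiv ℝ (fun y => σm θ y j i) z.1 (w : E N)))) * ‖z.2‖
            - (⨆ y : E N, |H θ y 0|))
          - ‖fderiv ℝ (fun y => H θ y z.2) z.1‖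
          - (N : ℝ) * (⨆ w : E N × Metric.closedBall (0 : E N) 1,
              mnorm (Matrix.of fun i j =>
                fderiv ℝ (fun y => σm θ y i j) w.1 (w.2 : E N)))^2 * ‖z.2‖) :
    -- (a) existence of Lipschitz solutions of (CP) and of the discounted problems
    (∀ u₀ : E N → ℝ, ZPeriodic u₀ → (∃ L : NNReal, LipschitzWith L u₀) →
      ∃ u : E N → ℝ → ℝ,
        ContinuousOn (fun q : E N × ℝ => u q.1 q.2) (Set.univ ×ˢ Set.Ici 0) ∧
        (∀ t : ℝ, ZPeriodic fun x => u x t) ∧ (∀ x : E N, u x 0 = u₀ x) ∧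
        IsSolCP A H u ∧
        ∃ L' : NNReal, ∀ t : ℝ, 0 ≤ t → LipschitzWith L' fun x => u x t) ∧
    (∃ L'' : NNReal, ∀ lam > (0:ℝ), ∃ w : E N → ℝ, ZPeriodic w ∧ Continuous w ∧
      IsSolDisc A H lam w ∧ LipschitzWith L'' w) ∧
    -- (b) comparison principle for (CP)
    (∀ u₁ u₂ : E N → ℝ → ℝ,
      (∀ t : ℝ, ZPeriodic fun x => u₁ x t) → (∀ t : ℝ, ZPeriodic fun x => u₂ x t) →
      UpperSemicontinuous (fun q : E N × ℝ => u₁ q.1 q.2) →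
      LowerSemicontinuous (fun q : E N × ℝ => u₂ q.1 q.2) →
      IsSubSolCP A H u₁ → IsSuperSolCP A H u₂ →
      ((∃ L : NNReal, ∀ t : ℝ, 0 ≤ t → LipschitzWith L fun x => u₁ x t) ∨
        (∃ L : NNReal, ∀ t : ℝ, 0 ≤ t → LipschitzWith L fun x => u₂ x t)) →
      ∀ (x : E N) (t : ℝ), 0 ≤ t →
        u₁ x t - u₂ x t ≤ sSup (Set.range fun y : E N => max (u₁ y 0 - u₂ y 0) 0)) ∧
    -- (b') comparison principle for the discounted stationary equations
    (∀ lam > (0:ℝ), ∀ w₁ w₂ : E N → ℝ, ZPeriodic w₁ → ZPeriodic w₂ →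
      UpperSemicontinuous w₁ → LowerSemicontinuous w₂ →
      IsSubSolDisc A H lam w₁ → IsSuperSolDisc A H lam w₂ →
      ((∃ L : NNReal, LipschitzWith L w₁) ∨ (∃ L : NNReal, LipschitzWith L w₂)) →
      ∀ x : E N, w₁ x ≤ w₂ x) ∧
    -- (c) solvability of the ergodic problem
    (∃ (c : ℝ) (v : E N → ℝ), ZPeriodic v ∧ (∃ L : NNReal, LipschitzWith L v) ∧
      IsSolErg A H c v) := by
  have hC0 := hC.le
  have S : Std C σm H L₁ := ⟨hC0, hσper, hσbd, hσlip, hHper, hH0, hHlip, hL₁,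
    fun θ _ _ _ _ hr hk0 hk _ _ _ hp hd hxy => PATH hC0 (hσbd θ) (hσlip θ)
      (fun R hR => (hHlip R hR).imp fun _ h => ⟨h.1, fun x y p q => h.2 θ x y p q⟩) hL₁ (hBS θ)
      hr hk0 hk hp hd hxy⟩
  have hΛ : 0 ≤ Lam N L₁ := mul_nonneg (Real.exp_pos _).le (by linarith)
  have lipw : ∀ {Λ : ℝ} {w : E N → ℝ}, 0 ≤ Λ → (∀ x y, w x - w y ≤ Λ * ‖x - y‖) →
      LipschitzWith Λ.toNNReal w := fun {Λ w} h0 h => LipschitzWith.of_dist_le_mul fun x y => by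
    rw [Real.coe_toNNReal _ h0, Real.dist_eq, dist_eq_norm]; exact abs_lip h x y
  have uscs : ∀ {w : E N → ℝ}, UpperSemicontinuous w →
      UpperSemicontinuous fun q : E N × ℝ => w q.1 := fun h => h.comp continuous_fst
  have lscs : ∀ {w : E N → ℝ}, LowerSemicontinuous w →
      LowerSemicontinuous fun q : E N × ℝ => w q.1 := fun h => h.comp continuous_fst
  refine ⟨?_, ⟨(Lam N L₁).toNNReal, ?_⟩, ?_, ?_, ?_⟩
  · rintro u₀ hup ⟨L, hL⟩
    obtain ⟨u, hu, hp, hu0, h1, h2, Λ, hΛ', hl⟩ := S.cp L.2 (fun x y => (le_abs_self _).trans (by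
        simpa [Real.dist_eq, dist_eq_norm] using hL.dist_le_mul x y)) hup
    exact ⟨u, hu.continuousOn, hp, hu0, ⟨subCP_of hA hσbd h1, supCP_of hA hσbd S.hb h2⟩,
      Λ.toNNReal, fun t ht => lipw hΛ' fun x y => hl x y t ht⟩
  · intro lam hlam
    obtain ⟨w, hwp, hwl, h1, h2, -, -⟩ := S.stat hlam
    have e : Fl lam H = Fl lam fun θ x p => H θ x p - 0 := by simp only [sub_zero]
    rw [e] at h1 h2
    refine ⟨w, hwp, (lipw hΛ hwl).continuous, ⟨fun φ hφ x hm => ?_, fun φ hφ x hm => ?_⟩, lipw hΛ hwl⟩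
    · simpa only [sub_zero] using subD_of hA hσbd h1 hφ hm
    · simpa only [sub_zero] using supD_of hA hσbd S.hb h2 hφ hm
  · intro u₁ u₂ hp₁ hp₂ hu hl h1 h2 hreg x t ht
    obtain ⟨M₁, hM₁⟩ := usc_bdd hu hp₁ 0
    obtain ⟨M₂, hM₂⟩ := usc_bdd (U := fun x t => -u₂ x t) (usc_neg hl)
      (fun t x k => congrArg Neg.neg (hp₂ t x k)) 0
    have hbd : BddAbove (Set.range fun y : E N => max (u₁ y 0 - u₂ y 0) 0) :=
      ⟨max (M₁ + M₂) 0, by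
        rintro _ ⟨y, rfl⟩
        exact max_le_max (by linarith [hM₁ y 0 le_rfl le_rfl, hM₂ y 0 le_rfl le_rfl]) le_rfl⟩
    have := S.cmp le_rfl hu hl hp₁ hp₂ (of_subCP hA hσbd S.hb h1) (of_supCP hA h2) hreg
      ((le_max_right _ _).trans (le_csSup hbd ⟨0, rfl⟩))
      (fun y => (le_max_left _ _).trans (le_csSup hbd ⟨y, rfl⟩)) x ht
    rwa [neg_zero, zero_mul, Real.exp_zero, one_mul] at this
  · intro lam hlam w₁ w₂ hp₁ hp₂ hu hl h1 h2 hreg x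
    obtain ⟨M₁, hM₁⟩ := usc_bdd (U := fun x _ => w₁ x) (uscs hu) (fun _ => hp₁) 0
    obtain ⟨M₂, hM₂⟩ := usc_bdd (U := fun x _ => -w₂ x) (usc_neg (lscs hl))
      (fun t x k => congrArg Neg.neg (hp₂ x k)) 0
    rw [← sub_nonpos]
    refine exp_lim (M := max (M₁ + M₂) 0) hlam fun t ht => ?_
    exact S.cmp hlam.le (U₁ := fun x _ => w₁ x) (U₂ := fun x _ => w₂ x) (uscs hu) (lscs hl)
      (fun _ => hp₁) (fun _ => hp₂) (of_subD hA hσbd S.hb h1) (of_supD hA h2)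
      (hreg.imp (fun ⟨L, h⟩ => ⟨L, fun _ _ => h⟩) (fun ⟨L, h⟩ => ⟨L, fun _ _ => h⟩))
      (le_max_right (M₁ + M₂) 0) (fun y => (le_max_left _ _).trans' (by
        linarith [hM₁ y 0 le_rfl le_rfl, hM₂ y 0 le_rfl le_rfl])) x ht
  · obtain ⟨c, v, hvp, hvl, h1, h2, -⟩ := S.erg
    refine ⟨c, v, hvp, ⟨_, lipw hΛ hvl⟩, fun φ hφ x hm => ?_, fun φ hφ x hm => ?_⟩
    · linarith [subD_of hA hσbd h1 hφ hm]
    · linarith [supD_of hA hσbd S.hb h2 hφ hm]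

end LargeTimeBehavior
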